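/- (Theorem B) Let μ > 0 and let (γ₁,γ₂) be a generic μ-admissible pair of closed regular curves in S² with periods l₁, l₂ > 0, parametrized so that |γᵢ'(s)|²(1+κᵢ(s)²) = 4 for i = 1,2, with lifts c₁, c₂ and associated map f_{γ₁,γ₂}. Assume either (a) the number of crossings #(γ₁) or #(γ₂) is even, or (b) both #(γ₁) and #(γ₂) are odd, the restriction of γ₁ to some closed interval is a negative shell, and the restriction of γ₂ to some closed interval is a positive shell. Then there exist (s₁,s₂), (u₁,u₂) ∈ ℝ² with f_{γ₁,γ₂}(u₁,u₂) = −f_{γ₁,γ₂}(s₁,s₂); equivalently, the extrinsic diameter of the image of f_{γ₁,γ₂} in S³ equals π. -/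

import Mathlib

noncomputable section

open Matrix

/-- Euclidean 3-space (as triples of reals). -/
abbrev R3 : Type := Fin 3 → ℝ

/-- The Euclidean inner product on ℝ³. -/
def dot3 (a b : R3) : ℝ := a 0 * b 0 + a 1 * b 1 + a 2 * b 2

/-- The Euclidean norm on ℝ³. -/
def norm3 (a : R3) : ℝ := Real.sqrt (dot3 a a)

/-- The cross product on ℝ³. -/
def cross3 (a b : R3) : R3 :=
  ![a 1 * b 2 - a 2 * b 1, a 2 * b 0 - a 0 * b 2, a 0 * b 1 - a 1 * b 0]

/-- The determinant of three vectors in ℝ³. -/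
def det3 (a b c : R3) : ℝ := dot3 a (cross3 b c)

/-- `γ : ℝ → ℝ³` is a regular curve in the unit sphere S²:
it is smooth, takes values in S², and has nowhere-vanishing derivative. -/
structure IsRegularCurve (γ : ℝ → R3) : Prop where
  smooth : ContDiff ℝ (⊤ : ℕ∞) γ
  sphere : ∀ s, dot3 (γ s) (γ s) = 1
  reg : ∀ s, deriv γ s ≠ 0

/-- The geodesic curvature `κ(s) = det(γ, γ', γ'')/|γ'|³` of a curve in S². -/
def kappa (γ : ℝ → R3) (s : ℝ) : ℝ :=
  det3 (γ s) (deriv γ s) (deriv (deriv γ) s) / norm3 (deriv γ s) ^ 3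

/-- The unit normal `n(s) = (γ × γ')/|γ'|` of a curve in S². -/
def unitNormal (γ : ℝ → R3) (s : ℝ) : R3 :=
  (norm3 (deriv γ s))⁻¹ • cross3 (γ s) (deriv γ s)

/-- `γ` is closed of period `l > 0`. -/
def HasPeriod (γ : ℝ → R3) (l : ℝ) : Prop := 0 < l ∧ ∀ s, γ (s + l) = γ s

/-- 2×2 complex matrices. -/
abbrev Mat2 := Matrix (Fin 2) (Fin 2) ℂ

def E1 : Mat2 := !![0, Complex.I; Complex.I, 0]
def E2 : Mat2 := !![0, -1; 1, 0]
def E3 : Mat2 := !![Complex.I, 0; 0, -Complex.I]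

/-- The identification of ℝ³ with su(2) via the orthonormal basis e₁, e₂, e₃. -/
def toSu2 (v : R3) : Mat2 := (v 0 : ℂ) • E1 + (v 1 : ℂ) • E2 + (v 2 : ℂ) • E3

/-- The adjoint action `Ad(a)x = a x a⁻¹`. -/
def AdM (a x : Mat2) : Mat2 := a * x * a⁻¹

/-- `c : ℝ → SU(2)` is a lift of the regular curve `γ` in S²:
it is smooth (entrywise), takes values in SU(2), and satisfies
`Ad(c(s))e₃ = γ(s)` and `Ad(c(s))e₁ = γ'(s)/|γ'(s)|` under `toSu2`. -/
structure IsLift (γ : ℝ → R3) (c : ℝ → Mat2) : Prop where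
  mem : ∀ s, c s ∈ Matrix.specialUnitaryGroup (Fin 2) ℂ
  smooth : ∀ i j, ContDiff ℝ (⊤ : ℕ∞) fun s => c s i j
  ad3 : ∀ s, AdM (c s) E3 = toSu2 (γ s)
  ad1 : ∀ s, AdM (c s) E1 = toSu2 ((norm3 (deriv γ s))⁻¹ • deriv γ s)

/-- The entrywise derivative of a matrix-valued curve. -/
def matDeriv (c : ℝ → Mat2) (s : ℝ) : Mat2 :=
  Matrix.of fun i j => deriv (fun t => c t i j) s

/-- The map `f_{γ₁,γ₂}(s₁,s₂) = c₁(0)⁻¹ c₁(s₁) c₂(s₂)⁻¹ c₂(0)` associated to lifts `c₁, c₂`. -/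
def fmap (c1 c2 : ℝ → Mat2) (s1 s2 : ℝ) : Mat2 :=
  (c1 0)⁻¹ * c1 s1 * (c2 s2)⁻¹ * c2 0

/-- `(γ₁, γ₂)` is an admissible pair. -/
structure IsAdmissiblePair (γ1 γ2 : ℝ → R3) : Prop where
  reg1 : IsRegularCurve γ1
  reg2 : IsRegularCurve γ2
  param1 : ∀ s, norm3 (deriv γ1 s) ^ 2 * (1 + kappa γ1 s ^ 2) = 4
  param2 : ∀ s, norm3 (deriv γ2 s) ^ 2 * (1 + kappa γ2 s ^ 2) = 4
  curv : ∀ s1 s2, kappa γ2 s2 < kappa γ1 s1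

/-- The restriction of `γ` to `[a,b]` is a shell. -/
def IsShell (γ : ℝ → R3) (a b : ℝ) : Prop :=
  a < b ∧ Set.InjOn γ (Set.Ico a b) ∧ γ a = γ b ∧
    LinearIndependent ℝ ![deriv γ a, deriv γ b]

/-- A positive shell: `det(γ(a), γ'(a), γ'(b)) < 0`. -/
def IsPositiveShell (γ : ℝ → R3) (a b : ℝ) : Prop :=
  IsShell γ a b ∧ det3 (γ a) (deriv γ a) (deriv γ b) < 0

/-- A negative shell: `det(γ(a), γ'(a), γ'(b)) > 0`. -/
def IsNegativeShell (γ : ℝ → R3) (a b : ℝ) : Prop :=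
  IsShell γ a b ∧ 0 < det3 (γ a) (deriv γ a) (deriv γ b)

/-- The unit sphere S² in ℝ³. -/
def sphere2 : Set R3 := {x | dot3 x x = 1}

/-- The μ-circle with center `o ∈ S²`. -/
def muCircle (μ : ℝ) (o : R3) : Set R3 :=
  {x | dot3 x x = 1 ∧ dot3 x o = μ / Real.sqrt (1 + μ ^ 2)}

/-- The (open) interior domain of the μ-circle with center `o ∈ S²`. -/
def muDisk (μ : ℝ) (o : R3) : Set R3 :=
  {x | dot3 x x = 1 ∧ μ / Real.sqrt (1 + μ ^ 2) < dot3 x o}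

def normalize3 (v : R3) : R3 := (norm3 v)⁻¹ • v

/-- `Δ` is the interior domain of the shell `γ|_{[a,b]}`: it is a connected component of the
complement of the image of the shell in S², and for each `s ∈ (a,b)` the points obtained by
pushing `γ(s)` slightly in the direction `σ • n(s)` (σ = 1 for a positive shell, σ = -1 for a
negative shell) belong to `Δ`. -/
def IsInteriorDomain (γ : ℝ → R3) (a b σ : ℝ) (Δ : Set R3) : Prop :=
  (∃ p ∈ sphere2 \ γ '' Set.Icc a b,
      Δ = connectedComponentIn (sphere2 \ γ '' Set.Icc a b) p) ∧
    ∀ s ∈ Set.Ioo a b, ∃ ε > 0, ∀ δ ∈ Set.Ioo (0 : ℝ) ε,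
      normalize3 (γ s + (σ * δ) • unitNormal γ s) ∈ Δ

/-- The center `o_t = (μ γ(t) + n(t))/√(1+μ²)` of the tangent μ-circle to `γ` at `γ(t)`
on the normal side. -/
def tangentCenter (μ : ℝ) (γ : ℝ → R3) (t : ℝ) : R3 :=
  (Real.sqrt (1 + μ ^ 2))⁻¹ • (μ • γ t + unitNormal γ t)

/-- The rotation of ℝ³ through angle `θ` about the oriented (unit) axis `o`. -/
def rot3 (o : R3) (θ : ℝ) (x : R3) : R3 :=
  Real.cos θ • x + Real.sin θ • cross3 o x + ((1 - Real.cos θ) * dot3 o x) • o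

/-- A closed regular curve of period `l` is generic: every self-intersection is a
transversal double point. -/
def IsGeneric (γ : ℝ → R3) (l : ℝ) : Prop :=
  ∀ s t : ℝ, γ s = γ t → (¬∃ k : ℤ, s - t = k * l) →
    LinearIndependent ℝ ![deriv γ s, deriv γ t] ∧
      ∀ u : ℝ, γ u = γ s → (∃ k : ℤ, u - s = k * l) ∨ (∃ k : ℤ, u - t = k * l)

/-- The number of crossings (self-intersection points) of a closed curve of period `l`. -/
def crossings (γ : ℝ → R3) (l : ℝ) : ℕ :=
  Set.ncard {p : R3 | ∃ s t : ℝ, γ s = p ∧ γ t = p ∧ ¬∃ k : ℤ, s - t = k * l}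

/-- The spherical (geodesic) distance on S³, identified with SU(2):
`dist(A,B) = arccos(Re trace(A Bᴴ)/2)`, which corresponds to the round distance on the
unit sphere S³ ⊂ ℝ⁴. -/
def distS3 (A B : Mat2) : ℝ := Real.arccos ((Matrix.trace (A * Bᴴ)).re / 2)

/-- The extrinsic diameter of the image of the map `f` associated to the lifts `c₁, c₂`. -/
def extDiam (c1 c2 : ℝ → Mat2) : ℝ :=
  sSup {d : ℝ | ∃ s1 s2 u1 u2 : ℝ, d = distS3 (fmap c1 c2 s1 s2) (fmap c1 c2 u1 u2)}

/-- The parallel curve `γ^θ = (cos θ) γ + (sin θ) n`. -/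
def parallelCurve (γ : ℝ → R3) (θ : ℝ) (s : ℝ) : R3 :=
  Real.cos θ • γ s + Real.sin θ • unitNormal γ s

/-- The arclength-type parameter `s(t) = (1/2)∫₀ᵗ |γ'(u)|√(1+κ(u)²) du`. -/
def arcParam (γ : ℝ → R3) (t : ℝ) : ℝ :=
  (1 / 2) * ∫ u in (0 : ℝ)..t, norm3 (deriv γ u) * Real.sqrt (1 + kappa γ u ^ 2)

open scoped ComplexConjugate

/-- A nonvanishing continuous function on a simply connected space has a continuous logarithm. -/
theorem exists_continuous_log {X : Type*} [TopologicalSpace X] [SimplyConnectedSpace X]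
    [LocallyPathConnectedSpace X] {F : X → ℂ} (hF : Continuous F) (h0 : ∀ x, F x ≠ 0) :
    ∃ L : X → ℂ, Continuous L ∧ ∀ x, Complex.exp (L x) = F x := by
  obtain ⟨x0⟩ : Nonempty X := inferInstance
  obtain ⟨L, ⟨-, hL⟩, -⟩ := Complex.isCoveringMapOn_exp.existsUnique_continuousMap_lifts
    ⟨F, hF⟩ (Complex.exp_log (h0 x0)) h0
  exact ⟨L, L.continuous, fun x => congrFun hL x⟩

/-- A nonvanishing continuous function on a retract of a simply connected space has a continuous
logarithm. -/
theorem exists_continuous_log_of_retract {X : Type*} [TopologicalSpace X] [SimplyConnectedSpace X]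
    [LocallyPathConnectedSpace X] {S : Set X} {ρ : X → X} (hρ : Continuous ρ)
    (hρS : ∀ x, ρ x ∈ S) (hid : ∀ x ∈ S, ρ x = x) {F : X → ℂ} (hF : ContinuousOn F S)
    (h0 : ∀ x ∈ S, F x ≠ 0) :
    ∃ L : X → ℂ, Continuous L ∧ ∀ x ∈ S, Complex.exp (L x) = F x := by
  obtain ⟨L, hL, he⟩ := exists_continuous_log (hF.comp_continuous hρ hρS)
    (fun x => h0 _ (hρS x))
  exact ⟨L, hL, fun x hx => by rw [he, Function.comp_apply, hid x hx]⟩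

theorem exists_continuous_log_Icc {a b : ℝ} (hab : a ≤ b) {F : ℝ → ℂ}
    (hF : ContinuousOn F (Set.Icc a b)) (h0 : ∀ x ∈ Set.Icc a b, F x ≠ 0) :
    ∃ L : ℝ → ℂ, Continuous L ∧ ∀ x ∈ Set.Icc a b, Complex.exp (L x) = F x := by
  refine exists_continuous_log_of_retract (S := Set.Icc a b)
    (ρ := fun x => max a (min b x)) (by fun_prop)
    (fun x => ⟨le_max_left _ _, max_le hab (min_le_left _ _)⟩) (fun x hx => ?_) hF h0
  rw [min_eq_right hx.2, max_eq_right hx.1]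

theorem exists_continuous_log_triangle {a b : ℝ} (hab : a ≤ b) {F : ℝ × ℝ → ℂ}
    (hF : ContinuousOn F {x | a ≤ x.1 ∧ x.1 ≤ x.2 ∧ x.2 ≤ b})
    (h0 : ∀ s u, a ≤ s → s ≤ u → u ≤ b → F (s, u) ≠ 0) :
    ∃ L : ℝ × ℝ → ℂ, Continuous L ∧
      ∀ s u, a ≤ s → s ≤ u → u ≤ b → Complex.exp (L (s, u)) = F (s, u) := by
  let ρ : ℝ × ℝ → ℝ × ℝ :=
    fun x => (max a (min b x.1), max (max a (min b x.1)) (max a (min b x.2)))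
  have hid : ∀ x ∈ {x : ℝ × ℝ | a ≤ x.1 ∧ x.1 ≤ x.2 ∧ x.2 ≤ b}, ρ x = x := by
    rintro x ⟨h1, h2, h3⟩
    ext
    · simp [ρ, min_eq_right (h2.trans h3), max_eq_right h1]
    · simp [ρ, min_eq_right (h2.trans h3), max_eq_right h1, min_eq_right h3,
        max_eq_right (h1.trans h2), max_eq_right h2]
  obtain ⟨L, hL, he⟩ := exists_continuous_log_of_retract
    (S := {x : ℝ × ℝ | a ≤ x.1 ∧ x.1 ≤ x.2 ∧ x.2 ≤ b}) (ρ := ρ)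
    (by fun_prop) (fun x => ⟨le_max_left _ _, le_max_left _ _,
      max_le (max_le hab (min_le_left _ _)) (max_le hab (min_le_left _ _))⟩) hid hF
      (fun x hx => h0 _ _ hx.1 hx.2.1 hx.2.2)
  exact ⟨L, hL, fun s u h1 h2 h3 => he _ ⟨h1, h2, h3⟩⟩

/-- A continuous function with constant exponential on a preconnected set is constant there. -/
theorem eq_of_exp_eq {X : Type*} [TopologicalSpace X] {S : Set X} (hS : IsPreconnected S)
    {f : X → ℂ} (hf : ContinuousOn f S) {c : ℂ} (hc : ∀ x ∈ S, Complex.exp (f x) = c)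
    {x y : X} (hx : x ∈ S) (hy : y ∈ S) : f x = f y := by
  obtain ⟨n, hn⟩ := Complex.exp_eq_exp_iff_exists_int.1 ((hc x hx).trans (hc y hy).symm)
  have key : ∀ w ∈ S, ∃ m : ℤ, (f w).im = (f y).im + m * (2 * Real.pi) := fun w hw => by
    obtain ⟨m, hm⟩ := Complex.exp_eq_exp_iff_exists_int.1 ((hc w hw).trans (hc y hy).symm)
    exact ⟨m, by rw [hm]; simp⟩
  have hg : ContinuousOn (fun x => (f x).im) S := Complex.continuous_im.comp_continuousOn hf
  have himage := (hS.image _ hg).ordConnected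
  have hpi := Real.pi_pos
  have hn' : (f x).im = (f y).im + n * (2 * Real.pi) := by rw [hn]; simp
  have aux : ∀ t, t ∈ (fun x => (f x).im) '' S → t ≠ (f y).im + Real.pi ∧
      t ≠ (f y).im - Real.pi := by
    rintro t ⟨w, hw, rfl⟩
    obtain ⟨m, hm⟩ := key w hw
    simp only [hm]
    constructor
    · intro h
      have h1 : ((m * 2 : ℤ) : ℝ) * Real.pi = (1 : ℤ) * Real.pi := by push_cast; linarith
      have := Int.cast_injective (mul_right_cancel₀ hpi.ne' h1)
      omega
    · intro h
      have h1 : ((m * 2 : ℤ) : ℝ) * Real.pi = (-1 : ℤ) * Real.pi := by push_cast; linarith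
      have := Int.cast_injective (mul_right_cancel₀ hpi.ne' h1)
      omega
  rcases lt_trichotomy n 0 with h | h | h
  · exfalso
    have : (n : ℝ) ≤ -1 := by exact_mod_cast Int.le_sub_one_of_lt h
    refine (aux _ (himage.out ⟨x, hx, rfl⟩ ⟨y, hy, rfl⟩ ⟨?_, ?_⟩)).2 rfl
    · simp only [hn']; nlinarith
    · simp only; linarith
  · rw [hn, h]; simp
  · exfalso
    have : (1 : ℝ) ≤ n := by exact_mod_cast h
    refine (aux _ (himage.out ⟨y, hy, rfl⟩ ⟨x, hx, rfl⟩ ⟨?_, ?_⟩)).1 rfl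
    · simp only; linarith
    · simp only [hn']; nlinarith

/-- The determinant of two spinors. -/
def det2 (x y : ℂ × ℂ) : ℂ := x.1 * y.2 - x.2 * y.1

/-- The Hermitian product of two spinors. -/
def herm (x y : ℂ × ℂ) : ℂ := conj x.1 * y.1 + conj x.2 * y.2

/-- The quaternionic product: `y ↦ act x y` is multiplication by the matrix in `ℝ·SU(2)` with first
column `x`. -/
def act (x y : ℂ × ℂ) : ℂ × ℂ := (x.1 * y.1 - conj x.2 * y.2, x.2 * y.1 + conj x.1 * y.2)

theorem det2_swap (x y : ℂ × ℂ) : det2 y x = -det2 x y := by simp only [det2]; ring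

theorem herm_swap (x y : ℂ × ℂ) : herm y x = conj (herm x y) := by
  simp only [herm, map_add, map_mul, Complex.conj_conj]; ring

theorem det2_self (x : ℂ × ℂ) : det2 x x = 0 := by simp only [det2]; ring

@[fun_prop]
theorem Continuous.det2 {X : Type*} [TopologicalSpace X] {f g : X → ℂ × ℂ} (hf : Continuous f)
    (hg : Continuous g) : Continuous fun x => det2 (f x) (g x) := by
  unfold _root_.det2; fun_prop

@[fun_prop]
theorem Continuous.herm {X : Type*} [TopologicalSpace X] {f g : X → ℂ × ℂ} (hf : Continuous f)
    (hg : Continuous g) : Continuous fun x => herm (f x) (g x) := by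
  unfold _root_.herm; fun_prop

@[fun_prop]
theorem Continuous.act {X : Type*} [TopologicalSpace X] {f g : X → ℂ × ℂ} (hf : Continuous f)
    (hg : Continuous g) : Continuous fun x => act (f x) (g x) := by
  unfold _root_.act; fun_prop

/-- Expansion of `det2 s η` in the frame of the unit spinor `x`. -/
theorem det2_eq_of_unit {x : ℂ × ℂ} (hx : herm x x = 1) (s η : ℂ × ℂ) :
    det2 s η = herm x η * det2 s x + det2 x η * herm x s := by
  have : det2 s η = det2 s η * herm x x := by rw [hx, mul_one]
  rw [this]; simp only [herm, det2]; ring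

theorem normSq_herm_add_det2 {x y : ℂ × ℂ} (hx : herm x x = 1) :
    Complex.normSq (herm x y) + Complex.normSq (det2 x y) =
      Complex.normSq y.1 + Complex.normSq y.2 := by
  have h : (Complex.normSq x.1 : ℂ) + Complex.normSq x.2 = 1 := by
    rw [← hx, herm, Complex.normSq_eq_conj_mul_self, Complex.normSq_eq_conj_mul_self]
  have h' : Complex.normSq x.1 + Complex.normSq x.2 = 1 := by exact_mod_cast h
  have : Complex.normSq y.1 + Complex.normSq y.2 =
    (Complex.normSq x.1 + Complex.normSq x.2) * (Complex.normSq y.1 + Complex.normSq y.2) := by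
    rw [h', one_mul]
  rw [this]
  simp only [herm, det2, Complex.normSq_apply, Complex.add_re, Complex.add_im, Complex.mul_re,
    Complex.mul_im, Complex.sub_re, Complex.sub_im, Complex.conj_re, Complex.conj_im]
  ring

/-- A curve of unit spinors obtained by lifting a regular curve with speed `2 V` and geodesic
curvature `κ` to `SU(2)`. -/
structure SpinorCurve (ξ : ℝ → ℂ × ℂ) (V κ : ℝ → ℝ) : Prop where
  d1 : ∀ s, HasDerivAt (fun s => (ξ s).1)
    (V s * (Complex.I * κ s * (ξ s).1 - conj (ξ s).2)) s
  d2 : ∀ s, HasDerivAt (fun s => (ξ s).2)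
    (V s * (Complex.I * κ s * (ξ s).2 + conj (ξ s).1)) s
  unit : ∀ s, herm (ξ s) (ξ s) = 1
  V_pos : ∀ s, 0 < V s
  V_cont : Continuous V
  κ_cont : Continuous κ

theorem exists_continuous_divided {H h : ℝ × ℝ → ℂ} (hh : Continuous h)
    (hd : ∀ s u, HasDerivAt (fun v => H (s, v)) (h (s, u)) u) (h0 : ∀ s, H (s, s) = 0) :
    ∃ Q : ℝ × ℝ → ℂ, Continuous Q ∧ (∀ s u : ℝ, H (s, u) = (u - s : ℝ) * Q (s, u)) ∧
      ∀ s, Q (s, s) = h (s, s) := by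
  refine ⟨fun x => ∫ t in (0 : ℝ)..1, h (x.1, x.1 + t * (x.2 - x.1)), ?_, fun s u => ?_,
    fun s => by simp⟩
  · exact intervalIntegral.continuous_parametric_intervalIntegral_of_continuous'
      (f := fun (x : ℝ × ℝ) (t : ℝ) => h (x.1, x.1 + t * (x.2 - x.1)))
      (by unfold Function.uncurry; fun_prop) 0 1
  · have hs : ∀ t ∈ Set.uIcc (0 : ℝ) 1, HasDerivAt (fun t : ℝ => H (s, s + t * (u - s)))
        ((u - s) • h (s, s + t * (u - s))) t := fun t _ => by
      have h1 : HasDerivAt (fun t : ℝ => s + t * (u - s)) (u - s) t := by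
        simpa using ((hasDerivAt_id t).mul_const (u - s)).const_add s
      exact (hd s (s + t * (u - s))).scomp t h1
    have h2 := intervalIntegral.integral_eq_sub_of_hasDerivAt hs
      (Continuous.intervalIntegrable (by fun_prop) _ _)
    rw [intervalIntegral.integral_smul] at h2
    simpa [h0] using h2.symm

namespace SpinorCurve

variable {ξ : ℝ → ℂ × ℂ} {V κ : ℝ → ℝ}

theorem cont (hξ : SpinorCurve ξ V κ) : Continuous ξ :=
  (continuous_iff_continuousAt.2 fun s => (hξ.d1 s).continuousAt).prodMk
    (continuous_iff_continuousAt.2 fun s => (hξ.d2 s).continuousAt)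

theorem hasDerivAt_det2 (hξ : SpinorCurve ξ V κ) (x : ℂ × ℂ) (u : ℝ) :
    HasDerivAt (fun u => det2 x (ξ u))
      (V u * (Complex.I * κ u * det2 x (ξ u) + conj (herm x (ξ u)))) u := by
  refine (((hξ.d2 u).const_mul x.1).sub ((hξ.d1 u).const_mul x.2)).congr_deriv ?_
  simp only [det2, herm, map_add, map_mul, Complex.conj_conj]; ring

theorem hasDerivAt_herm (hξ : SpinorCurve ξ V κ) (x : ℂ × ℂ) (u : ℝ) :
    HasDerivAt (fun u => herm x (ξ u))
      (V u * (Complex.I * κ u * herm x (ξ u) - conj (det2 x (ξ u)))) u := by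
  refine (((hξ.d1 u).const_mul (conj x.1)).add ((hξ.d2 u).const_mul (conj x.2))).congr_deriv ?_
  simp only [det2, herm, map_sub, map_mul]; ring

theorem hasDerivAt_det2_left (hξ : SpinorCurve ξ V κ) (x : ℂ × ℂ) (u : ℝ) :
    HasDerivAt (fun u => det2 (ξ u) x)
      (V u * (Complex.I * κ u * det2 (ξ u) x - herm (ξ u) x)) u := by
  have h := (hξ.hasDerivAt_det2 x u).neg
  simp only [Pi.neg_def, ← det2_swap] at h
  refine h.congr_deriv ?_
  rw [det2_swap x (ξ u), herm_swap x (ξ u)]; ring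

theorem hasDerivAt_herm_left (hξ : SpinorCurve ξ V κ) (x : ℂ × ℂ) (u : ℝ) :
    HasDerivAt (fun u => herm (ξ u) x)
      (V u * (-(Complex.I * κ u * herm (ξ u) x) + det2 (ξ u) x)) u := by
  have h := (hξ.hasDerivAt_herm x u).star
  have he : (fun u => star (herm x (ξ u))) = fun u => herm (ξ u) x :=
    funext fun u => (herm_swap x (ξ u)).symm
  rw [he] at h
  refine h.congr_deriv ?_
  rw [herm_swap x (ξ u), det2_swap x (ξ u)]
  simp only [Complex.star_def, map_mul, map_sub, Complex.conj_ofReal, Complex.conj_I,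
    Complex.conj_conj]
  ring

/-- Reversal of a spinor curve. -/
theorem reverse (hξ : SpinorCurve ξ V κ) :
    SpinorCurve (fun s => (Complex.I * (ξ (-s)).1, Complex.I * (ξ (-s)).2))
      (fun s => V (-s)) (fun s => -κ (-s)) where
  d1 s := by
    have h := ((hξ.d1 (-s)).scomp s (hasDerivAt_neg s)).const_mul Complex.I
    refine h.congr_deriv ?_
    simp only [map_mul, Complex.conj_I, Complex.real_smul, Complex.ofReal_neg,
      Complex.ofReal_one]; ring
  d2 s := by
    have h := ((hξ.d2 (-s)).scomp s (hasDerivAt_neg s)).const_mul Complex.I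
    refine h.congr_deriv ?_
    simp only [map_mul, Complex.conj_I, Complex.real_smul, Complex.ofReal_neg,
      Complex.ofReal_one]; ring
  unit s := by
    rw [← hξ.unit (-s)]
    simp only [herm, map_mul, Complex.conj_I]
    ring_nf; simp [Complex.I_sq]
  V_pos s := hξ.V_pos _
  V_cont := hξ.V_cont.comp continuous_neg
  κ_cont := (hξ.κ_cont.comp continuous_neg).neg

/-- The divided difference of `det2 (ξ s) (ξ u)`. -/
theorem exists_divided (hξ : SpinorCurve ξ V κ) :
    ∃ W : ℝ × ℝ → ℂ, Continuous W ∧ (∀ s u : ℝ, det2 (ξ s) (ξ u) = (u - s : ℝ) * W (s, u)) ∧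
      (∀ s, W (s, s) = V s) ∧ ∀ s u, W (u, s) = W (s, u) := by
  have := hξ.cont
  have := hξ.V_cont
  have := hξ.κ_cont
  obtain ⟨W, hW, h1, h2⟩ := exists_continuous_divided (H := fun x => det2 (ξ x.1) (ξ x.2))
    (h := fun x => V x.2 * (Complex.I * κ x.2 * det2 (ξ x.1) (ξ x.2) +
      conj (herm (ξ x.1) (ξ x.2)))) (by fun_prop) (fun s u => hξ.hasDerivAt_det2 (ξ s) u)
    (fun s => det2_self _)
  refine ⟨W, hW, h1, fun s => by simp [h2, det2_self, hξ.unit], fun s u => ?_⟩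
  rcases eq_or_ne s u with rfl | h
  · rfl
  · have h3 := h1 s u
    have h4 := h1 u s
    simp only at h3 h4
    rw [det2_swap, h3] at h4
    have h5 : ((u - s : ℝ) : ℂ) ≠ 0 := by exact_mod_cast sub_ne_zero.2 h.symm
    apply mul_left_cancel₀ h5
    push_cast at h4 ⊢
    linear_combination h4

/-- A choice of the divided difference of `det2 (ξ s) (ξ u)`. -/
def divided (hξ : SpinorCurve ξ V κ) : ℝ × ℝ → ℂ := hξ.exists_divided.choose

theorem continuous_divided (hξ : SpinorCurve ξ V κ) : Continuous hξ.divided :=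
  hξ.exists_divided.choose_spec.1

theorem det2_eq_divided (hξ : SpinorCurve ξ V κ) (s u : ℝ) :
    det2 (ξ s) (ξ u) = (u - s : ℝ) * hξ.divided (s, u) :=
  hξ.exists_divided.choose_spec.2.1 s u

theorem divided_diag (hξ : SpinorCurve ξ V κ) (s : ℝ) : hξ.divided (s, s) = V s :=
  hξ.exists_divided.choose_spec.2.2.1 s

theorem divided_symm (hξ : SpinorCurve ξ V κ) (s u : ℝ) :
    hξ.divided (u, s) = hξ.divided (s, u) :=
  hξ.exists_divided.choose_spec.2.2.2 s u

end SpinorCurve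

/-- A positive shell, in terms of spinors. -/
structure SpinorShell (ξ : ℝ → ℂ × ℂ) (V κ : ℝ → ℝ) (a b : ℝ) (ζ : ℂ) : Prop where
  curve : SpinorCurve ξ V κ
  lt : a < b
  ne : ∀ s u, a ≤ s → s < u → u ≤ b → u - s < b - a → det2 (ξ s) (ξ u) ≠ 0
  close : ξ b = (ζ * (ξ a).1, ζ * (ξ a).2)
  pos : (ζ ^ 2).im < 0

namespace SpinorShell

variable {ξ : ℝ → ℂ × ℂ} {V κ : ℝ → ℝ} {a b : ℝ} {ζ : ℂ}

theorem norm_ζ (h : SpinorShell ξ V κ a b ζ) : conj ζ * ζ = 1 := by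
  have h1 := h.curve.unit b
  have h2 := h.curve.unit a
  rw [h.close] at h1
  simp only [herm, map_mul] at h1 h2
  linear_combination h1 - conj ζ * ζ * h2

theorem abs_ζ (h : SpinorShell ξ V κ a b ζ) : ‖ζ‖ = 1 := by
  have h1 := h.norm_ζ
  rw [← Complex.normSq_eq_conj_mul_self] at h1
  have h2 : Complex.normSq ζ = 1 := by exact_mod_cast h1
  rw [Complex.normSq_eq_norm_sq] at h2
  nlinarith [norm_nonneg ζ]

theorem det2_close (h : SpinorShell ξ V κ a b ζ) (η : ℂ × ℂ) :
    det2 (ξ b) η = ζ * det2 (ξ a) η := by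
  rw [h.close]; simp only [det2]; ring

theorem herm_close (h : SpinorShell ξ V κ a b ζ) (η : ℂ × ℂ) :
    herm (ξ b) η = conj ζ * herm (ξ a) η := by
  rw [h.close]; simp only [herm, map_mul]; ring

theorem divided_ne (h : SpinorShell ξ V κ a b ζ) {s u : ℝ} (hs : a ≤ s) (hsu : s ≤ u) (hu : u ≤ b)
    (hd : u - s < b - a) : h.curve.divided (s, u) ≠ 0 := by
  rcases hsu.eq_or_lt with rfl | hlt
  · rw [h.curve.divided_diag]; exact_mod_cast (h.curve.V_pos s).ne'
  · intro h0
    exact h.ne s u hs hlt hu hd (by rw [h.curve.det2_eq_divided, h0, mul_zero])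

/-- Behaviour of the determinant near the node of a shell. -/
theorem exists_corner (h : SpinorShell ξ V κ a b ζ) :
    ∃ A B : ℝ × ℝ → ℂ, Continuous A ∧ Continuous B ∧ A (a, b) = ζ * V a ∧ B (a, b) = conj ζ * V b ∧
      ∀ s u : ℝ, det2 (ξ s) (ξ u) = -((s - a : ℝ) * A (s, u) + (b - u : ℝ) * B (s, u)) := by
  have hc := h.curve.cont
  have hd := h.curve.continuous_divided
  refine ⟨fun x => herm (ξ a) (ξ x.2) * h.curve.divided (a, x.1),
    fun x => conj ζ * herm (ξ a) (ξ x.1) * h.curve.divided (b, x.2), by fun_prop, by fun_prop,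
    ?_, ?_, fun s u => ?_⟩
  · simp only [h.curve.divided_diag]
    rw [herm_swap (ξ b), h.herm_close, h.curve.unit]; simp
  · simp only [h.curve.divided_diag]; rw [h.curve.unit]; simp
  · have h1 := h.curve.det2_eq_divided a s
    have h2 := h.curve.det2_eq_divided b u
    rw [det2_eq_of_unit (h.curve.unit a) (ξ s) (ξ u), det2_swap (ξ a) (ξ s), h1]
    rw [h.det2_close] at h2
    have h3 : det2 (ξ a) (ξ u) = conj ζ * ((u - b : ℝ) * h.curve.divided (b, u)) := by
      rw [← h2, ← mul_assoc, h.norm_ζ, one_mul]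
    rw [h3]; push_cast; ring

theorem exists_sign (h : SpinorShell ξ V κ a b ζ) :
    ∃ ε : ℂ, ε * ε = 1 ∧ 0 < (-ε * ζ).re ∧ (-ε * ζ).im < 0 := by
  have hp := h.pos
  have h2 : (ζ ^ 2).im = 2 * (ζ.re * ζ.im) := by rw [sq, Complex.mul_im]; ring
  rw [h2] at hp
  have hp : ζ.re * ζ.im < 0 := by linarith
  rcases mul_neg_iff.1 hp with ⟨h3, h4⟩ | ⟨h3, h4⟩
  · exact ⟨-1, by norm_num, by simpa using h3, by simpa using h4⟩
  · exact ⟨1, by norm_num, by simpa using h3, by simpa using h4⟩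

/-- Linear model of the divided difference near the node of a shell. -/
def model (V : ℝ → ℝ) (a b : ℝ) (ω : ℂ) (x : ℝ × ℝ) : ℂ :=
  (x.1 - a : ℝ) * V a * ω + (b - x.2 : ℝ) * V b * conj ω

theorem le_re_model (h : SpinorShell ξ V κ a b ζ) {ω : ℂ} (hω : 0 < ω.re) :
    ∃ c > 0, ∀ s u : ℝ, a ≤ s → u ≤ b → c * ((s - a) + (b - u)) ≤ (model V a b ω (s, u)).re := by
  have ha := h.curve.V_pos a
  have hb := h.curve.V_pos b
  refine ⟨ω.re * min (V a) (V b), by positivity, fun s u hs hu => ?_⟩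
  have h1 : (model V a b ω (s, u)).re = ω.re * (V a * (s - a) + V b * (b - u)) := by
    simp [model]; ring
  rw [h1, mul_assoc]
  refine mul_le_mul_of_nonneg_left ?_ hω.le
  nlinarith [min_le_left (V a) (V b), min_le_right (V a) (V b), sub_nonneg.2 hs, sub_nonneg.2 hu]

theorem exists_quotient (h : SpinorShell ξ V κ a b ζ) {ε : ℂ} (hε : ε * ε = 1)
    (hre : 0 < (-ε * ζ).re) :
    ∃ Ψ : ℝ × ℝ → ℂ, ContinuousOn Ψ {x | a ≤ x.1 ∧ x.1 ≤ x.2 ∧ x.2 ≤ b} ∧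
      (∀ s u, a ≤ s → s ≤ u → u ≤ b → Ψ (s, u) ≠ 0) ∧
      ∀ s u, a ≤ s → s ≤ u → u ≤ b → u - s < b - a →
        h.curve.divided (s, u) = Ψ (s, u) * model V a b (-ε * ζ) (s, u) := by
  classical
  set ω := -ε * ζ with hω
  obtain ⟨c, hc, hmod⟩ := h.le_re_model hre
  have hab := h.lt
  have hne : ∀ s u : ℝ, a ≤ s → u ≤ b → u - s < b - a → model V a b ω (s, u) ≠ 0 := by
    intro s u hs hu hd h0
    have := hmod s u hs hu
    rw [h0, Complex.zero_re] at this
    nlinarith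
  have hε0 : ε ≠ 0 := fun h0 => by simp [h0] at hε
  have hWc := h.curve.continuous_divided
  have hmc : Continuous (model V a b ω) := by unfold model; fun_prop
  have hba : ((b - a : ℝ) : ℂ) ≠ 0 := by exact_mod_cast (sub_pos.2 hab).ne'
  refine ⟨fun x => if x = (a, b) then ε / (b - a : ℝ) else h.curve.divided x / model V a b ω x,
    ?_, ?_, ?_⟩
  · rintro ⟨s, u⟩ ⟨h1, h2, h3⟩
    simp only at h1 h2 h3
    by_cases hx : (s, u) = (a, b)
    · rw [hx]
      obtain ⟨A, B, hA, hB, hA0, hB0, hAB⟩ := h.exists_corner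
      have hlim : Filter.Tendsto (fun x : ℝ × ℝ => (‖A x - A (a, b)‖ + ‖B x - B (a, b)‖) / c)
          (nhds (a, b)) (nhds 0) := by
        have : Continuous fun x : ℝ × ℝ => (‖A x - A (a, b)‖ + ‖B x - B (a, b)‖) / c := by fun_prop
        simpa using this.tendsto (a, b)
      have hlim2 : Filter.Tendsto (fun x : ℝ × ℝ => det2 (ξ x.1) (ξ x.2) / model V a b ω x)
          (nhdsWithin (a, b) ({x | a ≤ x.1 ∧ x.1 ≤ x.2 ∧ x.2 ≤ b} \ {(a, b)})) (nhds ε) := by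
        rw [tendsto_iff_norm_sub_tendsto_zero]
        refine squeeze_zero' (Filter.Eventually.of_forall fun _ => norm_nonneg _) ?_
          (hlim.mono_left nhdsWithin_le_nhds)
        filter_upwards [self_mem_nhdsWithin] with x hx
        obtain ⟨⟨x1, x2, x3⟩, x4⟩ := hx
        have hd : x.2 - x.1 < b - a := by
          by_contra hcon
          push Not at hcon
          apply x4
          ext <;> simp <;> linarith
        have hm := hne x.1 x.2 x1 x3 hd
        have hm2 := hmod x.1 x.2 x1 x3
        have hpos : 0 < c * ((x.1 - a) + (b - x.2)) := by apply mul_pos hc; linarith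
        have heq : det2 (ξ x.1) (ξ x.2) / model V a b ω x - ε =
            -((x.1 - a : ℝ) * (A x - A (a, b)) + (b - x.2 : ℝ) * (B x - B (a, b))) /
              model V a b ω x := by
          rw [sub_eq_iff_eq_add, div_add' _ _ _ hm]
          congr 1
          have hcω : conj ω = -ε * conj ζ := by
            have : conj ε = ε := by
              have : (ε - 1) * (ε + 1) = 0 := by linear_combination hε
              rcases mul_eq_zero.1 this with h | h
              · rw [sub_eq_zero.1 h, map_one]
              · rw [eq_neg_of_add_eq_zero_left h, map_neg, map_one]
            rw [hω, map_mul, map_neg, this]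
          rw [hAB, hA0, hB0]
          simp only [model, hcω]
          rw [hω]
          linear_combination ((x.1 - a : ℝ) * V a * ζ + (b - x.2 : ℝ) * V b * conj ζ) * hε
        rw [heq, norm_div, norm_neg]
        have hn1 : ‖(x.1 - a : ℝ) * (A x - A (a, b)) + (b - x.2 : ℝ) * (B x - B (a, b))‖ ≤
            ((x.1 - a) + (b - x.2)) * (‖A x - A (a, b)‖ + ‖B x - B (a, b)‖) := by
          refine (norm_add_le _ _).trans ?_
          rw [norm_mul, norm_mul, Complex.norm_real, Complex.norm_real, Real.norm_eq_abs,
            Real.norm_eq_abs, abs_of_nonneg (sub_nonneg.2 x1), abs_of_nonneg (sub_nonneg.2 x3)]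
          nlinarith [mul_nonneg (sub_nonneg.2 x1) (norm_nonneg (B x - B (a, b))),
            mul_nonneg (sub_nonneg.2 x3) (norm_nonneg (A x - A (a, b)))]
        have hn2 : c * ((x.1 - a) + (b - x.2)) ≤ ‖model V a b ω x‖ :=
          hm2.trans (Complex.re_le_norm _)
        calc _ ≤ ((x.1 - a) + (b - x.2)) * (‖A x - A (a, b)‖ + ‖B x - B (a, b)‖) /
              (c * ((x.1 - a) + (b - x.2))) := by gcongr
          _ = _ := by
            have : (x.1 - a) + (b - x.2) ≠ 0 := by linarith
            field_simp
      refine (continuousWithinAt_sdiff_singleton (y := (a, b))).1 ?_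
      have hlim3 : Filter.Tendsto (fun x : ℝ × ℝ => ((x.2 - x.1 : ℝ) : ℂ))
          (nhdsWithin (a, b) ({x | a ≤ x.1 ∧ x.1 ≤ x.2 ∧ x.2 ≤ b} \ {(a, b)}))
          (nhds ((b - a : ℝ) : ℂ)) := by
        have : Continuous fun x : ℝ × ℝ => ((x.2 - x.1 : ℝ) : ℂ) := by fun_prop
        exact (this.tendsto (a, b)).mono_left nhdsWithin_le_nhds
      have hlim4 := hlim2.div hlim3 hba
      simp only [ContinuousWithinAt, if_true]
      refine hlim4.congr' ?_
      have hnear : ∀ᶠ x : ℝ × ℝ in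
          nhdsWithin (a, b) ({x | a ≤ x.1 ∧ x.1 ≤ x.2 ∧ x.2 ≤ b} \ {(a, b)}), x.1 < x.2 :=
        nhdsWithin_le_nhds ((isOpen_lt continuous_fst continuous_snd).mem_nhds hab)
      filter_upwards [self_mem_nhdsWithin, hnear] with x hx hlt
      have hx0 : ((x.2 - x.1 : ℝ) : ℂ) ≠ 0 := by exact_mod_cast (sub_pos.2 hlt).ne'
      rw [if_neg (show x ≠ (a, b) from hx.2), Pi.div_apply, h.curve.det2_eq_divided]
      field_simp
    · have hx' : u - s < b - a := by
        by_contra hcon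
        push Not at hcon
        apply hx
        ext <;> simp <;> linarith
      have hcont : ContinuousAt (fun x => h.curve.divided x / model V a b ω x) (s, u) :=
        hWc.continuousAt.div hmc.continuousAt (hne s u h1 h3 hx')
      refine (hcont.congr ?_).continuousWithinAt
      filter_upwards [isOpen_ne.mem_nhds hx] with y hy
      rw [if_neg hy]
  · intro s u h1 h2 h3
    by_cases hx : (s, u) = (a, b)
    · simp only [hx, if_true]
      exact div_ne_zero hε0 hba
    · have hx' : u - s < b - a := by
        by_contra hcon
        push Not at hcon
        apply hx
        ext <;> simp <;> linarith
      simp only [if_neg hx]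
      exact div_ne_zero (h.divided_ne h1 h2 h3 hx') (hne s u h1 h3 hx')
  · intro s u h1 h2 h3 h4
    have hx : (s, u) ≠ (a, b) := by rintro ⟨⟩; exact h4.false
    simp only [if_neg hx]
    rw [div_mul_cancel₀ _ (hne s u h1 h3 h4)]

/-- The argument of the divided difference on the triangle `a ≤ s ≤ u ≤ b`, normalized to vanish on
the diagonal, increases by the exterior half-angle `α` between the two legs. -/
theorem exists_arg_triangle (h : SpinorShell ξ V κ a b ζ) :
    ∃ (α : ℝ) (Φ : ℝ × ℝ → ℝ), -(Real.pi / 2) < α ∧ α < 0 ∧ ζ = -Complex.exp (α * Complex.I) ∧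
      ContinuousOn Φ {x | a ≤ x.1 ∧ x.1 ≤ x.2 ∧ x.2 ≤ b ∧ x.2 - x.1 < b - a} ∧
      (∀ s, a ≤ s → s ≤ b → Φ (s, s) = 0) ∧
      (∀ s u, a ≤ s → s ≤ u → u ≤ b → u - s < b - a →
        h.curve.divided (s, u) =
          ‖h.curve.divided (s, u)‖ * Complex.exp (Φ (s, u) * Complex.I)) ∧
      ∀ s, a < s → s < b → Φ (s, b) = Φ (a, s) + α := by
  obtain ⟨ε, hε, hre, him⟩ := h.exists_sign
  obtain ⟨Ψ, hΨc, hΨ0, hΨ⟩ := h.exists_quotient hε hre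
  set ω := -ε * ζ with hω
  have hab := h.lt
  obtain ⟨c, hc, hmod⟩ := h.le_re_model hre
  have hmpos : ∀ s u : ℝ, a ≤ s → u ≤ b → u - s < b - a → 0 < (model V a b ω (s, u)).re := by
    intro s u hs hu hd
    have := hmod s u hs hu
    have : 0 < c * ((s - a) + (b - u)) := by apply mul_pos hc; linarith
    linarith
  have hmc : Continuous (model V a b ω) := by unfold model; fun_prop
  obtain ⟨L, hL, hLe⟩ := exists_continuous_log_triangle hab.le hΨc hΨ0
  have hω1 : ‖ω‖ = 1 := by
    have : ‖ε‖ * ‖ε‖ = 1 := by rw [← norm_mul, hε, norm_one]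
    have : ‖ε‖ = 1 := by nlinarith [norm_nonneg ε]
    rw [hω, norm_mul, norm_neg, this, h.abs_ζ, one_mul]
  have hωexp : Complex.exp (ω.arg * Complex.I) = ω := by
    have := Complex.norm_mul_exp_arg_mul_I ω
    rwa [hω1, Complex.ofReal_one, one_mul] at this
  have hωpi : ω.arg ≠ Real.pi := fun h0 => by
    have := (Complex.arg_eq_pi_iff.1 h0).1; linarith
  let φ : ℝ × ℝ → ℝ := fun x => (L x).im + (model V a b ω x).arg
  have hφc : ContinuousOn φ {x | a ≤ x.1 ∧ x.1 ≤ x.2 ∧ x.2 ≤ b ∧ x.2 - x.1 < b - a} := by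
    rintro ⟨s, u⟩ ⟨h1, h2, h3, h4⟩
    refine ContinuousAt.continuousWithinAt ?_
    refine (Complex.continuous_im.comp hL).continuousAt.add ?_
    exact (Complex.continuousAt_arg (Or.inl (hmpos s u h1 h3 h4))).comp hmc.continuousAt
  have hφe : ∀ s u, a ≤ s → s ≤ u → u ≤ b → u - s < b - a →
        h.curve.divided (s, u) =
          ‖h.curve.divided (s, u)‖ * Complex.exp (φ (s, u) * Complex.I) := by
    intro s u h1 h2 h3 h4
    rw [hΨ s u h1 h2 h3 h4, norm_mul, ← hLe s u h1 h2 h3, Complex.norm_exp]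
    conv_lhs => rw [← Complex.norm_mul_exp_arg_mul_I (model V a b ω (s, u))]
    have : Complex.exp (L (s, u)) =
        Complex.exp ((L (s, u)).re) * Complex.exp ((L (s, u)).im * Complex.I) := by
      rw [← Complex.exp_add, Complex.re_add_im]
    rw [this]
    simp only [φ]
    push_cast
    rw [add_mul, Complex.exp_add]; ring
  have hdiag : ∀ s ∈ Set.Icc a b, Complex.exp (φ (s, s) * Complex.I) = 1 := by
    intro s hs
    have h1 := hφe s s hs.1 le_rfl hs.2 (by linarith)
    have hV := h.curve.V_pos s
    rw [h.curve.divided_diag, Complex.norm_real, Real.norm_eq_abs, abs_of_pos hV] at h1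
    have hV' : (V s : ℂ) ≠ 0 := by exact_mod_cast hV.ne'
    apply mul_left_cancel₀ hV'
    rw [← h1, mul_one]
  have hdc : ContinuousOn (fun s => (φ (s, s) : ℂ) * Complex.I) (Set.Icc a b) := by
    refine (Complex.continuous_ofReal.comp_continuousOn
      (hφc.comp (f := fun s => (s, s)) (by fun_prop) fun s hs => ?_)).mul continuousOn_const
    exact ⟨hs.1, le_rfl, hs.2, by simp; linarith⟩
  have hconst : ∀ s ∈ Set.Icc a b, φ (s, s) = φ (a, a) := by
    intro s hs
    have := eq_of_exp_eq isPreconnected_Icc hdc hdiag hs (Set.left_mem_Icc.2 hab.le)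
    have := mul_right_cancel₀ Complex.I_ne_zero this
    exact_mod_cast this
  set C := φ (a, a) with hC
  have hargL : ∀ s, s < b → (model V a b ω (a, s)).arg = -ω.arg := by
    intro s hs
    have h1 : model V a b ω (a, s) = (((b - s) * V b : ℝ) : ℂ) * conj ω := by
      simp [model]
    rw [h1, Complex.arg_real_mul _ (mul_pos (by linarith) (h.curve.V_pos b)), Complex.arg_conj,
      if_neg hωpi]
  have hargR : ∀ s, a < s → (model V a b ω (s, b)).arg = ω.arg := by
    intro s hs
    have h1 : model V a b ω (s, b) = (((s - a) * V a : ℝ) : ℂ) * ω := by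
      simp [model]
    rw [h1, Complex.arg_real_mul _ (mul_pos (by linarith) (h.curve.V_pos a))]
  -- the difference of the arguments along the two edges of the triangle
  let D : ℝ → ℝ := fun s => (L (s, b)).im - (L (a, s)).im + ω.arg
  have hDc : Continuous D := by fun_prop
  have hDexp : ∀ s ∈ Set.Ioo a b, Complex.exp (D s * Complex.I) = ε := by
    rintro s ⟨h1, h2⟩
    have e1 := hφe s b h1.le h2.le le_rfl (by linarith)
    have e2 := hφe a s le_rfl h1.le h2.le (by linarith)
    have e3 := h.curve.det2_eq_divided s b
    have e4 := h.curve.det2_eq_divided a s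
    have e5 : det2 (ξ s) (ξ b) = -ζ * det2 (ξ a) (ξ s) := by
      rw [det2_swap, h.det2_close]; ring
    rw [e3, e4] at e5
    have e6 : (b - s) * ‖h.curve.divided (s, b)‖ = (s - a) * ‖h.curve.divided (a, s)‖ := by
      have := congrArg norm e5
      rwa [norm_mul, norm_mul, norm_mul, norm_neg, h.abs_ζ, one_mul, Complex.norm_real,
        Complex.norm_real, Real.norm_eq_abs, Real.norm_eq_abs, abs_of_pos (by linarith),
        abs_of_pos (by linarith)] at this
    have e7 : (((s - a) * ‖h.curve.divided (a, s)‖ : ℝ) : ℂ) ≠ 0 := by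
      have := h.divided_ne le_rfl h1.le h2.le (by linarith)
      have h8 := norm_pos_iff.2 this
      exact_mod_cast (mul_pos (sub_pos.2 h1) h8).ne'
    have e8 : Complex.exp (φ (s, b) * Complex.I) = -ζ * Complex.exp (φ (a, s) * Complex.I) := by
      apply mul_left_cancel₀ e7
      rw [e1, e2] at e5
      calc _ = (((b - s) * ‖h.curve.divided (s, b)‖ : ℝ) : ℂ) *
            Complex.exp (φ (s, b) * Complex.I) := by rw [e6]
        _ = _ := by
          push_cast at e5 ⊢
          linear_combination e5
    have e9 : D s = φ (s, b) - φ (a, s) - ω.arg := by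
      simp only [D, φ, hargL s h2, hargR s h1]; ring
    have e10 : ζ = -ε * ω := by rw [hω]; linear_combination -ζ * hε
    rw [e9]
    push_cast
    rw [sub_mul, sub_mul, Complex.exp_sub, Complex.exp_sub, hωexp, e8, e10]
    have := Complex.exp_ne_zero (φ (a, s) * Complex.I)
    have : ω ≠ 0 := fun h0 => by simp [h0] at hω1
    field_simp
  have hDconst : ∀ s ∈ Set.Icc a b, D s = D ((a + b) / 2) := by
    have hm : (a + b) / 2 ∈ Set.Ioo a b := ⟨by linarith, by linarith⟩
    have : Set.EqOn D (fun _ => D ((a + b) / 2)) (Set.Ioo a b) := by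
      intro s hs
      have := eq_of_exp_eq isPreconnected_Ioo
        (f := fun s => (D s : ℂ) * Complex.I) (by fun_prop) hDexp hs hm
      have := mul_right_cancel₀ Complex.I_ne_zero this
      exact_mod_cast this
    have := this.closure hDc continuous_const
    rwa [closure_Ioo hab.ne] at this
  have hDa := hDconst a (Set.left_mem_Icc.2 hab.le)
  have hDb := hDconst b (Set.right_mem_Icc.2 hab.le)
  have hCa : C = (L (a, a)).im - ω.arg := by simp only [hC, φ, hargL a hab]; ring
  have hCb : C = (L (b, b)).im + ω.arg := by
    rw [← hconst b (Set.right_mem_Icc.2 hab.le)]; simp only [φ, hargR b hab]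
  have hD0 : ∀ s ∈ Set.Icc a b, D s = 0 := by
    intro s hs
    rw [hDconst s hs]
    simp only [D] at hDa hDb ⊢
    linarith
  have hε1 : ε = 1 := by
    have := hDexp ((a + b) / 2) ⟨by linarith, by linarith⟩
    rw [hD0 _ ⟨by linarith, by linarith⟩] at this
    simpa using this.symm
  have hC1 := hdiag a (Set.left_mem_Icc.2 hab.le)
  refine ⟨ω.arg, fun x => φ x - C, ?_, ?_, ?_, hφc.sub continuousOn_const, ?_, ?_, ?_⟩
  · exact (abs_lt.1 (Complex.abs_arg_lt_pi_div_two_iff.2 (Or.inl hre))).1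
  · exact Complex.arg_neg_iff.2 him
  · rw [hωexp, hω, hε1]; ring
  · intro s h1 h2
    simp only [hconst s ⟨h1, h2⟩]; ring
  · intro s u h1 h2 h3 h4
    have := hφe s u h1 h2 h3 h4
    push_cast
    rw [sub_mul, Complex.exp_sub, ← hC] at *
    rw [hC1, div_one]
    exact this
  · intro s h1 h2
    have := hD0 s ⟨h1.le, h2.le⟩
    simp only [D] at this
    simp only [φ, hargL s h2, hargR s h1]
    linarith

/-- The square over a shell, without the two corners corresponding to the node. -/
def square (a b : ℝ) : Set (ℝ × ℝ) :=
  {x | x.1 ∈ Set.Icc a b ∧ x.2 ∈ Set.Icc a b ∧ |x.2 - x.1| < b - a}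

theorem exists_arg (h : SpinorShell ξ V κ a b ζ) :
    ∃ (α : ℝ) (Φ : ℝ × ℝ → ℝ), -(Real.pi / 2) < α ∧ α < 0 ∧ ζ = -Complex.exp (α * Complex.I) ∧
      ContinuousOn Φ (square a b) ∧
      (∀ s ∈ Set.Icc a b, Φ (s, s) = 0) ∧
      (∀ x ∈ square a b, h.curve.divided x =
          ‖h.curve.divided x‖ * Complex.exp (Φ x * Complex.I)) ∧
      (∀ s u, Φ (u, s) = Φ (s, u)) ∧
      ∀ s, a < s → s < b → Φ (s, b) = Φ (a, s) + α := by
  obtain ⟨α, Φ, h1, h2, h3, h4, h5, h6, h7⟩ := h.exists_arg_triangle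
  have hmaps : Set.MapsTo (fun x : ℝ × ℝ => (min x.1 x.2, max x.1 x.2)) (square a b)
      {x | a ≤ x.1 ∧ x.1 ≤ x.2 ∧ x.2 ≤ b ∧ x.2 - x.1 < b - a} := by
    rintro ⟨s, u⟩ ⟨⟨p1, p2⟩, ⟨p3, p4⟩, p5⟩
    refine ⟨le_min p1 p3, min_le_max, max_le p2 p4, ?_⟩
    simp only at *
    rwa [max_sub_min_eq_abs]
  refine ⟨α, fun x => Φ (min x.1 x.2, max x.1 x.2), h1, h2, h3, h4.comp (by fun_prop) hmaps,
    fun s hs => by simpa using h5 s hs.1 hs.2, fun x hx => ?_,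
    fun s u => by simp only [min_comm, max_comm], fun s hs hs' => ?_⟩
  · obtain ⟨p1, p2, p3, p4⟩ := hmaps hx
    have := h6 _ _ p1 p2 p3 p4
    simp only at this
    rcases le_total x.1 x.2 with hl | hl
    · simpa only [min_eq_left hl, max_eq_right hl] using this
    · rw [min_eq_right hl, max_eq_left hl, h.curve.divided_symm] at this
      simpa only [min_eq_right hl, max_eq_left hl] using this
  · simpa [hs.le, hs'.le] using h7 s hs hs'

/-- The exterior half-angle at the node of a shell. -/
def α (h : SpinorShell ξ V κ a b ζ) : ℝ := h.exists_arg.choose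

/-- The argument of the divided difference. -/
def Φ (h : SpinorShell ξ V κ a b ζ) : ℝ × ℝ → ℝ := h.exists_arg.choose_spec.choose

theorem lt_α (h : SpinorShell ξ V κ a b ζ) : -(Real.pi / 2) < h.α :=
  h.exists_arg.choose_spec.choose_spec.1

theorem α_neg (h : SpinorShell ξ V κ a b ζ) : h.α < 0 :=
  h.exists_arg.choose_spec.choose_spec.2.1

theorem ζ_eq (h : SpinorShell ξ V κ a b ζ) : ζ = -Complex.exp (h.α * Complex.I) :=
  h.exists_arg.choose_spec.choose_spec.2.2.1

theorem continuousOn_Φ (h : SpinorShell ξ V κ a b ζ) : ContinuousOn h.Φ (square a b) :=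
  h.exists_arg.choose_spec.choose_spec.2.2.2.1

theorem Φ_diag (h : SpinorShell ξ V κ a b ζ) {s : ℝ} (hs : s ∈ Set.Icc a b) : h.Φ (s, s) = 0 :=
  h.exists_arg.choose_spec.choose_spec.2.2.2.2.1 s hs

theorem divided_eq_norm_mul_exp (h : SpinorShell ξ V κ a b ζ) {x : ℝ × ℝ} (hx : x ∈ square a b) :
    h.curve.divided x = ‖h.curve.divided x‖ * Complex.exp (h.Φ x * Complex.I) :=
  h.exists_arg.choose_spec.choose_spec.2.2.2.2.2.1 x hx

theorem Φ_symm (h : SpinorShell ξ V κ a b ζ) (s u : ℝ) : h.Φ (u, s) = h.Φ (s, u) :=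
  h.exists_arg.choose_spec.choose_spec.2.2.2.2.2.2.1 s u

theorem Φ_edge (h : SpinorShell ξ V κ a b ζ) {s : ℝ} (hs : s ∈ Set.Ioo a b) :
    h.Φ (s, b) = h.Φ (a, s) + h.α :=
  h.exists_arg.choose_spec.choose_spec.2.2.2.2.2.2.2 s hs.1 hs.2

theorem divided_ne_zero (h : SpinorShell ξ V κ a b ζ) {x : ℝ × ℝ} (hx : x ∈ square a b) :
    h.curve.divided x ≠ 0 := by
  obtain ⟨s, u⟩ := x
  obtain ⟨p1, p2, p3⟩ := hx
  simp only at p1 p2 p3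
  rcases le_total s u with hl | hl
  · exact h.divided_ne p1.1 hl p2.2 (by rwa [abs_of_nonneg (by linarith)] at p3)
  · rw [h.curve.divided_symm]
    exact h.divided_ne p2.1 hl p1.2 (by rw [abs_of_nonpos (by linarith)] at p3; linarith)

theorem det2_ne_zero (h : SpinorShell ξ V κ a b ζ) {s u : ℝ} (hx : (s, u) ∈ square a b)
    (hne : s ≠ u) : det2 (ξ s) (ξ u) ≠ 0 := by
  rw [h.curve.det2_eq_divided]
  exact mul_ne_zero (by exact_mod_cast sub_ne_zero.2 hne.symm) (h.divided_ne_zero hx)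

theorem mem_square_of_Ioo {s x : ℝ} (hs : s ∈ Set.Icc a b) (hx : x ∈ Set.Ioo a b) :
    (s, x) ∈ square a b := by
  refine ⟨hs, Set.Ioo_subset_Icc_self hx, ?_⟩
  rw [abs_lt]; constructor <;> simp <;> linarith [hs.1, hs.2, hx.1, hx.2]

theorem square_symm {s x : ℝ} (hs : (s, x) ∈ square a b) : (x, s) ∈ square a b :=
  ⟨hs.2.1, hs.1, by have := hs.2.2; rwa [abs_sub_comm] at this⟩

theorem tendsto_Φ_right (h : SpinorShell ξ V κ a b ζ) :
    Filter.Tendsto (fun s => h.Φ (a, s)) (nhdsWithin b (Set.Ioo a b)) (nhds (-h.α)) := by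
  have hab := h.lt
  have h1 : Filter.Tendsto (fun s => h.Φ (s, b)) (nhdsWithin b (Set.Ioo a b)) (nhds 0) := by
    rw [← h.Φ_diag (Set.right_mem_Icc.2 hab.le)]
    have h2 := h.continuousOn_Φ (b, b) ⟨Set.right_mem_Icc.2 hab.le, Set.right_mem_Icc.2 hab.le,
      by simpa using hab⟩
    have h3 : ContinuousWithinAt (fun s => h.Φ (s, b)) (Set.Ioo a b) b :=
      h2.comp (f := fun s : ℝ => (s, b)) (by fun_prop) fun s hs =>
        ⟨Set.Ioo_subset_Icc_self hs, Set.right_mem_Icc.2 hab.le, by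
          simp only; rw [abs_of_pos (by linarith [hs.2])]; linarith [hs.1]⟩
    exact h3
  have h2 := h1.sub_const h.α
  rw [zero_sub] at h2
  refine h2.congr' ?_
  filter_upwards [self_mem_nhdsWithin] with s hs
  rw [h.Φ_edge hs]; ring

theorem tendsto_Φ_left (h : SpinorShell ξ V κ a b ζ) :
    Filter.Tendsto (fun s => h.Φ (s, b)) (nhdsWithin a (Set.Ioo a b)) (nhds h.α) := by
  have hab := h.lt
  have h1 : Filter.Tendsto (fun s => h.Φ (a, s)) (nhdsWithin a (Set.Ioo a b)) (nhds 0) := by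
    rw [← h.Φ_diag (Set.left_mem_Icc.2 hab.le)]
    have h2 := h.continuousOn_Φ (a, a) ⟨Set.left_mem_Icc.2 hab.le, Set.left_mem_Icc.2 hab.le,
      by simpa using hab⟩
    have h3 : ContinuousWithinAt (fun s => h.Φ (a, s)) (Set.Ioo a b) a :=
      h2.comp (f := fun s : ℝ => (a, s)) (by fun_prop) fun s hs =>
        ⟨Set.left_mem_Icc.2 hab.le, Set.Ioo_subset_Icc_self hs, by
          simp only; rw [abs_of_pos (by linarith [hs.1])]; linarith [hs.2]⟩
    exact h3
  have h2 := h1.add_const h.α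
  rw [zero_add] at h2
  refine h2.congr' ?_
  filter_upwards [self_mem_nhdsWithin] with s hs
  rw [h.Φ_edge hs]

/-- The region to the right of a positive shell, as a cone in the space of spinors. -/
def right (h : SpinorShell ξ V κ a b ζ) : Set (ℂ × ℂ) :=
  {η | ∃ L : ℝ → ℂ, ContinuousOn L (Set.Icc a b) ∧
    (∀ s ∈ Set.Icc a b, Complex.exp (L s) = det2 (ξ s) η) ∧ (L b - L a).im = h.α + Real.pi}

theorem ne_zero_of_mem_right (h : SpinorShell ξ V κ a b ζ) {η : ℂ × ℂ} (hη : η ∈ h.right) {s : ℝ}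
    (hs : s ∈ Set.Icc a b) : det2 (ξ s) η ≠ 0 := by
  obtain ⟨L, -, h2, -⟩ := hη
  rw [← h2 s hs]; exact Complex.exp_ne_zero _

theorem mem_right_iff (h : SpinorShell ξ V κ a b ζ) {η : ℂ × ℂ} {L : ℝ → ℂ}
    (hL : ContinuousOn L (Set.Icc a b))
    (he : ∀ s ∈ Set.Icc a b, Complex.exp (L s) = det2 (ξ s) η) :
    η ∈ h.right ↔ (L b - L a).im = h.α + Real.pi := by
  refine ⟨fun ⟨M, hM, hMe, hMi⟩ => ?_, fun hi => ⟨L, hL, he, hi⟩⟩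
  have := eq_of_exp_eq (isPreconnected_Icc (a := a) (b := b)) (hL.sub hM) (c := 1)
    (fun s hs => by
      rw [Pi.sub_apply, Complex.exp_sub, he s hs, hMe s hs]
      exact div_self (by rw [← he s hs]; exact Complex.exp_ne_zero _))
    (Set.right_mem_Icc.2 h.lt.le) (Set.left_mem_Icc.2 h.lt.le)
  simp only [Pi.sub_apply] at this
  rw [← hMi]
  congr 1
  linear_combination this

theorem exists_log (h : SpinorShell ξ V κ a b ζ) {η : ℂ × ℂ}
    (h0 : ∀ s ∈ Set.Icc a b, det2 (ξ s) η ≠ 0) :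
    ∃ L : ℝ → ℂ, Continuous L ∧ ∀ s ∈ Set.Icc a b, Complex.exp (L s) = det2 (ξ s) η := by
  have := h.curve.cont
  exact exists_continuous_log_Icc h.lt.le (by fun_prop) h0

theorem smul_mem_right (h : SpinorShell ξ V κ a b ζ) {η : ℂ × ℂ} {c : ℂ} (hc : c ≠ 0) :
    c • η ∈ h.right ↔ η ∈ h.right := by
  have key : ∀ (c : ℂ) (η : ℂ × ℂ), c ≠ 0 → η ∈ h.right → c • η ∈ h.right := by
    rintro c η hc ⟨L, hL, he, hi⟩
    refine ⟨fun s => L s + Complex.log c, hL.add continuousOn_const, fun s hs => ?_, ?_⟩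
    · rw [Complex.exp_add, he s hs, Complex.exp_log hc]
      simp only [det2, Prod.smul_fst, Prod.smul_snd, smul_eq_mul]; ring
    · rw [← hi]; congr 1; ring
  refine ⟨fun hη => ?_, key c η hc⟩
  have := key c⁻¹ _ (inv_ne_zero hc) hη
  rwa [smul_smul, inv_mul_cancel₀ hc, one_smul] at this

/-- Membership in the right region is locally constant off the curve. -/
theorem eventually_mem_right_iff (h : SpinorShell ξ V κ a b ζ) {η₀ : ℂ × ℂ}
    (h0 : ∀ s ∈ Set.Icc a b, det2 (ξ s) η₀ ≠ 0) :
    ∀ᶠ η in nhds η₀, (∀ s ∈ Set.Icc a b, det2 (ξ s) η ≠ 0) ∧ (η ∈ h.right ↔ η₀ ∈ h.right) := by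
  have hcont := h.curve.cont
  have hU : IsOpen {x : (ℂ × ℂ) × ℝ | ‖det2 (ξ x.2) x.1 - det2 (ξ x.2) η₀‖ <
      ‖det2 (ξ x.2) η₀‖} := isOpen_lt (by fun_prop) (by fun_prop)
  have hev : ∀ᶠ η in nhds η₀, ∀ s ∈ Set.Icc a b,
      ‖det2 (ξ s) η - det2 (ξ s) η₀‖ < ‖det2 (ξ s) η₀‖ :=
    isCompact_Icc.eventually_forall_of_forall_eventually fun s hs =>
      hU.mem_nhds (by simpa using h0 s hs)
  filter_upwards [hev] with η hη
  have hslit : ∀ s ∈ Set.Icc a b, det2 (ξ s) η / det2 (ξ s) η₀ ∈ Complex.slitPlane := by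
    intro s hs
    have h1 : ‖det2 (ξ s) η / det2 (ξ s) η₀ - 1‖ < 1 := by
      rw [div_sub_one (h0 s hs), norm_div, div_lt_one (norm_pos_iff.2 (h0 s hs))]
      exact hη s hs
    have h2 := Complex.mem_slitPlane_of_norm_lt_one h1
    simpa using h2
  have hne : ∀ s ∈ Set.Icc a b, det2 (ξ s) η ≠ 0 := fun s hs hz => by
    have := Complex.slitPlane_ne_zero (hslit s hs); simp [hz] at this
  refine ⟨hne, ?_⟩
  obtain ⟨L, hL, hLe⟩ := h.exists_log h0
  have hM : ContinuousOn (fun s => L s + Complex.log (det2 (ξ s) η / det2 (ξ s) η₀))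
      (Set.Icc a b) := by
    refine hL.continuousOn.add (ContinuousOn.clog ?_ hslit)
    exact ContinuousOn.div (by fun_prop) (by fun_prop) h0
  rw [h.mem_right_iff hL.continuousOn hLe, h.mem_right_iff hM fun s hs => by
    rw [Complex.exp_add, hLe s hs, Complex.exp_log (Complex.slitPlane_ne_zero (hslit s hs)),
      mul_div_cancel₀ _ (h0 s hs)]]
  have hζ : ζ ≠ 0 := fun h0 => by have := h.abs_ζ; simp [h0] at this
  have : det2 (ξ b) η / det2 (ξ b) η₀ = det2 (ξ a) η / det2 (ξ a) η₀ := by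
    rw [h.det2_close, h.det2_close, mul_div_mul_left _ _ hζ]
  simp only [this, add_sub_add_right_eq_sub]

end SpinorShell

/-- The affine coordinate of the spinor `η` in the frame of `x`. -/
def chi (x η : ℂ × ℂ) : ℂ := herm x η / det2 x η

theorem chi_im (x η : ℂ × ℂ) :
    (chi x η).im = (herm x η * conj (det2 x η)).im / Complex.normSq (det2 x η) := by
  rw [chi, Complex.div_im, Complex.mul_im, Complex.conj_re, Complex.conj_im]; ring

namespace SpinorShell

variable {ξ : ℝ → ℂ × ℂ} {V κ : ℝ → ℝ} {a b : ℝ} {ζ : ℂ}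

/-- The determinant of `ξ s` and `η` divided by its value for `η = ξ x`, without the zero at
`s = x`. -/
def quot (h : SpinorShell ξ V κ a b ζ) (x : ℝ) (η : ℂ × ℂ) (s : ℝ) : ℂ :=
  det2 (ξ s) η / (det2 (ξ x) η * h.curve.divided (s, x))

theorem quot_eq (h : SpinorShell ξ V κ a b ζ) {x s : ℝ} {η : ℂ × ℂ} (hx : (s, x) ∈ square a b)
    (hne : s ≠ x) (hη : det2 (ξ x) η ≠ 0) :
    h.quot x η s = (x - s : ℝ) * (chi (ξ x) η - chi (ξ x) (ξ s)) := by
  have h1 := h.divided_ne_zero hx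
  have h2 := h.curve.det2_eq_divided s x
  have h3 : det2 (ξ x) (ξ s) ≠ 0 := h.det2_ne_zero (square_symm hx) hne.symm
  rw [det2_swap] at h2
  rw [quot, chi, chi, det2_eq_of_unit (h.curve.unit x) (ξ s) η, det2_swap (ξ x) (ξ s)]
  have h4 : ((x - s : ℝ) : ℂ) ≠ 0 := by exact_mod_cast sub_ne_zero.2 hne.symm
  have h5 : det2 (ξ x) (ξ s) = -((x - s : ℝ) * h.curve.divided (s, x)) := by
    rw [← h2, neg_neg]
  rw [h5]
  field_simp
  ring

theorem quot_self (h : SpinorShell ξ V κ a b ζ) {x : ℝ} {η : ℂ × ℂ} (hη : det2 (ξ x) η ≠ 0) :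
    h.quot x η x = ((V x)⁻¹ : ℝ) := by
  rw [quot, h.curve.divided_diag]
  have : (V x : ℂ) ≠ 0 := by exact_mod_cast (h.curve.V_pos x).ne'
  push_cast
  field_simp

theorem continuousOn_quot (h : SpinorShell ξ V κ a b ζ) {x : ℝ} {η : ℂ × ℂ}
    (hη : det2 (ξ x) η ≠ 0) : ContinuousOn (h.quot x η) {s | (s, x) ∈ square a b} := by
  have := h.curve.cont
  have := h.curve.continuous_divided
  unfold quot
  exact ContinuousOn.div (by fun_prop) (by fun_prop) fun s hs =>
    mul_ne_zero hη (h.divided_ne_zero hs)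

/-- A logarithm of `det2 (ξ s) η` adapted to the frame at `x`. -/
def frameLog (h : SpinorShell ξ V κ a b ζ) (x : ℝ) (η : ℂ × ℂ) (s : ℝ) : ℂ :=
  Real.log ‖h.curve.divided (s, x)‖ + h.Φ (s, x) * Complex.I + Complex.log (h.quot x η s) +
    Complex.log (det2 (ξ x) η)

theorem exp_frameLog (h : SpinorShell ξ V κ a b ζ) {x s : ℝ} {η : ℂ × ℂ}
    (hx : (s, x) ∈ square a b) (hη : det2 (ξ x) η ≠ 0) (hq : h.quot x η s ∈ Complex.slitPlane) :
    Complex.exp (h.frameLog x η s) = det2 (ξ s) η := by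
  have h1 := h.divided_ne_zero hx
  rw [frameLog, Complex.exp_add, Complex.exp_add, Complex.exp_add, Complex.exp_log hη,
    Complex.exp_log (Complex.slitPlane_ne_zero hq), ← Complex.ofReal_exp,
    Real.exp_log (norm_pos_iff.2 h1), ← h.divided_eq_norm_mul_exp hx, quot]
  field_simp

theorem continuousOn_frameLog (h : SpinorShell ξ V κ a b ζ) {x : ℝ} {η : ℂ × ℂ} {S : Set ℝ}
    (hx : ∀ s ∈ S, (s, x) ∈ square a b) (hη : det2 (ξ x) η ≠ 0)
    (hq : ∀ s ∈ S, h.quot x η s ∈ Complex.slitPlane) : ContinuousOn (h.frameLog x η) S := by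
  have hc : ContinuousOn (fun s : ℝ => (s, x)) S := by fun_prop
  unfold frameLog
  refine ((ContinuousOn.add ?_ ?_).add (((h.continuousOn_quot hη).mono hx).clog hq)).add
    continuousOn_const
  · refine Complex.continuous_ofReal.comp_continuousOn (ContinuousOn.log ?_ fun s hs => ?_)
    · exact (h.curve.continuous_divided.comp_continuousOn hc).norm
    · exact (norm_pos_iff.2 (h.divided_ne_zero (hx s hs))).ne'
  · exact (Complex.continuous_ofReal.comp_continuousOn
      (h.continuousOn_Φ.comp hc hx)).mul continuousOn_const

theorem frameLog_im (h : SpinorShell ξ V κ a b ζ) (x : ℝ) (η : ℂ × ℂ) (s : ℝ) :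
    (h.frameLog x η s).im =
      h.Φ (s, x) + (h.quot x η s).arg + (det2 (ξ x) η).arg := by
  simp [frameLog, Complex.log_im]

theorem chi_node (h : SpinorShell ξ V κ a b ζ) (x : ℝ) :
    chi (ξ x) (ξ b) = chi (ξ x) (ξ a) := by
  have hζ : ζ ≠ 0 := fun h0 => by have := h.abs_ζ; simp [h0] at this
  have h1 : herm (ξ x) (ξ b) = ζ * herm (ξ x) (ξ a) := by
    rw [h.close]; simp only [herm]; ring
  have h2 : det2 (ξ x) (ξ b) = ζ * det2 (ξ x) (ξ a) := by
    rw [h.close]; simp only [det2]; ring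
  rw [chi, chi, h1, h2, mul_div_mul_left _ _ hζ]

theorem quot_node (h : SpinorShell ξ V κ a b ζ) {x : ℝ} (hx : x ∈ Set.Ioo a b) {η : ℂ × ℂ}
    (hη : det2 (ξ x) η ≠ 0) :
    h.quot x η b = (((b - x) / (x - a) : ℝ) : ℂ) * -h.quot x η a := by
  have hab := h.lt
  have h1 : ((x - a : ℝ) : ℂ) ≠ 0 := by exact_mod_cast (sub_pos.2 hx.1).ne'
  rw [h.quot_eq (mem_square_of_Ioo (Set.left_mem_Icc.2 hab.le) hx) hx.1.ne hη,
    h.quot_eq (mem_square_of_Ioo (Set.right_mem_Icc.2 hab.le) hx) hx.2.ne' hη, h.chi_node,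
    Complex.ofReal_div, ← mul_neg, ← mul_assoc, div_mul_cancel₀ _ h1]
  push_cast; ring

theorem mem_right_iff_arg (h : SpinorShell ξ V κ a b ζ) {x : ℝ} (hx : x ∈ Set.Ioo a b) {η : ℂ × ℂ}
    (hη : det2 (ξ x) η ≠ 0) (hq : ∀ s ∈ Set.Icc a b, h.quot x η s ∈ Complex.slitPlane) :
    η ∈ h.right ↔ (h.quot x η b).arg - (h.quot x η a).arg = Real.pi := by
  have hsq : ∀ s ∈ Set.Icc a b, (s, x) ∈ square a b := fun s hs => mem_square_of_Ioo hs hx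
  rw [h.mem_right_iff (h.continuousOn_frameLog hsq hη hq) fun s hs =>
    h.exp_frameLog (hsq s hs) hη (hq s hs), Complex.sub_im, frameLog_im, frameLog_im,
    h.Φ_symm x b, h.Φ_edge hx]
  constructor <;> intro h <;> linarith

theorem quot_im (h : SpinorShell ξ V κ a b ζ) {x s : ℝ} {η : ℂ × ℂ} (hx : (s, x) ∈ square a b)
    (hne : s ≠ x) (hη : det2 (ξ x) η ≠ 0) :
    (h.quot x η s).im = (x - s) * ((chi (ξ x) η).im - (chi (ξ x) (ξ s)).im) := by
  rw [h.quot_eq hx hne hη, Complex.im_ofReal_mul, Complex.sub_im]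

theorem quot_mem_slitPlane (h : SpinorShell ξ V κ a b ζ) {x s : ℝ} {η : ℂ × ℂ}
    (hx : (s, x) ∈ square a b) (hη : det2 (ξ x) η ≠ 0)
    (hne : s ≠ x → (chi (ξ x) η).im ≠ (chi (ξ x) (ξ s)).im) :
    h.quot x η s ∈ Complex.slitPlane := by
  rcases eq_or_ne s x with rfl | hs
  · rw [h.quot_self hη, Complex.ofReal_mem_slitPlane]
    exact inv_pos.2 (h.curve.V_pos s)
  · refine Or.inr ?_
    rw [h.quot_im hx hs hη]
    exact mul_ne_zero (sub_ne_zero.2 hs.symm) (sub_ne_zero.2 (hne hs))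

theorem arg_quot_node (h : SpinorShell ξ V κ a b ζ) {x : ℝ} (hx : x ∈ Set.Ioo a b) {η : ℂ × ℂ}
    (hη : det2 (ξ x) η ≠ 0) : (h.quot x η b).arg = (-h.quot x η a).arg := by
  rw [h.quot_node hx hη, Complex.arg_real_mul]
  exact div_pos (sub_pos.2 hx.2) (sub_pos.2 hx.1)

/-- A spinor below the whole curve in the frame at `x` is in the right region. -/
theorem mem_right_of_chi_lt (h : SpinorShell ξ V κ a b ζ) {x : ℝ} (hx : x ∈ Set.Ioo a b)
    {η : ℂ × ℂ} (hη : det2 (ξ x) η ≠ 0)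
    (hlt : ∀ s ∈ Set.Icc a b, s ≠ x → (chi (ξ x) η).im < (chi (ξ x) (ξ s)).im) :
    η ∈ h.right := by
  have ha := Set.left_mem_Icc.2 h.lt.le
  rw [h.mem_right_iff_arg hx hη fun s hs =>
    h.quot_mem_slitPlane (mem_square_of_Ioo hs hx) hη fun hne => (hlt s hs hne).ne,
    h.arg_quot_node hx hη, Complex.arg_neg_eq_arg_add_pi_of_im_neg, add_sub_cancel_left]
  rw [h.quot_im (mem_square_of_Ioo ha hx) hx.1.ne hη]
  exact mul_neg_of_pos_of_neg (sub_pos.2 hx.1) (sub_neg.2 (hlt a ha hx.1.ne))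

/-- A spinor above the whole curve in the frame at `x` is not in the right region. -/
theorem not_mem_right_of_lt_chi (h : SpinorShell ξ V κ a b ζ) {x : ℝ} (hx : x ∈ Set.Ioo a b)
    {η : ℂ × ℂ} (hη : det2 (ξ x) η ≠ 0)
    (hlt : ∀ s ∈ Set.Icc a b, s ≠ x → (chi (ξ x) (ξ s)).im < (chi (ξ x) η).im) :
    η ∉ h.right := by
  have ha := Set.left_mem_Icc.2 h.lt.le
  rw [h.mem_right_iff_arg hx hη fun s hs =>
    h.quot_mem_slitPlane (mem_square_of_Ioo hs hx) hη fun hne => (hlt s hs hne).ne',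
    h.arg_quot_node hx hη, Complex.arg_neg_eq_arg_sub_pi_of_im_pos]
  · linarith [Real.pi_pos]
  · rw [h.quot_im (mem_square_of_Ioo ha hx) hx.1.ne hη]
    exact mul_pos (sub_pos.2 hx.1) (sub_pos.2 (hlt a ha hx.1.ne))

theorem mem_right_of_log_mem (h : SpinorShell ξ V κ a b ζ) {η : ℂ × ℂ} {L : ℝ → ℂ}
    (hL : ContinuousOn L (Set.Icc a b))
    (he : ∀ s ∈ Set.Icc a b, Complex.exp (L s) = det2 (ξ s) η)
    (hI : (L b - L a).im ∈ Set.Icc (-h.α) (Real.pi - h.α)) : η ∈ h.right := by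
  rw [h.mem_right_iff hL he]
  have ha := he a (Set.left_mem_Icc.2 h.lt.le)
  have hb := he b (Set.right_mem_Icc.2 h.lt.le)
  have h1 : Complex.exp (L b) = Complex.exp (L a + (h.α + Real.pi) * Complex.I) := by
    rw [hb, h.det2_close, ← ha, Complex.exp_add, add_mul, Complex.exp_add,
      Complex.exp_pi_mul_I, mul_neg_one, ← h.ζ_eq, mul_comm]
  obtain ⟨n, hn⟩ := Complex.exp_eq_exp_iff_exists_int.1 h1
  have h2 : (L b - L a).im = h.α + Real.pi + n * (2 * Real.pi) := by
    rw [hn]; simp; ring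
  rw [h2] at hI ⊢
  have h3 := h.lt_α
  have h4 := h.α_neg
  have hpi := Real.pi_pos
  have h5 : (-1 : ℝ) < n := by
    by_contra! hc
    nlinarith [hI.1]
  have h6 : (n : ℝ) < 1 := by
    by_contra! hc
    nlinarith [hI.2]
  have h7 : n = 0 := by
    have : (-1 : ℤ) < n := by exact_mod_cast h5
    have : n < (1 : ℤ) := by exact_mod_cast h6
    omega
  simp [h7]

theorem mem_square_left {s : ℝ} (hs : s ∈ Set.Ico a b) : (s, a) ∈ square a b := by
  have := hs.1
  have := hs.2
  refine ⟨⟨hs.1, hs.2.le⟩, ⟨le_rfl, by linarith⟩, ?_⟩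
  rw [abs_lt]; constructor <;> simp only <;> linarith

theorem mem_square_right {s : ℝ} (hs : s ∈ Set.Ioc a b) : (s, b) ∈ square a b := by
  have := hs.1
  have := hs.2
  refine ⟨⟨hs.1.le, hs.2⟩, ⟨by linarith, le_rfl⟩, ?_⟩
  rw [abs_lt]; constructor <;> simp only <;> linarith

theorem mem_right_of_chi_lt_left (h : SpinorShell ξ V κ a b ζ) {η : ℂ × ℂ}
    (hη : det2 (ξ a) η ≠ 0)
    (hlt : ∀ s ∈ Set.Ioo a b, (chi (ξ a) η).im < (chi (ξ a) (ξ s)).im) : η ∈ h.right := by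
  have hab := h.lt
  have hsl : ∀ s ∈ Set.Ico a b, h.quot a η s ∈ Complex.slitPlane := fun s hs =>
    h.quot_mem_slitPlane (mem_square_left hs) hη fun hne =>
      (hlt s ⟨lt_of_le_of_ne hs.1 hne.symm, hs.2⟩).ne
  have hζ : ζ ≠ 0 := fun h0 => by have := h.abs_ζ; simp [h0] at this
  have hexp := fun s hs => h.exp_frameLog (mem_square_left hs) hη (hsl s hs)
  obtain ⟨L, hL', he⟩ := h.exists_log (η := η) fun s hs => by
    rcases hs.2.eq_or_lt with rfl | hs'
    · rw [h.det2_close]; exact mul_ne_zero hζ hη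
    · rw [← hexp s ⟨hs.1, hs'⟩]; exact Complex.exp_ne_zero _
  have hL := hL'.continuousOn (s := Set.Icc a b)
  refine h.mem_right_of_log_mem hL he ?_
  have key : ∀ s ∈ Set.Ioo a b, (L s - L a).im - h.Φ (a, s) ∈ Set.Icc 0 Real.pi := fun s hs => by
    have h1 : L s - h.frameLog a η s = L a - h.frameLog a η a :=
      eq_of_exp_eq (S := Set.Ico a b) (c := 1) isPreconnected_Ico
        ((hL.mono Set.Ico_subset_Icc_self).sub
          (h.continuousOn_frameLog (fun s hs => mem_square_left hs) hη hsl))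
        (fun s hs => by
          rw [Pi.sub_apply, Complex.exp_sub, hexp s hs, ← he s (Set.Ico_subset_Icc_self hs),
            div_self (Complex.exp_ne_zero _)])
        (Set.Ioo_subset_Ico_self hs) (Set.left_mem_Ico.2 hab)
    have h2 : L s - L a = h.frameLog a η s - h.frameLog a η a := by linear_combination h1
    have h3 : (h.quot a η a).arg = 0 := by
      rw [h.quot_self hη]; exact Complex.arg_ofReal_of_nonneg (inv_pos.2 (h.curve.V_pos a)).le
    rw [h2, Complex.sub_im, frameLog_im, frameLog_im, h3, h.Φ_symm,
      h.Φ_diag (Set.left_mem_Icc.2 hab.le)]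
    have h4 : 0 ≤ (h.quot a η s).arg := by
      rw [Complex.arg_nonneg_iff, h.quot_im (mem_square_left (Set.Ioo_subset_Ico_self hs))
          hs.1.ne' hη]
      exact mul_nonneg_of_nonpos_of_nonpos (sub_neg.2 hs.1).le (sub_neg.2 (hlt s hs)).le
    have h5 := Complex.arg_le_pi (h.quot a η s)
    constructor <;> linarith
  have hne : (nhdsWithin b (Set.Ioo a b)).NeBot := right_nhdsWithin_Ioo_neBot hab
  have hlim : Filter.Tendsto (fun s => (L s - L a).im - h.Φ (a, s)) (nhdsWithin b (Set.Ioo a b))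
      (nhds ((L b - L a).im - -h.α)) := by
    refine Filter.Tendsto.sub ?_ h.tendsto_Φ_right
    exact (Complex.continuous_im.tendsto _).comp
      (((hL b (Set.right_mem_Icc.2 hab.le)).mono_left
        (nhdsWithin_mono _ Set.Ioo_subset_Icc_self)).sub tendsto_const_nhds)
  have := isClosed_Icc.mem_of_tendsto hlim (by filter_upwards [self_mem_nhdsWithin] using key)
  constructor <;> [linarith [this.1]; linarith [this.2]]

theorem mem_right_of_chi_lt_right (h : SpinorShell ξ V κ a b ζ) {η : ℂ × ℂ}
    (hη : det2 (ξ b) η ≠ 0)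
    (hlt : ∀ s ∈ Set.Ioo a b, (chi (ξ b) η).im < (chi (ξ b) (ξ s)).im) : η ∈ h.right := by
  have hab := h.lt
  have hsl : ∀ s ∈ Set.Ioc a b, h.quot b η s ∈ Complex.slitPlane := fun s hs =>
    h.quot_mem_slitPlane (mem_square_right hs) hη fun hne =>
      (hlt s ⟨hs.1, lt_of_le_of_ne hs.2 hne⟩).ne
  have hexp := fun s hs => h.exp_frameLog (mem_square_right hs) hη (hsl s hs)
  obtain ⟨L, hL', he⟩ := h.exists_log (η := η) fun s hs => by
    rcases hs.1.eq_or_lt with rfl | hs'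
    · rw [h.det2_close] at hη; exact right_ne_zero_of_mul hη
    · rw [← hexp s ⟨hs', hs.2⟩]; exact Complex.exp_ne_zero _
  have hL := hL'.continuousOn (s := Set.Icc a b)
  refine h.mem_right_of_log_mem hL he ?_
  have key : ∀ s ∈ Set.Ioo a b, (L b - L s).im + h.Φ (s, b) ∈ Set.Icc 0 Real.pi := fun s hs => by
    have h1 : L s - h.frameLog b η s = L b - h.frameLog b η b :=
      eq_of_exp_eq (S := Set.Ioc a b) (c := 1) isPreconnected_Ioc
        ((hL.mono Set.Ioc_subset_Icc_self).sub
          (h.continuousOn_frameLog (fun s hs => mem_square_right hs) hη hsl))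
        (fun s hs => by
          rw [Pi.sub_apply, Complex.exp_sub, hexp s hs, ← he s (Set.Ioc_subset_Icc_self hs),
            div_self (Complex.exp_ne_zero _)])
        (Set.Ioo_subset_Ioc_self hs) (Set.right_mem_Ioc.2 hab)
    have h2 : L b - L s = h.frameLog b η b - h.frameLog b η s := by linear_combination -h1
    have h3 : (h.quot b η b).arg = 0 := by
      rw [h.quot_self hη]; exact Complex.arg_ofReal_of_nonneg (inv_pos.2 (h.curve.V_pos b)).le
    rw [h2, Complex.sub_im, frameLog_im, frameLog_im, h3,
      h.Φ_diag (Set.right_mem_Icc.2 hab.le)]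
    have h4 : (h.quot b η s).arg < 0 := by
      rw [Complex.arg_neg_iff, h.quot_im (mem_square_right (Set.Ioo_subset_Ioc_self hs)) hs.2.ne hη]
      exact mul_neg_of_pos_of_neg (sub_pos.2 hs.2) (sub_neg.2 (hlt s hs))
    have h5 := Complex.neg_pi_lt_arg (h.quot b η s)
    constructor <;> linarith
  have hne : (nhdsWithin a (Set.Ioo a b)).NeBot := left_nhdsWithin_Ioo_neBot hab
  have hlim : Filter.Tendsto (fun s => (L b - L s).im + h.Φ (s, b)) (nhdsWithin a (Set.Ioo a b))
      (nhds ((L b - L a).im + h.α)) := by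
    refine Filter.Tendsto.add ?_ h.tendsto_Φ_left
    exact (Complex.continuous_im.tendsto _).comp
      (tendsto_const_nhds.sub ((hL a (Set.left_mem_Icc.2 hab.le)).mono_left
        (nhdsWithin_mono _ Set.Ioo_subset_Icc_self)))
  have := isClosed_Icc.mem_of_tendsto hlim (by filter_upwards [self_mem_nhdsWithin] using key)
  constructor <;> [linarith [this.1]; linarith [this.2]]

/-- A spinor below the curve in the frame at a point of the shell is in the right region. -/
theorem mem_right_of_chi (h : SpinorShell ξ V κ a b ζ) {x : ℝ} (hx : x ∈ Set.Icc a b) {η : ℂ × ℂ}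
    (hη : det2 (ξ x) η ≠ 0)
    (hlt : ∀ s ∈ Set.Icc a b, det2 (ξ x) (ξ s) ≠ 0 → (chi (ξ x) η).im < (chi (ξ x) (ξ s)).im) :
    η ∈ h.right := by
  rcases hx.1.eq_or_lt with rfl | hxa
  · exact h.mem_right_of_chi_lt_left hη fun s hs => hlt s (Set.Ioo_subset_Icc_self hs)
      (h.det2_ne_zero (square_symm (mem_square_left (Set.Ioo_subset_Ico_self hs))) hs.1.ne)
  rcases hx.2.eq_or_lt with rfl | hxb
  · exact h.mem_right_of_chi_lt_right hη fun s hs => hlt s (Set.Ioo_subset_Icc_self hs)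
      (h.det2_ne_zero (square_symm (mem_square_right (Set.Ioo_subset_Ioc_self hs))) hs.2.ne')
  · exact h.mem_right_of_chi_lt ⟨hxa, hxb⟩ hη fun s hs hne => hlt s hs
      (h.det2_ne_zero (square_symm (mem_square_of_Ioo hs ⟨hxa, hxb⟩)) hne.symm)

end SpinorShell

/-- The sign of `defect μ x y` tells whether `y` lies above or below the height `μ` in the frame
of `x`. -/
def defect (μ : ℝ) (x y : ℂ × ℂ) : ℝ :=
  (herm x y * conj (det2 x y)).im - μ * Complex.normSq (det2 x y)

theorem defect_eq (μ : ℝ) (x y : ℂ × ℂ) :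
    defect μ x y = ((chi x y).im - μ) * Complex.normSq (det2 x y) := by
  rw [chi_im, defect]
  rcases eq_or_ne (det2 x y) 0 with h | h
  · simp [h]
  · have : Complex.normSq (det2 x y) ≠ 0 := by simpa using h
    field_simp

theorem defect_neg_iff {μ : ℝ} {x y : ℂ × ℂ} (h : det2 x y ≠ 0) :
    defect μ x y < 0 ↔ (chi x y).im < μ := by
  rw [← not_le, defect_eq, mul_nonneg_iff_of_pos_right (Complex.normSq_pos.2 h), sub_nonneg, not_le]

theorem defect_nonneg_iff {μ : ℝ} {x y : ℂ × ℂ} (h : det2 x y ≠ 0) :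
    0 ≤ defect μ x y ↔ μ ≤ (chi x y).im := by
  rw [← not_lt, defect_neg_iff h, not_lt]

theorem Continuous.defect {X : Type*} [TopologicalSpace X] {f g : X → ℂ × ℂ} (hf : Continuous f)
    (hg : Continuous g) (μ : ℝ) : Continuous fun x => defect μ (f x) (g x) := by
  unfold _root_.defect
  have := Complex.continuous_conj
  have h1 := hf.herm hg
  have h2 := hf.det2 hg
  exact (Complex.continuous_im.comp (h1.mul (this.comp h2))).sub
    (continuous_const.mul (Complex.continuous_normSq.comp h2))

/-- A second order criterion for a strict local maximum. -/
theorem neg_of_second_deriv_neg {f e D W : ℝ → ℝ} {x y δ : ℝ} (hW : ∀ t, 0 < W t)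
    (hf : ∀ t, HasDerivAt f (W t * e t) t) (he : ∀ t, HasDerivAt e (W t * D t) t)
    (hf0 : f x = 0) (he0 : e x = 0) (hD : ∀ t, |t - x| < δ → D t < 0) (hne : y ≠ x)
    (hy : |y - x| < δ) : f y < 0 := by
  have hec : Continuous e := continuous_iff_continuousAt.2 fun t => (he t).continuousAt
  have hfc : Continuous f := continuous_iff_continuousAt.2 fun t => (hf t).continuousAt
  have hanti : StrictAntiOn e (Set.Ioo (x - δ) (x + δ)) := by
    refine strictAntiOn_of_deriv_neg (convex_Ioo _ _) hec.continuousOn fun t ht => ?_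
    rw [interior_Ioo] at ht
    rw [(he t).deriv]
    exact mul_neg_of_pos_of_neg (hW t)
      (hD t (by rw [abs_lt]; constructor <;> linarith [ht.1, ht.2]))
  rw [abs_lt] at hy
  have hδ : 0 < δ := by linarith
  have hx : x ∈ Set.Ioo (x - δ) (x + δ) := ⟨by linarith, by linarith⟩
  rcases lt_or_gt_of_ne hne with h | h
  · have : StrictMonoOn f (Set.Icc y x) := by
      refine strictMonoOn_of_deriv_pos (convex_Icc _ _) hfc.continuousOn fun t ht => ?_
      rw [interior_Icc] at ht
      rw [(hf t).deriv]
      have := hanti (a := t) (b := x) ⟨by linarith [ht.1], by linarith [ht.2]⟩ hx ht.2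
      exact mul_pos (hW t) (by linarith)
    rw [← hf0]
    exact this ⟨le_rfl, h.le⟩ ⟨h.le, le_rfl⟩ h
  · have : StrictAntiOn f (Set.Icc x y) := by
      refine strictAntiOn_of_deriv_neg (convex_Icc _ _) hfc.continuousOn fun t ht => ?_
      rw [interior_Icc] at ht
      rw [(hf t).deriv]
      have := hanti (a := x) (b := t) hx ⟨by linarith [ht.1], by linarith [ht.2]⟩ ht.1
      exact mul_neg_of_pos_of_neg (hW t) (by linarith)
    rw [← hf0]
    exact this ⟨le_rfl, h.le⟩ ⟨h.le, le_rfl⟩ h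

namespace SpinorCurve

variable {ξ : ℝ → ℂ × ℂ} {V κ : ℝ → ℝ}

/-- The derivative of `defect` along a curve, divided by the speed. -/
def defectDeriv (μ : ℝ) (x y : ℂ × ℂ) : ℝ :=
  (herm x y * herm x y).im + (det2 x y * det2 x y).im - 2 * μ * (herm x y * det2 x y).re

/-- The second derivative of `defect` along a curve of curvature `k`, divided by the speed. -/
def defectDeriv2 (μ k : ℝ) (x y : ℂ × ℂ) : ℝ :=
  2 * k * (herm x y * herm x y + det2 x y * det2 x y).re - 4 * (herm x y * conj (det2 x y)).im -
    2 * μ * (-2 * k * (herm x y * det2 x y).im + Complex.normSq (herm x y) -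
      Complex.normSq (det2 x y))

theorem hasDerivAt_defect (hξ : SpinorCurve ξ V κ) (μ : ℝ) (x : ℂ × ℂ) (u : ℝ) :
    HasDerivAt (fun t => defect μ x (ξ t)) (V u * defectDeriv μ x (ξ u)) u := by
  have h1 := hξ.hasDerivAt_herm x u
  have h2 := hξ.hasDerivAt_det2 x u
  have h3 : HasDerivAt (fun t => conj (det2 x (ξ t))) _ u := h2.star_conj
  have h4 := (h1.mul h3)
  have h5 := (Complex.imCLM.hasFDerivAt.comp_hasDerivAt u h4)
  have h6 := (Complex.reCLM.hasFDerivAt.comp_hasDerivAt u (h2.mul h3))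
  have h7 := h5.sub (h6.const_mul μ)
  refine (h7.congr_deriv ?_).congr_of_eventuallyEq (Filter.Eventually.of_forall fun t => ?_)
  · simp only [defectDeriv, Complex.imCLM_apply, Complex.reCLM_apply]
    generalize herm x (ξ u) = z
    generalize det2 x (ξ u) = w
    simp
    ring
  · simp [defect, Complex.normSq_apply]

theorem hasDerivAt_defectDeriv (hξ : SpinorCurve ξ V κ) (μ : ℝ) (x : ℂ × ℂ) (u : ℝ) :
    HasDerivAt (fun t => defectDeriv μ x (ξ t)) (V u * defectDeriv2 μ (κ u) x (ξ u)) u := by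
  have h1 := hξ.hasDerivAt_herm x u
  have h2 := hξ.hasDerivAt_det2 x u
  have h4 := (Complex.imCLM.hasFDerivAt.comp_hasDerivAt u (h1.mul h1))
  have h5 := (Complex.imCLM.hasFDerivAt.comp_hasDerivAt u (h2.mul h2))
  have h6 := (Complex.reCLM.hasFDerivAt.comp_hasDerivAt u (h1.mul h2))
  have h7 := (h4.add h5).sub (h6.const_mul (2 * μ))
  refine (h7.congr_deriv ?_).congr_of_eventuallyEq (Filter.Eventually.of_forall fun t => ?_)
  · simp only [defectDeriv2, Complex.imCLM_apply, Complex.reCLM_apply]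
    generalize herm x (ξ u) = z
    generalize det2 x (ξ u) = w
    simp [Complex.normSq_apply]
    ring
  · simp [defectDeriv]

theorem defect_self (μ : ℝ) (x : ℂ × ℂ) : defect μ x x = 0 := by
  simp [defect, det2_self]

theorem continuous_defectDeriv2 (hξ : SpinorCurve ξ V κ) (μ : ℝ) :
    Continuous fun p : ℝ × ℝ => defectDeriv2 μ (κ p.2) (ξ p.1) (ξ p.2) := by
  have := hξ.cont
  have := hξ.κ_cont
  have h1 : Continuous fun p : ℝ × ℝ => herm (ξ p.1) (ξ p.2) := by fun_prop
  have h2 : Continuous fun p : ℝ × ℝ => det2 (ξ p.1) (ξ p.2) := by fun_prop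
  unfold defectDeriv2
  have := Complex.continuous_normSq
  fun_prop

theorem defectDeriv2_self (hξ : SpinorCurve ξ V κ) (μ s : ℝ) :
    defectDeriv2 μ (κ s) (ξ s) (ξ s) = 2 * (κ s - μ) := by
  simp [defectDeriv2, det2_self, hξ.unit]; ring

theorem defectDeriv_self (hξ : SpinorCurve ξ V κ) (μ s : ℝ) :
    defectDeriv μ (ξ s) (ξ s) = 0 := by
  simp [defectDeriv, det2_self, hξ.unit]

/-- A curve of curvature less than `μ` stays locally below its osculating discs of curvature
`μ`. -/
theorem exists_defect_neg (hξ : SpinorCurve ξ V κ) {μ a b : ℝ}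
    (hκ : ∀ s ∈ Set.Icc a b, κ s < μ) :
    ∃ δ > 0, ∀ x ∈ Set.Icc a b, ∀ y, y ≠ x → |y - x| < δ → defect μ (ξ x) (ξ y) < 0 := by
  have hcont := hξ.continuous_defectDeriv2 μ
  have h1 : ∀ᶠ t : ℝ in nhds 0, ∀ x ∈ Set.Icc a b,
      defectDeriv2 μ (κ (x + t)) (ξ x) (ξ (x + t)) < 0 := by
    refine isCompact_Icc.eventually_forall_of_forall_eventually fun x hx => ?_
    have hU : IsOpen {p : ℝ × ℝ | defectDeriv2 μ (κ (p.2 + p.1)) (ξ p.2) (ξ (p.2 + p.1)) < 0} :=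
      isOpen_lt (hcont.comp (f := fun p : ℝ × ℝ => (p.2, p.2 + p.1)) (by fun_prop))
        continuous_const
    refine hU.mem_nhds ?_
    have := hκ x hx
    simp only [Set.mem_ofPred_eq, add_zero, hξ.defectDeriv2_self]
    linarith
  obtain ⟨δ, hδ, h2⟩ := Metric.eventually_nhds_iff.1 h1
  refine ⟨δ, hδ, fun x hx y hne hy => ?_⟩
  refine neg_of_second_deriv_neg (f := fun t => defect μ (ξ x) (ξ t)) hξ.V_pos
    (hξ.hasDerivAt_defect μ (ξ x))
    (hξ.hasDerivAt_defectDeriv μ (ξ x)) (defect_self μ _) (hξ.defectDeriv_self μ x)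
    (fun t ht => ?_) hne hy
  have := h2 (y := t - x) (by simpa [Real.dist_eq] using ht) x hx
  simpa using this

/-- A curve stays locally above its osculating discs of curvature smaller than its own. -/
theorem eventually_defect_nonneg (hξ : SpinorCurve ξ V κ) {μ x : ℝ} (hκ : μ < κ x) :
    ∀ᶠ y in nhds x, 0 ≤ defect μ (ξ x) (ξ y) := by
  have hcont := hξ.continuous_defectDeriv2 μ
  have h1 : ∀ᶠ t : ℝ in nhds x, 0 < defectDeriv2 μ (κ t) (ξ x) (ξ t) := by
    have hU : IsOpen {t : ℝ | 0 < defectDeriv2 μ (κ t) (ξ x) (ξ t)} :=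
      isOpen_lt continuous_const (hcont.comp (f := fun t : ℝ => (x, t)) (by fun_prop))
    refine hU.mem_nhds ?_
    simp only [Set.mem_ofPred_eq, hξ.defectDeriv2_self]
    linarith
  obtain ⟨δ, hδ, h2⟩ := Metric.eventually_nhds_iff.1 h1
  refine Metric.eventually_nhds_iff.2 ⟨δ, hδ, fun y hy => ?_⟩
  rcases eq_or_ne y x with rfl | hne
  · rw [defect_self]
  have := neg_of_second_deriv_neg (f := fun t => -defect μ (ξ x) (ξ t))
    (e := fun t => -defectDeriv μ (ξ x) (ξ t)) (D := fun t => -defectDeriv2 μ (κ t) (ξ x) (ξ t))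
    (x := x) (y := y) (δ := δ) hξ.V_pos
    (fun t => ((hξ.hasDerivAt_defect μ (ξ x) t).neg).congr_deriv (by ring))
    (fun t => ((hξ.hasDerivAt_defectDeriv μ (ξ x) t).neg).congr_deriv (by ring))
    (by simp [defect_self]) (by simp [hξ.defectDeriv_self]) (fun t ht => ?_) hne hy
  · linarith
  · have := h2 (y := t) ht
    linarith

end SpinorCurve

namespace SpinorShell

open SpinorCurve

variable {ξ : ℝ → ℂ × ℂ} {V κ : ℝ → ℝ} {a b : ℝ} {ζ : ℂ}

theorem exists_eventually_le_chi (h : SpinorShell ξ V κ a b ζ) {x s : ℝ} (hx : x ∈ Set.Icc a b)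
    (hs : s ∈ Set.Icc a b) :
    ∃ k, ∀ᶠ t in nhdsWithin s (Set.Icc a b), det2 (ξ x) (ξ t) ≠ 0 → k ≤ (chi (ξ x) (ξ t)).im := by
  have hcont := h.curve.cont
  have hpos : (∀ᶠ t in nhdsWithin s (Set.Icc a b), 0 ≤ defect 0 (ξ x) (ξ t)) →
      ∃ k, ∀ᶠ t in nhdsWithin s (Set.Icc a b),
        det2 (ξ x) (ξ t) ≠ 0 → k ≤ (chi (ξ x) (ξ t)).im := fun h0 => by
    refine ⟨0, h0.mono fun t ht hne => (defect_nonneg_iff hne).1 ht⟩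
  by_cases hw : det2 (ξ x) (ξ s) = 0
  · rcases eq_or_ne x s with rfl | hne
    · refine ⟨κ x - 1, Filter.Eventually.filter_mono nhdsWithin_le_nhds ?_⟩
      filter_upwards [h.curve.eventually_defect_nonneg (μ := κ x - 1) (x := x) (by linarith)]
        with t ht hne
      exact (defect_nonneg_iff hne).1 ht
    have hcorner : ¬(x, s) ∈ square a b := fun hsq => h.det2_ne_zero hsq hne hw
    have hdist : b - a ≤ |s - x| := by
      by_contra! hc
      exact hcorner ⟨hx, hs, hc⟩
    have hζ : 0 < -(ζ * ζ).im := by have := h.pos; rw [sq] at this; linarith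
    have hder := h.curve.hasDerivAt_defect 0 (ξ x) s
    have hde : defectDeriv 0 (ξ x) (ξ s) = (herm (ξ x) (ξ s) * herm (ξ x) (ξ s)).im := by
      simp [defectDeriv, hw]
    have hd0 : defect 0 (ξ x) (ξ s) = 0 := by simp [defect, hw]
    have hslope := hasDerivAt_iff_tendsto_slope.1 hder
    refine hpos ?_
    rw [le_abs] at hdist
    rcases hdist with hd | hd
    · obtain ⟨rfl, rfl⟩ : x = a ∧ s = b := ⟨by linarith [hx.1, hs.2], by linarith [hx.1, hs.2]⟩
      have hz : herm (ξ x) (ξ s) = ζ := by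
        rw [herm_swap, h.herm_close, h.curve.unit]; simp
      have hneg : V s * defectDeriv 0 (ξ x) (ξ s) < 0 := by
        rw [hde, hz]; exact mul_neg_of_pos_of_neg (h.curve.V_pos s) (by linarith)
      have h2 : ∀ᶠ t in nhdsWithin s {s}ᶜ, slope (fun t => defect 0 (ξ x) (ξ t)) s t < 0 :=
        hslope.eventually_lt_const hneg
      rw [eventually_nhdsWithin_iff] at h2 ⊢
      filter_upwards [h2] with t ht hI
      rcases eq_or_ne t s with rfl | hts
      · exact hd0.ge
      have := ht hts
      rw [slope_def_field, hd0, sub_zero] at this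
      have h3 : t - s < 0 := sub_neg.2 (lt_of_le_of_ne hI.2 hts)
      by_contra! hc
      linarith [div_pos_of_neg_of_neg hc h3]
    · obtain ⟨rfl, rfl⟩ : s = a ∧ x = b := ⟨by linarith [hx.2, hs.1], by linarith [hx.2, hs.1]⟩
      have hz : herm (ξ x) (ξ s) = conj ζ := by
        rw [h.herm_close, h.curve.unit]; simp
      have hneg : 0 < V s * defectDeriv 0 (ξ x) (ξ s) := by
        rw [hde, hz]
        refine mul_pos (h.curve.V_pos s) ?_
        rw [← map_mul, Complex.conj_im]; exact hζ
      have h2 : ∀ᶠ t in nhdsWithin s {s}ᶜ, 0 < slope (fun t => defect 0 (ξ x) (ξ t)) s t :=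
        hslope.eventually_const_lt hneg
      rw [eventually_nhdsWithin_iff] at h2 ⊢
      filter_upwards [h2] with t ht hI
      rcases eq_or_ne t s with rfl | hts
      · exact hd0.ge
      have := ht hts
      rw [slope_def_field, hd0, sub_zero] at this
      have h3 : 0 < t - s := sub_pos.2 (lt_of_le_of_ne hI.1 hts.symm)
      by_contra! hc
      linarith [div_neg_of_neg_of_pos hc h3]
  · refine ⟨(chi (ξ x) (ξ s)).im - 1, Filter.Eventually.filter_mono nhdsWithin_le_nhds ?_⟩
    have hc : ContinuousAt (fun t => (chi (ξ x) (ξ t)).im) s := by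
      refine Complex.continuous_im.continuousAt.comp ?_
      unfold chi
      exact ContinuousAt.div (by fun_prop) (by fun_prop) hw
    filter_upwards [hc.eventually (lt_mem_nhds (sub_one_lt (chi (ξ x) (ξ s)).im))] with t ht _
    exact ht.le

/-- In the frame at one of its points, a positive shell is bounded below, and everything below it
is in the right region. -/
theorem exists_defect_neg_mem_right (h : SpinorShell ξ V κ a b ζ) {x : ℝ}
    (hx : x ∈ Set.Icc a b) :
    ∃ k, ∀ η, defect k (ξ x) η < 0 → η ∈ h.right := by
  have hk : ∃ k, ∀ t ∈ Set.Icc a b, det2 (ξ x) (ξ t) ≠ 0 → k ≤ (chi (ξ x) (ξ t)).im := by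
    refine isCompact_Icc.induction_on (p := fun S => ∃ k, ∀ t ∈ S, det2 (ξ x) (ξ t) ≠ 0 →
      k ≤ (chi (ξ x) (ξ t)).im) ⟨0, by simp⟩ (fun S T hST ⟨k, hk⟩ => ⟨k, fun t ht => hk t (hST ht)⟩)
      (fun S T ⟨k, hk⟩ ⟨m, hm⟩ => ⟨min k m, ?_⟩) fun s hs => ?_
    · rintro t (ht | ht) hne
      · exact (min_le_left _ _).trans (hk t ht hne)
      · exact (min_le_right _ _).trans (hm t ht hne)
    · obtain ⟨k, hk⟩ := h.exists_eventually_le_chi hx hs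
      exact ⟨_, hk, k, fun t ht => ht⟩
  obtain ⟨k, hk⟩ := hk
  refine ⟨k, fun η hη => ?_⟩
  have hne : det2 (ξ x) η ≠ 0 := fun h0 => by simp [defect, h0] at hη
  exact h.mem_right_of_chi hx hne fun s hs hs' =>
    ((defect_neg_iff hne).1 hη).trans_le (hk s hs hs')

end SpinorShell

theorem nonpos_of_sin_nonpos {f : ℝ → ℝ} {s t : ℝ} (hst : s ≤ t)
    (hf : ContinuousOn f (Set.Icc s t)) (h0 : f s = 0)
    (hsin : ∀ x ∈ Set.Ioc s t, Real.sin (f x) ≤ 0) : f t ≤ 0 := by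
  by_contra! hc
  have hpi := Real.pi_pos
  have hm : min (f t) (Real.pi / 2) ∈ Set.Icc (f s) (f t) :=
    ⟨by rw [h0]; exact le_min hc.le (by linarith), min_le_left _ _⟩
  obtain ⟨x, hx, hfx⟩ := intermediate_value_Icc hst hf hm
  have hpos : 0 < f x := by rw [hfx]; exact lt_min hc (by linarith)
  have hle : f x ≤ Real.pi / 2 := by rw [hfx]; exact min_le_right _ _
  have hne : s ≠ x := fun h => by rw [← h, h0] at hpos; exact hpos.false
  exact (Real.sin_pos_of_pos_of_lt_pi hpos (by linarith)).not_ge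
    (hsin x ⟨lt_of_le_of_ne hx.1 hne, hx.2⟩)

theorem nonneg_of_sin_nonneg_left {f : ℝ → ℝ} {s t : ℝ} (hst : s ≤ t)
    (hf : ContinuousOn f (Set.Icc s t)) (h0 : f t = 0)
    (hsin : ∀ x ∈ Set.Ico s t, 0 ≤ Real.sin (f x)) : 0 ≤ f s := by
  have := nonpos_of_sin_nonpos (f := fun x => -f (-x)) (neg_le_neg hst)
    (hf.comp (f := fun x => -x) (by fun_prop) fun x hx =>
      ⟨by linarith [hx.2], by linarith [hx.1]⟩).neg (by simp [h0]) fun x hx => by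
        rw [Real.sin_neg, neg_nonpos]
        exact hsin _ ⟨by linarith [hx.2], by linarith [hx.1]⟩
  simpa using this

namespace SpinorShell

open SpinorCurve

variable {ξ : ℝ → ℂ × ℂ} {V κ : ℝ → ℝ} {a b : ℝ} {ζ : ℂ}

/-- The lifted argument of the difference of the affine coordinates of `ξ u` and `ξ s` in the frame
at `x`. -/
def turn (h : SpinorShell ξ V κ a b ζ) (x s u : ℝ) : ℝ := h.Φ (s, u) - h.Φ (x, u) - h.Φ (s, x)

theorem exists_chi_sub_eq (h : SpinorShell ξ V κ a b ζ) {x s u : ℝ} (hs : a ≤ s) (hsx : s < x)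
    (hxu : x < u) (hu : u ≤ b) (hne : u - s < b - a) :
    ∃ ρ : ℝ, 0 < ρ ∧
      chi (ξ x) (ξ u) - chi (ξ x) (ξ s) = ρ * Complex.exp (h.turn x s u * Complex.I) := by
  have hx : x ∈ Set.Ioo a b := ⟨by linarith, by linarith⟩
  have q1 : (s, x) ∈ square a b := mem_square_of_Ioo ⟨hs, by linarith⟩ hx
  have q2 : (x, u) ∈ square a b := square_symm (mem_square_of_Ioo ⟨by linarith, hu⟩ hx)
  have q3 : (s, u) ∈ square a b := ⟨⟨hs, by linarith⟩, ⟨by linarith, hu⟩, by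
    simp only; rwa [abs_of_pos (by linarith)]⟩
  have e0 := h.quot_eq q1 hsx.ne (h.det2_ne_zero q2 hxu.ne)
  have d1 := h.divided_eq_norm_mul_exp q1
  have d2 := h.divided_eq_norm_mul_exp q2
  have d3 := h.divided_eq_norm_mul_exp q3
  have n1 := norm_pos_iff.2 (h.divided_ne_zero q1)
  have n2 := norm_pos_iff.2 (h.divided_ne_zero q2)
  have n3 := norm_pos_iff.2 (h.divided_ne_zero q3)
  refine ⟨(u - s) * ‖h.curve.divided (s, u)‖ /
    ((u - x) * (x - s) * ‖h.curve.divided (x, u)‖ * ‖h.curve.divided (s, x)‖), ?_, ?_⟩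
  · have := sub_pos.2 hsx
    have := sub_pos.2 hxu
    have := sub_pos.2 (hsx.trans hxu)
    positivity
  · have m1 : ((x - s : ℝ) : ℂ) ≠ 0 := by exact_mod_cast (sub_pos.2 hsx).ne'
    have m2 : ((u - x : ℝ) : ℂ) ≠ 0 := by exact_mod_cast (sub_pos.2 hxu).ne'
    have k1 : (‖h.curve.divided (s, x)‖ : ℂ) ≠ 0 := by exact_mod_cast n1.ne'
    have k2 : (‖h.curve.divided (x, u)‖ : ℂ) ≠ 0 := by exact_mod_cast n2.ne'
    have ex1 := Complex.exp_ne_zero (h.Φ (s, x) * Complex.I)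
    have ex2 := Complex.exp_ne_zero (h.Φ (x, u) * Complex.I)
    have e1 : chi (ξ x) (ξ u) - chi (ξ x) (ξ s) = h.quot x (ξ u) s / (x - s : ℝ) := by
      rw [e0]; field_simp
    rw [e1, quot, h.curve.det2_eq_divided, h.curve.det2_eq_divided, d1, d2, d3, turn]
    push_cast at m1 m2 ⊢
    simp only [Complex.norm_mul, Complex.norm_real, norm_norm, Complex.norm_exp_ofReal_mul_I,
      mul_one, sub_mul, Complex.exp_sub]
    field_simp

/-- If `s < x < u` both realize the maximal height in the frame at `x`, then `ξ s` lies to the left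
of `ξ u`. -/
theorem re_chi_lt (h : SpinorShell ξ V κ a b ζ) {x s u : ℝ} (hs : a ≤ s) (hsx : s < x)
    (hxu : x < u) (hu : u ≤ b)
    (hmaxs : ∀ t ∈ Set.Icc a b, t ≠ x → (chi (ξ x) (ξ t)).im ≤ (chi (ξ x) (ξ s)).im)
    (hmaxu : ∀ t ∈ Set.Icc a b, t ≠ x → (chi (ξ x) (ξ t)).im ≤ (chi (ξ x) (ξ u)).im) :
    (chi (ξ x) (ξ s)).re < (chi (ξ x) (ξ u)).re := by
  have hx : x ∈ Set.Ioo a b := ⟨by linarith, by linarith⟩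
  have hI : x ∈ Set.Icc a b := Set.Ioo_subset_Icc_self hx
  have sq1 : ∀ {t}, t ∈ Set.Icc a b → (t, x) ∈ square a b := fun ht => mem_square_of_Ioo ht hx
  have im_eq : ∀ {t v : ℝ}, a ≤ t → t < x → x < v → v ≤ b → v - t < b - a →
      ∃ ρ : ℝ, 0 < ρ ∧ (chi (ξ x) (ξ v)).im - (chi (ξ x) (ξ t)).im = ρ * Real.sin (h.turn x t v) :=
    fun h1 h2 h3 h4 h5 => by
      obtain ⟨ρ, hρ, he⟩ := h.exists_chi_sub_eq h1 h2 h3 h4 h5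
      refine ⟨ρ, hρ, ?_⟩
      rw [← Complex.sub_im, he, Complex.im_ofReal_mul, Complex.exp_ofReal_mul_I_im]
  have hle : ∀ v, x < v → v ≤ b → v - s < b - a → h.turn x s v ≤ 0 := fun v h1 h2 h3 => by
    have hsq : ∀ t ∈ Set.Icc x v, (s, t) ∈ square a b := fun t ht =>
      ⟨⟨hs, by linarith⟩, ⟨by linarith [ht.1], by linarith [ht.2]⟩, by
        simp only; rw [abs_of_pos (by linarith [ht.1])]; linarith [ht.2]⟩
    have hsq' : ∀ t ∈ Set.Icc x v, (x, t) ∈ square a b := fun t ht =>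
      square_symm (sq1 ⟨by linarith [ht.1], by linarith [ht.2]⟩)
    refine nonpos_of_sin_nonpos h1.le (((h.continuousOn_Φ.comp (by fun_prop) hsq).sub
      (h.continuousOn_Φ.comp (by fun_prop) hsq')).sub continuousOn_const) ?_ fun t ht => ?_
    · rw [turn, h.Φ_diag hI]; ring
    · obtain ⟨ρ, hρ, he⟩ := im_eq hs hsx ht.1 (ht.2.trans h2) (by linarith [ht.2])
      have := hmaxs t ⟨by linarith [ht.1], by linarith [ht.2]⟩ ht.1.ne'
      by_contra! hc
      linarith [mul_pos hρ hc]
  have hge : ∀ v, a ≤ v → v < x → u - v < b - a → 0 ≤ h.turn x v u := fun v h1 h2 h3 => by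
    have hsq : ∀ t ∈ Set.Icc v x, (t, u) ∈ square a b := fun t ht =>
      ⟨⟨by linarith [ht.1], by linarith [ht.2]⟩, ⟨by linarith [ht.1], hu⟩, by
        simp only; rw [abs_of_pos (by linarith [ht.2])]; linarith [ht.1]⟩
    have hsq' : ∀ t ∈ Set.Icc v x, (t, x) ∈ square a b := fun t ht =>
      sq1 ⟨by linarith [ht.1], by linarith [ht.2]⟩
    refine nonneg_of_sin_nonneg_left (f := fun v => h.turn x v u) h2.le
      (((h.continuousOn_Φ.comp (by fun_prop) hsq).sub continuousOn_const).sub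
      (h.continuousOn_Φ.comp (by fun_prop) hsq')) ?_ fun t ht => ?_
    · rw [turn, h.Φ_diag hI]; ring
    · obtain ⟨ρ, hρ, he⟩ := im_eq (h1.trans ht.1) ht.2 hxu hu (by linarith [ht.1])
      have := hmaxu t ⟨by linarith [ht.1], by linarith [ht.2]⟩ ht.2.ne
      by_contra! hc
      linarith [mul_neg_of_pos_of_neg hρ hc]
  by_cases hcor : u - s < b - a
  · obtain ⟨ρ, hρ, he⟩ := h.exists_chi_sub_eq hs hsx hxu hu hcor
    rw [le_antisymm (hle u hxu hu hcor) (hge s hs hsx hcor)] at he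
    have := congrArg Complex.re he
    simp at this
    linarith
  · obtain ⟨rfl, rfl⟩ : s = a ∧ u = b := ⟨by linarith, by linarith⟩
    have hab := h.lt
    have hα := h.α_neg
    have t1 : Filter.Tendsto (fun v => h.turn x s v) (nhdsWithin u (Set.Ioo s u))
        (nhds (-h.α - h.Φ (x, u) - h.Φ (s, x))) := by
      refine (h.tendsto_Φ_right.sub ?_).sub tendsto_const_nhds
      exact ((h.continuousOn_Φ.comp (f := fun t => (x, t)) (s := Set.Icc s u) (by fun_prop)
        fun t ht => square_symm (sq1 ht)) u (Set.right_mem_Icc.2 hab.le)).mono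
        Set.Ioo_subset_Icc_self
    have t2 : Filter.Tendsto (fun v => h.turn x v u) (nhdsWithin s (Set.Ioo s u))
        (nhds (h.α - h.Φ (x, u) - h.Φ (s, x))) := by
      refine (h.tendsto_Φ_left.sub tendsto_const_nhds).sub ?_
      exact ((h.continuousOn_Φ.comp (f := fun t => (t, x)) (s := Set.Icc s u) (by fun_prop)
        fun t ht => sq1 ht) s (Set.left_mem_Icc.2 hab.le)).mono
        Set.Ioo_subset_Icc_self
    have n1 : (nhdsWithin s (Set.Ioo s u)).NeBot := left_nhdsWithin_Ioo_neBot hab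
    have n2 : (nhdsWithin u (Set.Ioo s u)).NeBot := right_nhdsWithin_Ioo_neBot hab
    have l1 : -h.α - h.Φ (x, u) - h.Φ (s, x) ≤ 0 := by
      refine le_of_tendsto t1 ?_
      filter_upwards [self_mem_nhdsWithin, nhdsWithin_le_nhds (lt_mem_nhds hxu)] with v hv hv'
      exact hle v hv' hv.2.le (by linarith [hv.2])
    have l2 : 0 ≤ h.α - h.Φ (x, u) - h.Φ (s, x) := by
      refine ge_of_tendsto t2 ?_
      filter_upwards [self_mem_nhdsWithin, nhdsWithin_le_nhds (gt_mem_nhds hsx)] with v hv hv'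
      exact hge v hv.1.le hv' (by linarith [hv.1])
    linarith

end SpinorShell

namespace SpinorCurve

variable {ξ : ℝ → ℂ × ℂ} {V κ : ℝ → ℝ}

theorem hasDerivAt_chi_im_left (hξ : SpinorCurve ξ V κ) {y : ℂ × ℂ} {x : ℝ}
    (hw : det2 (ξ x) y ≠ 0) :
    HasDerivAt (fun t => (chi (ξ t) y).im)
      (2 * V x * (chi (ξ x) y).re * ((chi (ξ x) y).im - κ x)) x := by
  have h1 := (hξ.hasDerivAt_herm_left y x).div (hξ.hasDerivAt_det2_left y x) hw
  have h2 := Complex.imCLM.hasFDerivAt.comp_hasDerivAt x h1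
  refine (h2.congr_deriv ?_).congr_of_eventuallyEq (Filter.Eventually.of_forall fun t => rfl)
  have h3 : ((V x : ℂ) * (-(Complex.I * κ x * herm (ξ x) y) + det2 (ξ x) y) * det2 (ξ x) y -
      herm (ξ x) y * (V x * (Complex.I * κ x * det2 (ξ x) y - herm (ξ x) y))) /
      det2 (ξ x) y ^ 2 = V x * (1 + chi (ξ x) y * chi (ξ x) y -
        2 * (Complex.I * (κ x * chi (ξ x) y))) := by
    rw [chi]; field_simp; ring
  rw [h3, Complex.imCLM_apply]
  generalize chi (ξ x) y = c
  simp
  ring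

/-- If the height in the frame at `x` grows faster at `z` than at `w`, then the height at points
near `w` falls behind the height at `z`. -/
theorem eventually_chi_im_lt (hξ : SpinorCurve ξ V κ) {x z w : ℝ} (hz : det2 (ξ x) (ξ z) ≠ 0)
    (hw : det2 (ξ x) (ξ w) ≠ 0)
    (hlt : (chi (ξ x) (ξ w)).re * ((chi (ξ x) (ξ w)).im - κ x) <
      (chi (ξ x) (ξ z)).re * ((chi (ξ x) (ξ z)).im - κ x)) :
    ∀ᶠ p : ℝ × ℝ in nhds (x, w), x < p.1 →
      (chi (ξ p.1) (ξ p.2)).im - (chi (ξ x) (ξ p.2)).im <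
        (chi (ξ p.1) (ξ z)).im - (chi (ξ x) (ξ z)).im := by
  have := hξ.cont
  have := hξ.κ_cont
  have hca : ∀ {y : ℝ}, det2 (ξ x) (ξ y) ≠ 0 →
      ContinuousAt (fun p : ℝ × ℝ => chi (ξ p.1) (ξ p.2)) (x, y) := fun hy => by
    unfold chi
    exact ContinuousAt.div (by fun_prop) (by fun_prop) hy
  have hza : ContinuousAt (fun p : ℝ × ℝ => chi (ξ p.1) (ξ z)) (x, w) :=
    ContinuousAt.comp (x := (x, w)) (g := fun p : ℝ × ℝ => chi (ξ p.1) (ξ p.2))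
      (f := fun p : ℝ × ℝ => (p.1, z)) (hca hz) (by fun_prop)
  have hwa := hca hw
  have e1 : ∀ᶠ p : ℝ × ℝ in nhds (x, w), det2 (ξ p.1) (ξ z) ≠ 0 ∧ det2 (ξ p.1) (ξ p.2) ≠ 0 ∧
      (chi (ξ p.1) (ξ p.2)).re * ((chi (ξ p.1) (ξ p.2)).im - κ p.1) <
        (chi (ξ p.1) (ξ z)).re * ((chi (ξ p.1) (ξ z)).im - κ p.1) := by
    refine Filter.Eventually.and ?_ (Filter.Eventually.and ?_ ?_)
    · exact ContinuousAt.eventually_ne (by fun_prop) hz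
    · exact ContinuousAt.eventually_ne (by fun_prop) hw
    · refine ContinuousAt.eventually_lt (f := fun p : ℝ × ℝ => (chi (ξ p.1) (ξ p.2)).re *
        ((chi (ξ p.1) (ξ p.2)).im - κ p.1)) (g := fun p : ℝ × ℝ => (chi (ξ p.1) (ξ z)).re *
        ((chi (ξ p.1) (ξ z)).im - κ p.1)) ?_ ?_ hlt
      · exact (Complex.continuous_re.continuousAt.comp hwa).mul
          ((Complex.continuous_im.continuousAt.comp hwa).sub (by fun_prop))
      · exact (Complex.continuous_re.continuousAt.comp hza).mul
          ((Complex.continuous_im.continuousAt.comp hza).sub (by fun_prop))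
  obtain ⟨ε, hε, h2⟩ := Metric.eventually_nhds_iff.1 e1
  refine Metric.eventually_nhds_iff.2 ⟨ε, hε, fun {p} hp hxp => ?_⟩
  rw [Prod.dist_eq, max_lt_iff, Real.dist_eq, Real.dist_eq, abs_of_pos (by simpa using hxp)] at hp
  have h3 : ∀ c ∈ Set.Icc x p.1, det2 (ξ c) (ξ z) ≠ 0 ∧ det2 (ξ c) (ξ p.2) ≠ 0 ∧
      (chi (ξ c) (ξ p.2)).re * ((chi (ξ c) (ξ p.2)).im - κ c) <
        (chi (ξ c) (ξ z)).re * ((chi (ξ c) (ξ z)).im - κ c) := fun c hc => by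
    refine h2 (y := (c, p.2)) ?_
    rw [Prod.dist_eq, max_lt_iff, Real.dist_eq, Real.dist_eq,
      abs_of_nonneg (by simpa using hc.1)]
    exact ⟨by have := hc.2; simp only at *; linarith [hp.1], hp.2⟩
  have h4 : ∀ c ∈ Set.Icc x p.1, HasDerivAt
      (fun t => (chi (ξ t) (ξ p.2)).im - (chi (ξ t) (ξ z)).im) _ c := fun c hc =>
    (hξ.hasDerivAt_chi_im_left (h3 c hc).2.1).sub (hξ.hasDerivAt_chi_im_left (h3 c hc).1)
  have h5 : StrictAntiOn (fun t => (chi (ξ t) (ξ p.2)).im - (chi (ξ t) (ξ z)).im)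
      (Set.Icc x p.1) := by
    refine strictAntiOn_of_deriv_neg (convex_Icc _ _)
      (fun c hc => (h4 c hc).continuousAt.continuousWithinAt) fun c hc => ?_
    rw [interior_Icc] at hc
    have hc' := Set.Ioo_subset_Icc_self hc
    rw [(h4 c hc').deriv]
    have := mul_lt_mul_of_pos_left (h3 c hc').2.2 (hξ.V_pos c)
    linarith
  have := h5 (Set.left_mem_Icc.2 hxp.le) (Set.right_mem_Icc.2 hxp.le) hxp
  simp only at this
  linarith

end SpinorCurve

namespace SpinorShell

open SpinorCurve

variable {ξ : ℝ → ℂ × ℂ} {V κ : ℝ → ℝ} {a b : ℝ} {ζ : ℂ}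

/-- `y` maximizes the height in the frame at `x`. -/
def IsTop (_h : SpinorShell ξ V κ a b ζ) (x y : ℝ) : Prop :=
  ∀ t ∈ Set.Icc a b, (herm (ξ x) (ξ t) * conj (det2 (ξ x) (ξ t))).im *
      Complex.normSq (det2 (ξ x) (ξ y)) ≤
    (herm (ξ x) (ξ y) * conj (det2 (ξ x) (ξ y))).im * Complex.normSq (det2 (ξ x) (ξ t))

theorem det2_ne_of_Ioo (h : SpinorShell ξ V κ a b ζ) {x y : ℝ} (hx : x ∈ Set.Ioo a b)
    (hy : y ∈ Set.Icc a b) (hne : y ≠ x) : det2 (ξ x) (ξ y) ≠ 0 :=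
  h.det2_ne_zero (square_symm (mem_square_of_Ioo hy hx)) hne.symm

theorem isTop_iff (h : SpinorShell ξ V κ a b ζ) {x y : ℝ} (hx : x ∈ Set.Ioo a b)
    (hy : y ∈ Set.Icc a b) (hne : y ≠ x) :
    h.IsTop x y ↔ ∀ t ∈ Set.Icc a b, t ≠ x → (chi (ξ x) (ξ t)).im ≤ (chi (ξ x) (ξ y)).im := by
  have h1 := Complex.normSq_pos.2 (h.det2_ne_of_Ioo hx hy hne)
  have key : ∀ t ∈ Set.Icc a b, t ≠ x → ((herm (ξ x) (ξ t) * conj (det2 (ξ x) (ξ t))).im *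
      Complex.normSq (det2 (ξ x) (ξ y)) ≤
    (herm (ξ x) (ξ y) * conj (det2 (ξ x) (ξ y))).im * Complex.normSq (det2 (ξ x) (ξ t)) ↔
      (chi (ξ x) (ξ t)).im ≤ (chi (ξ x) (ξ y)).im) := fun t ht hne => by
    rw [chi_im, chi_im, div_le_div_iff₀ (Complex.normSq_pos.2 (h.det2_ne_of_Ioo hx ht hne)) h1]
  refine ⟨fun H t ht hne => (key t ht hne).1 (H t ht), fun H t ht => ?_⟩
  rcases eq_or_ne t x with rfl | hne
  · simp [det2_self]
  · exact (key t ht hne).2 (H t ht hne)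

theorem isClosed_isTop (h : SpinorShell ξ V κ a b ζ) :
    IsClosed {p : ℝ × ℝ | h.IsTop p.1 p.2} := by
  have := h.curve.cont
  have := Complex.continuous_conj
  have := Complex.continuous_normSq
  have := Complex.continuous_im
  have : {p : ℝ × ℝ | h.IsTop p.1 p.2} = ⋂ t ∈ Set.Icc a b, {p : ℝ × ℝ |
      (herm (ξ p.1) (ξ t) * conj (det2 (ξ p.1) (ξ t))).im *
      Complex.normSq (det2 (ξ p.1) (ξ p.2)) ≤
    (herm (ξ p.1) (ξ p.2) * conj (det2 (ξ p.1) (ξ p.2))).im *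
      Complex.normSq (det2 (ξ p.1) (ξ t))} := by
    ext p; simp [IsTop]
  rw [this]
  refine isClosed_biInter fun t _ => isClosed_le ?_ ?_
  · exact (Complex.continuous_im.comp (by fun_prop)).mul
      (Complex.continuous_normSq.comp (by fun_prop))
  · exact (Complex.continuous_im.comp (by fun_prop)).mul
      (Complex.continuous_normSq.comp (by fun_prop))

/-- A version of the Pestov-Ionin theorem: a positive shell of curvature less than `μ` lies below
one of its tangent discs of curvature `μ`. -/
theorem exists_chi_le (h : SpinorShell ξ V κ a b ζ) {μ : ℝ} (hκ : ∀ s ∈ Set.Icc a b, κ s < μ) :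
    ∃ x ∈ Set.Ioo a b, ∀ y ∈ Set.Icc a b, y ≠ x → (chi (ξ x) (ξ y)).im ≤ μ := by
  by_contra! hc
  have hab := h.lt
  have hcont := h.curve.cont
  obtain ⟨δ₀, hδ₀, hnear⟩ := h.curve.exists_defect_neg hκ
  obtain ⟨δ, hδ, hδ₁, hδ₂⟩ : ∃ δ, 0 < δ ∧ δ ≤ δ₀ ∧ δ ≤ b - a :=
    ⟨min δ₀ (b - a), lt_min hδ₀ (by linarith), min_le_left _ _, min_le_right _ _⟩
  have hfar : ∀ x ∈ Set.Ioo a b, ∀ y ∈ Set.Icc a b, y ≠ x → μ ≤ (chi (ξ x) (ξ y)).im →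
      δ ≤ |y - x| := fun x hx y hy hne hle => by
    by_contra! hlt
    have := hnear x (Set.Ioo_subset_Icc_self hx) y hne (hlt.trans_le hδ₁)
    rw [defect_neg_iff (h.det2_ne_of_Ioo hx hy hne)] at this
    linarith
  have hmax : ∀ x ∈ Set.Ioo a b, ∃ y ∈ Set.Icc a b, δ ≤ |y - x| ∧ h.IsTop x y := fun x hx => by
    obtain ⟨y₀, hy₀, hne₀, hlt₀⟩ := hc x hx
    have hne : ∀ {y : ℝ}, δ ≤ |y - x| → y ≠ x := fun hy he => by
      rw [he, sub_self, abs_zero] at hy; linarith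
    have hcpt : IsCompact (Set.Icc a b ∩ {y | δ ≤ |y - x|}) :=
      isCompact_Icc.inter_right (isClosed_le (by fun_prop) (by fun_prop))
    obtain ⟨y, hy, hymax⟩ := hcpt.exists_isMaxOn ⟨y₀, hy₀, hfar x hx y₀ hy₀ hne₀ hlt₀.le⟩
      (f := fun y => (chi (ξ x) (ξ y)).im) (Complex.continuous_im.comp_continuousOn
        (ContinuousOn.div (by fun_prop) (by fun_prop) fun y hy =>
          h.det2_ne_of_Ioo hx hy.1 (hne hy.2)))
    refine ⟨y, hy.1, hy.2, (h.isTop_iff hx hy.1 (hne hy.2)).2 fun t ht htx => ?_⟩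
    by_cases htd : δ ≤ |t - x|
    · exact hymax ⟨ht, htd⟩
    · have h1 : ¬μ ≤ (chi (ξ x) (ξ t)).im := fun hle => htd (hfar x hx t ht htx hle)
      have h2 : (chi (ξ x) (ξ y₀)).im ≤ (chi (ξ x) (ξ y)).im :=
        hymax ⟨hy₀, hfar x hx y₀ hy₀ hne₀ hlt₀.le⟩
      linarith
  have hmu : ∀ x ∈ Set.Ioo a b, ∀ y ∈ Set.Icc a b, y ≠ x → h.IsTop x y →
      μ < (chi (ξ x) (ξ y)).im := fun x hx y hy hne ht => by
    obtain ⟨y₀, hy₀, hne₀, hlt₀⟩ := hc x hx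
    exact hlt₀.trans_le ((h.isTop_iff hx hy hne).1 ht y₀ hy₀ hne₀)
  set S : Set ℝ := Prod.fst '' ((Set.Icc (a + δ / 2) (b - δ / 2) ×ˢ Set.Icc a b) ∩
    ({p : ℝ × ℝ | p.1 + δ ≤ p.2} ∩ {p : ℝ × ℝ | h.IsTop p.1 p.2})) with hS
  have hScpt : IsCompact S := by
    refine IsCompact.image ?_ continuous_fst
    exact (isCompact_Icc.prod isCompact_Icc).inter_right
      ((isClosed_le (by fun_prop) (by fun_prop)).inter h.isClosed_isTop)
  have hSne : S.Nonempty := by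
    obtain ⟨y, hy, hyd, hyt⟩ := hmax (a + δ / 2) ⟨by linarith, by linarith⟩
    refine ⟨a + δ / 2, (a + δ / 2, y), ⟨⟨⟨le_rfl, by simp only; linarith⟩, hy⟩, ?_, hyt⟩, rfl⟩
    rcases le_abs.1 hyd with h1 | h1
    · simp only [Set.mem_ofPred_eq]; linarith
    · linarith [hy.1]
  obtain ⟨x₀, ⟨⟨x', z⟩, ⟨⟨hx₀, hz⟩, hxz, hztop⟩, rfl⟩, hgreat⟩ := hScpt.exists_isGreatest hSne
  simp only [Set.mem_ofPred_eq] at hxz hztop hx₀ hz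
  have hx'b : x' < b - δ / 2 := by linarith [hz.2]
  have hxI : x' ∈ Set.Ioo a b := ⟨by linarith [hx₀.1], by linarith⟩
  have hzne : z ≠ x' := by intro he; linarith
  have hzmax := (h.isTop_iff hxI hz hzne).1 hztop
  have hloc : ∀ w ∈ Set.Icc a b, ∀ᶠ p : ℝ × ℝ in nhds (x', w), x' < p.1 → p.2 ≤ p.1 - δ →
      p.2 ∈ Set.Icc a b → ¬h.IsTop p.1 p.2 := fun w hw => by
    by_cases h1 : w ≤ x' - δ
    · by_cases h2 : h.IsTop x' w
      · have hwne : w ≠ x' := by intro he; linarith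
        have hwmax := (h.isTop_iff hxI hw hwne).1 h2
        have heq : (chi (ξ x') (ξ w)).im = (chi (ξ x') (ξ z)).im :=
          le_antisymm (hzmax w hw hwne) (hwmax z hz hzne)
        have hre := h.re_chi_lt hw.1 (by linarith) (by linarith : x' < z) hz.2 hwmax hzmax
        have hpos : 0 < (chi (ξ x') (ξ z)).im - κ x' := by
          linarith [hmu x' hxI z hz hzne hztop, hκ x' (Set.Ioo_subset_Icc_self hxI)]
        have hev := h.curve.eventually_chi_im_lt (h.det2_ne_of_Ioo hxI hz hzne)
          (h.det2_ne_of_Ioo hxI hw hwne) (by rw [heq]; exact mul_lt_mul_of_pos_right hre hpos)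
        have hfst : Filter.Tendsto Prod.fst (nhds (x', w)) (nhds x') := continuous_fst.tendsto _
        have hsnd : Filter.Tendsto Prod.snd (nhds (x', w)) (nhds w) := continuous_snd.tendsto _
        have hlt1 : x' < min z b := lt_min (by linarith) hxI.2
        filter_upwards [hev, hfst.eventually (gt_mem_nhds hlt1),
          hsnd.eventually (gt_mem_nhds (by linarith : w < x'))] with p hp hpz hpw hpx hpd hpI htop
        have hpz1 := hpz.trans_le (min_le_left _ _)
        have hpz2 := hpz.trans_le (min_le_right _ _)
        have hpIoo : p.1 ∈ Set.Ioo a b := ⟨by linarith [hxI.1], hpz2⟩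
        have hpne : p.2 ≠ p.1 := by intro he; linarith
        have c1 := (h.isTop_iff hpIoo hpI hpne).1 htop z hz hpz1.ne'
        have c2 := hzmax p.2 hpI hpw.ne
        linarith [hp hpx]
      · have : {p : ℝ × ℝ | h.IsTop p.1 p.2}ᶜ ∈ nhds (x', w) :=
          h.isClosed_isTop.isOpen_compl.mem_nhds h2
        filter_upwards [this] with p hp _ _ _ using hp
    · have : {p : ℝ × ℝ | p.1 - δ < p.2} ∈ nhds (x', w) :=
        (isOpen_lt (by fun_prop) (by fun_prop)).mem_nhds (by
          simp only [Set.mem_ofPred_eq]; linarith)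
      filter_upwards [this] with p hp _ hle
      linarith
  have hev : ∀ᶠ x in nhds x', ∀ w ∈ Set.Icc a b, x' < x → w ≤ x - δ →
      w ∈ Set.Icc a b → ¬h.IsTop x w :=
    isCompact_Icc.eventually_forall_of_forall_eventually fun w hw => hloc w hw
  have hright := (hev.filter_mono nhdsWithin_le_nhds).and
    (Ioo_mem_nhdsGT hx'b)
  obtain ⟨x, hx1, hx2⟩ := hright.exists
  have hxI' : x ∈ Set.Ioo a b := ⟨by linarith [hxI.1, hx2.1], by linarith [hx2.2]⟩
  obtain ⟨y, hy, hyd, hyt⟩ := hmax x hxI'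
  rcases le_abs.1 hyd with h1 | h1
  · have : x ∈ S := ⟨(x, y), ⟨⟨⟨by simp only; linarith [hx₀.1, hx2.1], hx2.2.le⟩, hy⟩,
      by simp only [Set.mem_ofPred_eq]; linarith, hyt⟩, rfl⟩
    linarith [hgreat this, hx2.1]
  · exact hx1 y hy hx2.1 (by linarith) hy hyt

end SpinorShell

/-- The conjugate of a spinor as a quaternion. -/
def qconj (x : ℂ × ℂ) : ℂ × ℂ := (conj x.1, -x.2)

theorem act_assoc (x y z : ℂ × ℂ) : act (act x y) z = act x (act y z) := by
  simp only [act, Prod.mk.injEq, map_sub, map_add, map_mul, Complex.conj_conj]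
  constructor <;> ring

theorem act_one (x : ℂ × ℂ) : act x (1, 0) = x := by simp [act]

theorem one_act (x : ℂ × ℂ) : act (1, 0) x = x := by simp [act]

theorem act_qconj {x : ℂ × ℂ} (hx : herm x x = 1) : act x (qconj x) = (1, 0) := by
  simp only [act, qconj, herm] at *
  refine Prod.ext ?_ ?_
  · simp only; linear_combination hx
  · simp only; ring

theorem qconj_act {x : ℂ × ℂ} (hx : herm x x = 1) : act (qconj x) x = (1, 0) := by
  simp only [act, qconj, herm] at *
  refine Prod.ext ?_ ?_
  · simp only [map_neg]; linear_combination hx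
  · simp only [Complex.conj_conj]; ring

theorem act_smul (x y : ℂ × ℂ) (c : ℂ) : act x (c • y) = c • act x y := by
  simp only [act, Prod.smul_fst, Prod.smul_snd, smul_eq_mul, Prod.smul_mk, Prod.mk.injEq]
  constructor <;> ring

theorem act_neg (x y : ℂ × ℂ) : act x (-y) = -act x y := by
  simp only [act, Prod.fst_neg, Prod.snd_neg, Prod.neg_mk, Prod.mk.injEq]
  constructor <;> ring

theorem neg_act (x y : ℂ × ℂ) : act (-x) y = -act x y := by
  simp only [act, Prod.fst_neg, Prod.snd_neg, Prod.neg_mk, Prod.mk.injEq, map_neg]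
  constructor <;> ring

theorem smul_act (c : ℂ) (x y : ℂ × ℂ) : act (c • x) y = act x (c * y.1, conj c * y.2) := by
  simp only [act, Prod.smul_fst, Prod.smul_snd, smul_eq_mul, Prod.mk.injEq, map_mul]
  constructor <;> ring

theorem herm_act_act (q x y : ℂ × ℂ) : herm (act q x) (act q y) = herm q q * herm x y := by
  simp only [act, herm, map_sub, map_add, map_mul, Complex.conj_conj]; ring

theorem herm_act {x : ℂ × ℂ} (hx : herm x x = 1) (y : ℂ × ℂ) : herm x (act x y) = y.1 := by
  have := herm_act_act x (1, 0) y
  rw [act_one, hx, one_mul] at this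
  rw [this]; simp [herm]

theorem det2_act {x : ℂ × ℂ} (hx : herm x x = 1) (y : ℂ × ℂ) : det2 x (act x y) = y.2 := by
  have : det2 x (act x y) = herm x x * y.2 := by simp only [det2, act, herm]; ring
  rw [this, hx, one_mul]

theorem act_qconj_eq (x η : ℂ × ℂ) : act (qconj x) η = (herm x η, det2 x η) := by
  simp only [act, qconj, herm, det2, Prod.mk.injEq, map_neg, Complex.conj_conj]
  constructor <;> ring

theorem act_herm_det2 {x : ℂ × ℂ} (hx : herm x x = 1) (η : ℂ × ℂ) :
    act x (herm x η, det2 x η) = η := by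
  rw [← act_qconj_eq, ← act_assoc, act_qconj hx, one_act]

theorem eq_smul_of_det2_eq_zero {x η : ℂ × ℂ} (hx : herm x x = 1) (h0 : det2 x η = 0) :
    η = herm x η • x := by
  conv_lhs => rw [← act_herm_det2 hx η, h0]
  refine Prod.ext ?_ ?_ <;> simp [act, mul_comm]

theorem herm_self_smul (c : ℂ) (x : ℂ × ℂ) : herm (c • x) (c • x) = conj c * c * herm x x := by
  simp only [herm, Prod.smul_fst, Prod.smul_snd, smul_eq_mul, map_mul]; ring

theorem defect_act {x : ℂ × ℂ} (hx : herm x x = 1) (k : ℝ) (y : ℂ × ℂ) :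
    defect k x (act x y) = (y.1 * conj y.2).im - k * Complex.normSq y.2 := by
  rw [defect, herm_act hx, det2_act hx]

namespace SpinorShell

variable {ξ : ℝ → ℂ × ℂ} {V κ : ℝ → ℝ} {a b : ℝ} {ζ : ℂ}

/-- Spinors on the right of a point of a positive shell and close to it are in the right region. -/
theorem eventually_push (h : SpinorShell ξ V κ a b ζ) {x : ℝ} (hx : x ∈ Set.Icc a b) {d : ℂ}
    (hd : d.im < 0) :
    ∀ᶠ ε : ℝ in nhdsWithin 0 (Set.Ioi 0), act (ξ x) (1, ε * conj d) ∈ h.right := by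
  obtain ⟨k, hk⟩ := h.exists_defect_neg_mem_right hx
  have h1 : ∀ᶠ ε : ℝ in nhds 0, d.im - k * ε * Complex.normSq d < 0 :=
    ContinuousAt.eventually_lt (by fun_prop) (by fun_prop) (by simpa using hd)
  filter_upwards [nhdsWithin_le_nhds h1, self_mem_nhdsWithin] with ε hε hpos
  refine hk _ ?_
  rw [defect_act (h.curve.unit x)]
  have : (1 * conj ((ε : ℂ) * conj d)).im - k * Complex.normSq ((ε : ℂ) * conj d) =
      ε * (d.im - k * ε * Complex.normSq d) := by
    simp [Complex.normSq_apply]; ring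
  rw [this]
  exact mul_neg_of_pos_of_neg hpos hε

theorem tendsto_push (x : ℂ × ℂ) (d : ℂ) :
    Filter.Tendsto (fun ε : ℝ => act x (1, ε * conj d)) (nhdsWithin 0 (Set.Ioi 0)) (nhds x) := by
  have : Continuous fun ε : ℝ => act x (1, (ε : ℂ) * conj d) := by fun_prop
  have h2 := this.tendsto 0
  simp only [Complex.ofReal_zero, zero_mul, act_one] at h2
  exact h2.mono_left nhdsWithin_le_nhds

variable {ξ' : ℝ → ℂ × ℂ} {V' κ' : ℝ → ℝ} {a' b' : ℝ} {ζ' : ℂ}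

/-- The quaternions moving the second right region off the first one. -/
def separating (h : SpinorShell ξ V κ a b ζ) (h' : SpinorShell ξ' V' κ' a' b' ζ') :
    Set (ℂ × ℂ) := {q | ∀ η ∈ h'.right, act q η ∉ h.right}

theorem isClosed_separating (h : SpinorShell ξ V κ a b ζ)
    (h' : SpinorShell ξ' V' κ' a' b' ζ') : IsClosed (h.separating h') := by
  rw [← isOpen_compl_iff, isOpen_iff_mem_nhds]
  intro q hq
  simp only [separating, Set.mem_compl_iff, Set.mem_ofPred_eq, not_forall, not_not] at hq
  obtain ⟨η, hη, hη'⟩ := hq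
  have hc : Continuous fun q => act q η := by fun_prop
  have := hc.continuousAt.eventually (h.eventually_mem_right_iff fun s hs =>
    h.ne_zero_of_mem_right hη' hs)
  filter_upwards [this] with p hp hsep
  exact hsep η hη (hp.2.2 hη')

theorem neg_mem_right (h : SpinorShell ξ V κ a b ζ) {η : ℂ × ℂ} :
    -η ∈ h.right ↔ η ∈ h.right := by
  rw [← neg_one_smul ℂ η]; exact h.smul_mem_right (by norm_num)

theorem neg_mem_separating (h : SpinorShell ξ V κ a b ζ)
    (h' : SpinorShell ξ' V' κ' a' b' ζ') {q : ℂ × ℂ} :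
    -q ∈ h.separating h' ↔ q ∈ h.separating h' := by
  simp only [separating, Set.mem_ofPred_eq, neg_act, neg_mem_right]

/-- If the regions are separated and the boundary curves touch, then they do so with opposite
orientations. -/
theorem contact_phase (h : SpinorShell ξ V κ a b ζ) (h' : SpinorShell ξ' V' κ' a' b' ζ')
    {q : ℂ × ℂ} (hT : q ∈ h.separating h') {x x' : ℝ} (hx : x ∈ Set.Icc a b)
    (hx' : x' ∈ Set.Icc a' b') {u : ℂ} (hu : conj u * u = 1) (he : act q (ξ' x') = u • ξ x) :
    u ^ 2 = -1 := by
  by_contra hne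
  have hns : Complex.normSq u = 1 := by
    rw [mul_comm, Complex.mul_conj] at hu; exact_mod_cast hu
  have hre : 0 < 1 + (u ^ 2).re := by
    have h1 : Complex.normSq (u ^ 2) = 1 := by rw [map_pow, hns, one_pow]
    rw [Complex.normSq_apply] at h1
    by_contra! hc
    have h2 : (u ^ 2).re = -1 := by nlinarith [mul_self_nonneg (u ^ 2).im]
    have h3 : (u ^ 2).im = 0 := by
      rw [h2] at h1; nlinarith [mul_self_nonneg (u ^ 2).im]
    exact hne (Complex.ext (by simp [h2]) (by simp [h3]))
  have e1 := h'.eventually_push hx' (d := -Complex.I * (1 + conj (u ^ 2))) (by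
    simp only [Complex.mul_im, Complex.neg_re, Complex.neg_im, Complex.I_re, Complex.I_im,
      Complex.add_re, Complex.add_im, Complex.one_re, Complex.one_im, Complex.conj_re]
    linarith)
  have e2 := h.eventually_push hx (d := -Complex.I * (1 + u ^ 2)) (by
    simp only [Complex.mul_im, Complex.neg_re, Complex.neg_im, Complex.I_re, Complex.I_im,
      Complex.add_re, Complex.add_im, Complex.one_re, Complex.one_im]
    linarith)
  obtain ⟨ε, hε1, hε2⟩ := (e1.and e2).exists
  refine hT _ hε1 ?_
  have hu0 : u ≠ 0 := fun h0 => by simp [h0] at hu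
  rw [← act_assoc, he, smul_act]
  have : ((u * 1, conj u * (ε * conj (-Complex.I * (1 + conj (u ^ 2))))) : ℂ × ℂ) =
      u • ((1, (ε : ℂ) * conj (-Complex.I * (1 + u ^ 2))) : ℂ × ℂ) := by
    refine Prod.ext rfl ?_
    simp only [Prod.smul_snd, smul_eq_mul, map_mul, map_neg, Complex.conj_I, map_add, map_one,
      Complex.conj_conj, map_pow]
    linear_combination (ε * Complex.I * (u - conj u) ) * hu
  rw [this, act_smul, h.smul_mem_right hu0]
  exact hε2

/-- On the frontier of the separating quaternions, the two curves touch with opposite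
orientations. -/
theorem exists_contact (h : SpinorShell ξ V κ a b ζ) (h' : SpinorShell ξ' V' κ' a' b' ζ')
    {q : ℂ × ℂ} (hq : herm q q = 1) (hT : q ∈ frontier (h.separating h')) :
    ∃ x ∈ Set.Icc a b, ∃ x' ∈ Set.Icc a' b',
      act q (ξ' x') = Complex.I • ξ x ∨ act q (ξ' x') = -(Complex.I • ξ x) := by
  by_contra! hc
  rw [(h.isClosed_separating h').frontier_eq, Set.mem_sdiff, mem_interior_iff_mem_nhds] at hT
  obtain ⟨hT, hnhds⟩ := hT
  refine hnhds ?_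
  have hloc : ∀ η ∈ Metric.sphere (0 : ℂ × ℂ) 1, ∀ᶠ p : (ℂ × ℂ) × (ℂ × ℂ) in nhds (q, η),
      p.2 ∈ h'.right → act p.1 p.2 ∉ h.right := fun η hη => by
    have hη0 : η ≠ 0 := fun h0 => by simp [h0] at hη
    have hact : Filter.Tendsto (fun p : (ℂ × ℂ) × (ℂ × ℂ) => act p.1 p.2) (nhds (q, η))
        (nhds (act q η)) := by
      have : Continuous fun p : (ℂ × ℂ) × (ℂ × ℂ) => act p.1 p.2 := by fun_prop
      exact this.tendsto (q, η)
    have hsnd : Filter.Tendsto Prod.snd (nhds (q, η)) (nhds η) := continuous_snd.tendsto _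
    by_cases c1 : ∀ s ∈ Set.Icc a b, det2 (ξ s) (act q η) ≠ 0
    · have ev1 := hact.eventually (h.eventually_mem_right_iff c1)
      suffices hnot : (∀ s ∈ Set.Icc a' b', det2 (ξ' s) η ≠ 0) ∨ act q η ∉ h.right by
        by_cases hR : act q η ∈ h.right
        · have c2 := hnot.resolve_right (not_not.2 hR)
          have hR2 : η ∉ h'.right := fun hmem => hT η hmem hR
          filter_upwards [hsnd.eventually (h'.eventually_mem_right_iff c2)] with p hp hmem
          exact absurd (hp.2.1 hmem) hR2
        · filter_upwards [ev1] with p hp _ hmem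
          exact hR (hp.2.1 hmem)
      by_contra! hcon
      obtain ⟨⟨x', hx', h0⟩, hR⟩ := hcon
      have hη2 := eq_smul_of_det2_eq_zero (h'.curve.unit x') h0
      have hne : herm (ξ' x') η ≠ 0 := fun h0 => hη0 (by rw [hη2, h0, zero_smul])
      rw [hη2, act_smul, h.smul_mem_right hne] at hR
      have hcont : Continuous fun η => act q η := by fun_prop
      have ev2 := (hcont.tendsto (ξ' x')).eventually
        (h.eventually_mem_right_iff fun s hs => h.ne_zero_of_mem_right hR hs)
      obtain ⟨ε, hε1, hε2⟩ := ((h'.eventually_push hx' (d := -Complex.I) (by simp)).and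
        ((tendsto_push (ξ' x') (-Complex.I)).eventually ev2)).exists
      exact hT _ hε1 (hε2.2.2 hR)
    · push Not at c1
      obtain ⟨x, hx, h0⟩ := c1
      have hη1 := eq_smul_of_det2_eq_zero (h.curve.unit x) h0
      have hback : act (qconj q) (act q η) = η := by rw [← act_assoc, qconj_act hq, one_act]
      have hne : herm (ξ x) (act q η) ≠ 0 := fun h0 => hη0 (by
        rw [← hback, hη1, h0, zero_smul]; simp [act])
      have c2 : ∀ s ∈ Set.Icc a' b', det2 (ξ' s) η ≠ 0 := fun x' hx' h0' => by
        have hη2 := eq_smul_of_det2_eq_zero (h'.curve.unit x') h0'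
        set c := herm (ξ' x') η
        set d := herm (ξ x) (act q η)
        have hc0 : c ≠ 0 := fun h0 => hη0 (by rw [hη2, h0, zero_smul])
        have he : act q (ξ' x') = (c⁻¹ * d) • ξ x := by
          rw [mul_smul, ← hη1]
          conv_rhs => rw [hη2]
          rw [act_smul, smul_smul, inv_mul_cancel₀ hc0, one_smul]
        have hu : conj (c⁻¹ * d) * (c⁻¹ * d) = 1 := by
          have h1 := herm_self_smul (c⁻¹ * d) (ξ x)
          rw [← he, herm_act_act, hq, h'.curve.unit, h.curve.unit] at h1
          simpa using h1.symm
        have hsq := h.contact_phase h' hT hx hx' hu he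
        have := hc x hx x' hx'
        have hfac : (c⁻¹ * d - Complex.I) * (c⁻¹ * d + Complex.I) = 0 := by
          linear_combination hsq - Complex.I_sq
        rcases mul_eq_zero.1 hfac with h1 | h1
        · exact this.1 (by rw [he, sub_eq_zero.1 h1])
        · exact this.2 (by rw [he, eq_neg_of_add_eq_zero_left h1, neg_smul])
      have hR2 : η ∉ h'.right := fun hmem => by
        have hcont : Continuous fun η => act (qconj q) η := by fun_prop
        have hpt : act (qconj q) (ξ x) ∈ h'.right := by
          rw [← h'.smul_mem_right hne, ← act_smul, ← hη1, hback]
          exact hmem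
        have ev2 := (hcont.tendsto (ξ x)).eventually
          (h'.eventually_mem_right_iff fun s hs => h'.ne_zero_of_mem_right hpt hs)
        obtain ⟨ε, hε1, hε2⟩ := ((h.eventually_push hx (d := -Complex.I) (by simp)).and
          ((tendsto_push (ξ x) (-Complex.I)).eventually ev2)).exists
        refine hT _ (hε2.2.2 hpt) ?_
        rwa [← act_assoc, act_qconj hq, one_act]
      filter_upwards [hsnd.eventually (h'.eventually_mem_right_iff c2)] with p hp hmem
      exact absurd (hp.2.1 hmem) hR2
  have hev := (isCompact_sphere (0 : ℂ × ℂ) 1).eventually_forall_of_forall_eventually (x₀ := q)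
    (P := fun p η => η ∈ h'.right → act p η ∉ h.right) hloc
  filter_upwards [hev] with p hp η hη hmem
  have hη0 : η ≠ 0 := fun h0 => by
    refine h'.ne_zero_of_mem_right hη (Set.left_mem_Icc.2 h'.lt.le) ?_
    simp [h0, det2]
  have hn : ((‖η‖⁻¹ : ℝ) : ℂ) ≠ 0 := by exact_mod_cast inv_ne_zero (norm_ne_zero_iff.2 hη0)
  refine hp (((‖η‖⁻¹ : ℝ) : ℂ) • η) ?_ ((h'.smul_mem_right hn).2 hη) ?_
  · rw [mem_sphere_zero_iff_norm, norm_smul, Complex.norm_real, norm_inv, norm_norm,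
      inv_mul_cancel₀ (norm_ne_zero_iff.2 hη0)]
  · rw [act_smul]; exact (h.smul_mem_right hn).2 hmem

end SpinorShell

theorem herm_qconj (x : ℂ × ℂ) : herm (qconj x) (qconj x) = herm x x := by
  simp only [qconj, herm, map_neg, Complex.conj_conj]; ring

/-- Rotations by the angle `t` about axes between the invariant axis of the curves of constant
geodesic curvature `tan ψ` (the elevation `ψ`) and the vertical one. -/
def tilt (ψ t : ℝ) : ℂ × ℂ :=
  (Real.cos t + Complex.I * (Real.sin t * Real.sin ψ : ℝ), (Real.sin t * Real.cos ψ : ℝ))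

theorem herm_tilt (ψ t : ℝ) : herm (tilt ψ t) (tilt ψ t) = 1 := by
  have h1 := Real.sin_sq_add_cos_sq t
  have h2 := Real.sin_sq_add_cos_sq ψ
  simp only [tilt, herm, map_add, map_mul, Complex.conj_ofReal, Complex.conj_I]
  have : ((Real.cos t ^ 2 + (Real.sin t * Real.sin ψ) ^ 2 + (Real.sin t * Real.cos ψ) ^ 2 : ℝ) : ℂ)
      = 1 := by
    rw [mul_pow, mul_pow, add_assoc, ← mul_add, h2]; norm_cast; linarith
  push_cast at this ⊢
  linear_combination this - Complex.sin t ^ 2 * Complex.sin ψ ^ 2 * Complex.I_sq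

theorem tilt_zero (ψ : ℝ) : tilt ψ 0 = (1, 0) := by simp [tilt]

theorem tilt_pi (ψ : ℝ) : tilt ψ Real.pi = -(1, 0) := by simp [tilt]

theorem act_tilt_im {μ ψ : ℝ} (hψ : Real.sin ψ = μ * Real.cos ψ) (t : ℝ) (y : ℂ × ℂ) :
    ((act (tilt ψ t) y).1 * conj (act (tilt ψ t) y).2).im -
      μ * Complex.normSq (act (tilt ψ t) y).2 = (y.1 * conj y.2).im - μ * Complex.normSq y.2 := by
  have h1 := Real.sin_sq_add_cos_sq t
  have h2 := Real.sin_sq_add_cos_sq ψ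
  obtain ⟨⟨a, b⟩, ⟨c, d⟩⟩ := y
  simp only [tilt, act, Complex.normSq_apply, Complex.mul_im, Complex.mul_re, Complex.add_re,
    Complex.add_im, Complex.sub_re, Complex.sub_im, Complex.conj_re, Complex.conj_im,
    Complex.ofReal_re, Complex.ofReal_im, Complex.I_re, Complex.I_im]
  generalize Real.sin t = S, Real.cos t = C, Real.sin ψ = P, Real.cos ψ = R at *
  subst hψ
  linear_combination (b * c - a * d - μ * (c ^ 2 + d ^ 2)) * (h1 + S ^ 2 * h2)

/-- The tilt by a small angle towards the left of a curve. -/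
def nudge (θ : ℝ) : ℂ × ℂ := (Real.cos θ, -Complex.I * Real.sin θ)

theorem herm_nudge (θ : ℝ) : herm (nudge θ) (nudge θ) = 1 := by
  have h1 : ((Real.sin θ ^ 2 + Real.cos θ ^ 2 : ℝ) : ℂ) = 1 := by
    rw [Real.sin_sq_add_cos_sq]; simp
  simp only [nudge, herm, map_mul, map_neg, Complex.conj_ofReal, Complex.conj_I]
  push_cast at h1 ⊢
  linear_combination h1 - Complex.sin θ ^ 2 * Complex.I_sq

theorem nudge_zero : nudge 0 = (1, 0) := by simp [nudge]

/-- A continuous family of closed loops of unit quaternions joining a loop in `T` to a loop off `T`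
meets the frontier of `T` only along `X ∪ -X`; this is impossible when `X` and `-X` are
disjoint. -/
theorem exists_antipodal_of_homotopy {X T : Set (ℂ × ℂ)} (hX : IsCompact X) (hX0 : X.Nonempty)
    (hT : ∀ q, -q ∈ T ↔ q ∈ T) {Q : ℝ × ℝ → ℂ × ℂ} (hQ : Continuous Q)
    (hfr : ∀ p, Q p ∈ frontier T → Q p ∈ X ∨ -Q p ∈ X)
    (hQπ : ∀ s, Q (s, Real.pi) = -Q (s, 0)) (h0 : ∀ t, Q (0, t) ∈ T) (h1 : ∀ t, Q (1, t) ∉ T) :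
    ∃ q ∈ X, -q ∈ X := by
  classical
  by_contra! hc
  have hmem : ∀ q, Metric.infDist q X = 0 ↔ q ∈ X := fun q =>
    (hX.isClosed.mem_iff_infDist_zero hX0).symm
  have hnn : ∀ q, 0 ≤ Metric.infDist q X := fun q => Metric.infDist_nonneg
  have hpos : ∀ q, Metric.infDist q X + Metric.infDist (-q) X ≠ 0 := fun q h0 => by
    have := (add_eq_zero_iff_of_nonneg (hnn _) (hnn _)).1 h0
    exact hc q ((hmem q).1 this.1) ((hmem _).1 this.2)
  set lam : ℂ × ℂ → ℝ := fun q => Metric.infDist q X / (Metric.infDist q X + Metric.infDist (-q) X)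
    with hlam
  have hlamc : Continuous lam := by
    refine Continuous.div ?_ ?_ hpos
    · exact Metric.continuous_infDist_pt X
    · exact (Metric.continuous_infDist_pt X).add
        ((Metric.continuous_infDist_pt X).comp continuous_neg)
  have hlamneg : ∀ q, lam (-q) = 1 - lam q := fun q => by
    simp only [hlam, neg_neg]
    rw [eq_sub_iff_add_eq, add_comm (Metric.infDist (-q) X), ← add_div, add_comm, div_self (hpos q)]
  have hlam0 : ∀ q ∈ X, lam q = 0 := fun q hq => by simp only [hlam, (hmem q).2 hq, zero_div]
  set g : ℝ × ℝ → ℂ := fun p => if Q p ∈ T then Complex.exp (Complex.I * Real.pi * lam (Q p))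
    else Complex.exp (-(Complex.I * Real.pi * lam (Q p))) with hg
  have hgc : Continuous g := by
    refine Continuous.if (fun p hp => ?_) (by fun_prop) (by fun_prop)
    have hp' : Q p ∈ frontier T := hQ.frontier_preimage_subset T hp
    rcases hfr p hp' with h | h
    · simp [hlam0 _ h]
    · have : lam (Q p) = 1 := by
        have := hlamneg (Q p); rw [hlam0 _ h] at this; linarith
      rw [this, Complex.ofReal_one, mul_one, mul_comm, Complex.exp_pi_mul_I, Complex.exp_neg,
        Complex.exp_pi_mul_I]
      norm_num
  have hg0 : ∀ p, g p ≠ 0 := fun p => by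
    simp only [hg]; split_ifs <;> exact Complex.exp_ne_zero _
  obtain ⟨L, hL, he⟩ := exists_continuous_log hgc hg0
  have hgg : ∀ s, g (s, 0) * g (s, Real.pi) = -1 := fun s => by
    simp only [hg, hQπ, hT, hlamneg]
    split_ifs
    · rw [← Complex.exp_add, ← Complex.exp_pi_mul_I]; push_cast; ring_nf
    · rw [← Complex.exp_add, ← inv_neg_one, ← Complex.exp_pi_mul_I, ← Complex.exp_neg]
      push_cast; ring_nf
  have hsum := eq_of_exp_eq (f := fun s : ℝ => L (s, 0) + L (s, Real.pi)) (c := -1)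
    (S := Set.univ) isPreconnected_univ (by fun_prop)
    (fun s _ => by rw [Complex.exp_add, he, he, hgg]) (Set.mem_univ 0) (Set.mem_univ 1)
  have hk0 := eq_of_exp_eq (f := fun t : ℝ => L (0, t) - Complex.I * Real.pi * lam (Q (0, t)))
    (c := 1) (S := Set.univ) isPreconnected_univ (by fun_prop)
    (fun t _ => by
      rw [Complex.exp_sub, he]; simp only [hg, h0, if_true]; exact div_self (Complex.exp_ne_zero _))
    (Set.mem_univ 0) (Set.mem_univ Real.pi)
  have hk1 := eq_of_exp_eq (f := fun t : ℝ => L (1, t) + Complex.I * Real.pi * lam (Q (1, t)))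
    (c := 1) (S := Set.univ) isPreconnected_univ (by fun_prop)
    (fun t _ => by
      rw [Complex.exp_add, he]; simp only [hg, h1, if_false]
      rw [← Complex.exp_add, neg_add_cancel, Complex.exp_zero])
    (Set.mem_univ 0) (Set.mem_univ Real.pi)
  have e0 : Complex.exp (L (0, 0) - Complex.I * Real.pi * lam (Q (0, 0))) = 1 := by
    rw [Complex.exp_sub, he]; simp only [hg, h0, if_true]; exact div_self (Complex.exp_ne_zero _)
  have e1 : Complex.exp (L (1, 0) + Complex.I * Real.pi * lam (Q (1, 0))) = 1 := by
    rw [Complex.exp_add, he]; simp only [hg, h1, if_false]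
    rw [← Complex.exp_add, neg_add_cancel, Complex.exp_zero]
  simp only [hQπ, hlamneg] at hk0 hk1 hsum
  push_cast at hk0 hk1
  have key : L (0, 0) - Complex.I * Real.pi * lam (Q (0, 0)) + Real.pi * Complex.I =
      L (1, 0) + Complex.I * Real.pi * lam (Q (1, 0)) := by
    linear_combination (1/2) * hsum + (1/2) * hk0 - (1/2) * hk1
  have := congrArg Complex.exp key
  rw [Complex.exp_add, e0, e1, Complex.exp_pi_mul_I] at this
  norm_num at this

namespace SpinorShell

variable {ξ : ℝ → ℂ × ℂ} {V κ : ℝ → ℝ} {a b : ℝ} {ζ : ℂ}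

/-- Near a point of maximal height the right region of a shell lies under a circle. -/
theorem exists_defect_neg_of_mem_right (h : SpinorShell ξ V κ a b ζ) {μ : ℝ}
    (hκ : ∀ s ∈ Set.Icc a b, κ s < μ) :
    ∃ x ∈ Set.Icc a b, ∀ η ∈ h.right, defect μ (ξ x) η < 0 := by
  have hne : (Set.Icc a b).Nonempty := Set.nonempty_Icc.2 h.lt.le
  obtain ⟨x0, hx0, hmax⟩ := isCompact_Icc.exists_isMaxOn hne h.curve.κ_cont.continuousOn
  have hκ' : ∀ s ∈ Set.Icc a b, κ s < (κ x0 + μ) / 2 := fun s hs => by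
    have h1 := hκ x0 hx0
    have h2 : κ s ≤ κ x0 := hmax hs
    linarith
  obtain ⟨x, hx, hle⟩ := h.exists_chi_le hκ'
  refine ⟨x, Set.Ioo_subset_Icc_self hx, fun η hη => ?_⟩
  have hd := h.ne_zero_of_mem_right hη (Set.Ioo_subset_Icc_self hx)
  rw [defect_neg_iff hd]
  by_contra! hc
  refine h.not_mem_right_of_lt_chi hx hd (fun s hs hsx => ?_) hη
  have := hκ x0 hx0
  linarith [hle s hs hsx]

theorem exists_antipodal (h : SpinorShell ξ V κ a b ζ) {ξ' : ℝ → ℂ × ℂ} {V' κ' : ℝ → ℝ}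
    {a' b' : ℝ} {ζ' : ℂ}
    (h' : SpinorShell ξ' V' κ' a' b' ζ') {μ : ℝ} (hκ : ∀ s ∈ Set.Icc a b, κ s < -μ)
    (hκ' : ∀ s ∈ Set.Icc a' b', κ' s < μ) :
    ∃ s t s' t',
      act (Complex.I • ξ s) (qconj (ξ' s')) = -act (Complex.I • ξ t) (qconj (ξ' t')) := by
  have hξ := h.curve.cont
  have hξ' := h'.curve.cont
  set X : Set (ℂ × ℂ) := (fun p : ℝ × ℝ => act (Complex.I • ξ p.1) (qconj (ξ' p.2))) ''
    (Set.Icc a b ×ˢ Set.Icc a' b') with hX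
  have hqc : Continuous qconj := by unfold qconj; fun_prop
  have hXc : IsCompact X := by
    refine (isCompact_Icc.prod isCompact_Icc).image ?_
    fun_prop
  have hX0 : X.Nonempty := ((Set.nonempty_Icc.2 h.lt.le).prod (Set.nonempty_Icc.2 h'.lt.le)).image _
  suffices hs : ∃ q ∈ X, -q ∈ X by
    obtain ⟨q, ⟨⟨t, t'⟩, -, rfl⟩, ⟨⟨s, s'⟩, -, hs⟩⟩ := hs
    exact ⟨s, t, s', t', hs⟩
  obtain ⟨x, hx, hR⟩ := h.exists_defect_neg_of_mem_right hκ
  obtain ⟨x', hx', hR'⟩ := h'.exists_defect_neg_of_mem_right hκ'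
  obtain ⟨k, hk⟩ := h.exists_defect_neg_mem_right hx
  obtain ⟨k', hk'⟩ := h'.exists_defect_neg_mem_right hx'
  obtain ⟨ε, ⟨hε1, hε2⟩, hε3⟩ : ∃ ε : ℝ, (0 < Real.cos ε + k * Real.sin ε ∧
      0 < Real.cos ε + k' * Real.sin ε) ∧ 0 < Real.sin ε := by
    have e1 : ∀ᶠ ε : ℝ in nhds 0, 0 < Real.cos ε + k * Real.sin ε :=
      ContinuousAt.eventually_lt (by fun_prop) (by fun_prop) (by simp)
    have e2 : ∀ᶠ ε : ℝ in nhds 0, 0 < Real.cos ε + k' * Real.sin ε :=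
      ContinuousAt.eventually_lt (by fun_prop) (by fun_prop) (by simp)
    have e3 : ∀ᶠ ε : ℝ in nhdsWithin 0 (Set.Ioi 0), 0 < Real.sin ε := by
      filter_upwards [Ioo_mem_nhdsGT Real.pi_pos] with ε hε
      exact Real.sin_pos_of_pos_of_lt_pi hε.1 hε.2
    have e12 := e1.and e2
    exact ((e12.filter_mono nhdsWithin_le_nhds).and e3).exists
  set ψ : ℝ → ℝ := fun s => Real.arctan μ + s * (Real.pi / 2 - Real.arctan μ) with hψ
  have hψ0 : Real.sin (ψ 0) = μ * Real.cos (ψ 0) := by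
    have := Real.tan_arctan μ
    rw [Real.tan_eq_sin_div_cos, div_eq_iff (Real.cos_arctan_pos μ).ne'] at this
    simpa [hψ] using this
  set Q : ℝ × ℝ → ℂ × ℂ := fun p => act (act (Complex.I • ξ x) (nudge (p.1 * ε)))
    (act (tilt (ψ p.1) p.2) (act (nudge (p.1 * ε)) (qconj (ξ' x')))) with hQ
  have hI : herm (Complex.I • ξ x) (Complex.I • ξ x) = 1 := by
    rw [herm_self_smul, h.curve.unit]; simp
  have hQu : ∀ p, herm (Q p) (Q p) = 1 := fun p => by
    simp only [hQ, herm_act_act, herm_nudge, herm_tilt, herm_qconj, h'.curve.unit, hI, mul_one]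
  refine exists_antipodal_of_homotopy hXc hX0
    (fun q => h.neg_mem_separating h') (Q := Q) ?_ ?_ ?_ ?_ ?_
  · simp only [hQ, hψ]; unfold nudge tilt; fun_prop
  · intro p hp
    obtain ⟨y, hy, y', hy', hc⟩ := h.exists_contact h' (hQu p) hp
    have hback : Q p = act (act (Q p) (ξ' y')) (qconj (ξ' y')) := by
      rw [act_assoc, act_qconj (h'.curve.unit _), act_one]
    refine hc.imp (fun hc => ⟨(y, y'), ⟨hy, hy'⟩, ?_⟩) fun hc => ⟨(y, y'), ⟨hy, hy'⟩, ?_⟩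
    · rw [hback, hc]
    · rw [hback, hc, neg_act, neg_neg]
  · intro s
    simp only [hQ, tilt_zero, tilt_pi, neg_act, act_neg]
  · intro t η hη hη'
    have hd1 := hR _ hη'
    have hd2 := hR' _ hη
    have e1 : act (Q (0, t)) η =
        act (ξ x) (Complex.I * (act (tilt (ψ 0) t) (herm (ξ' x') η, det2 (ξ' x') η)).1,
          conj Complex.I * (act (tilt (ψ 0) t) (herm (ξ' x') η, det2 (ξ' x') η)).2) := by
      simp only [hQ, zero_mul, nudge_zero, act_one, one_act]
      rw [act_assoc, act_assoc, act_qconj_eq, smul_act]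
    rw [e1, defect_act (h.curve.unit x)] at hd1
    have := act_tilt_im hψ0 t (herm (ξ' x') η, det2 (ξ' x') η)
    rw [defect] at hd2
    revert hd1 this
    generalize act (tilt (ψ 0) t) (herm (ξ' x') η, det2 (ξ' x') η) = z
    intro hd1 this
    have e2 : (Complex.I * z.1 * conj (conj Complex.I * z.2)).im = - (z.1 * conj z.2).im := by
      simp
    have e3 : Complex.normSq (conj Complex.I * z.2) = Complex.normSq z.2 := by simp
    simp only [e2, e3] at hd1
    simp only at this
    linarith
  · intro t hsep
    refine hsep (act (ξ' x') (qconj (nudge ε))) (hk' _ ?_) (hk _ ?_)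
    · rw [defect_act (h'.curve.unit _)]
      simp only [qconj, nudge, map_mul, map_neg, Complex.conj_ofReal, Complex.conj_I,
        Complex.normSq_apply, Complex.mul_im, Complex.mul_re, Complex.neg_re, Complex.neg_im,
        Complex.ofReal_re, Complex.ofReal_im, Complex.I_re, Complex.I_im]
      nlinarith [mul_pos hε2 hε3]
    · have e1 : act (Q (1, t)) (act (ξ' x') (qconj (nudge ε))) =
          act (ξ x) (Complex.I * (act (nudge ε) (tilt (ψ 1) t)).1,
            conj Complex.I * (act (nudge ε) (tilt (ψ 1) t)).2) := by
        simp only [hQ, one_mul]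
        rw [act_assoc, act_assoc, act_assoc, act_assoc, ← act_assoc (qconj (ξ' x')),
          qconj_act (h'.curve.unit _), one_act, act_qconj (herm_nudge _), act_one, smul_act]
      have e2 : tilt (ψ 1) t = (Real.cos t + Complex.I * Real.sin t, 0) := by
        simp [tilt, hψ]
      rw [e1, e2, defect_act (h.curve.unit _)]
      have := Real.sin_sq_add_cos_sq t
      simp only [act, nudge, map_mul, map_neg, map_add, Complex.conj_ofReal,
        Complex.conj_I, mul_zero, sub_zero, add_zero,
        Complex.normSq_apply, Complex.mul_im, Complex.mul_re, Complex.neg_re, Complex.neg_im,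
        Complex.add_re, Complex.add_im,
        Complex.ofReal_re, Complex.ofReal_im, Complex.I_re, Complex.I_im]
      generalize Real.sin t = S, Real.cos t = C at *
      have e3 := mul_pos hε1 hε3
      generalize Real.sin ε = P, Real.cos ε = R at *
      refine lt_of_eq_of_lt (b := -((R + k * P) * P)) ?_ (by linarith)
      linear_combination (- (R + k * P) * P) * this

end SpinorShell

/-- The function `F` has a continuous logarithm on `[0, l]` with equal values at the endpoints. -/
def HasClosedLog (F : ℝ → ℂ) (l : ℝ) : Prop :=
  ∃ L : ℝ → ℂ, ContinuousOn L (Set.Icc 0 l) ∧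
    (∀ s ∈ Set.Icc 0 l, Complex.exp (L s) = F s) ∧ L 0 = L l

theorem HasClosedLog.div {F G : ℝ → ℂ} {l : ℝ} (hF : HasClosedLog F l) (hG : HasClosedLog G l) :
    HasClosedLog (fun s => F s / G s) l := by
  obtain ⟨L, h1, h2, h3⟩ := hF
  obtain ⟨M, k1, k2, k3⟩ := hG
  refine ⟨fun s => L s - M s, h1.sub k1, fun s hs => ?_, by simp only [h3, k3]⟩
  rw [Complex.exp_sub, h2 s hs, k2 s hs]

theorem HasClosedLog.congr {F G : ℝ → ℂ} {l : ℝ} (hF : HasClosedLog F l)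
    (h : ∀ s ∈ Set.Icc 0 l, F s = G s) : HasClosedLog G l := by
  obtain ⟨L, h1, h2, h3⟩ := hF
  exact ⟨L, h1, fun s hs => by rw [h2 s hs, h s hs], h3⟩

/-- The triangle of pairs of parameters `0 ≤ s ≤ u ≤ l`. -/
def triangle (l : ℝ) : Set (ℝ × ℝ) := {x | 0 ≤ x.1 ∧ x.1 ≤ x.2 ∧ x.2 ≤ l}

theorem eq_one_of_ne_zero {l : ℝ} (hl : 0 ≤ l) {W : ℝ × ℝ → ℂ} {τ : ℂ}
    (hW : ContinuousOn W (triangle l)) (h0 : ∀ x ∈ triangle l, W x ≠ 0)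
    (hτ : ∀ u, 0 ≤ u → u ≤ l → W (u, l) = τ * W (0, u))
    (hd : HasClosedLog (fun s => W (s, s)) l) : τ = 1 := by
  obtain ⟨L, hL, he⟩ := exists_continuous_log_triangle hl hW
    fun s u h1 h2 h3 => h0 (s, u) ⟨h1, h2, h3⟩
  obtain ⟨M, hM, hMe, hMc⟩ := hd
  have hl0 : (0 : ℝ) ∈ Set.Icc 0 l := ⟨le_rfl, hl⟩
  have hll : l ∈ Set.Icc 0 l := ⟨hl, le_rfl⟩
  have e1 := eq_of_exp_eq (f := fun u : ℝ => L (u, l) - L (0, u)) (c := τ) isPreconnected_Icc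
    (by fun_prop) (fun u hu => by
      rw [Complex.exp_sub, he _ _ hu.1 hu.2 le_rfl, he _ _ le_rfl hu.1 hu.2, hτ u hu.1 hu.2]
      exact mul_div_cancel_right₀ _ (h0 _ ⟨le_rfl, hu.1, hu.2⟩)) hl0 hll
  have e2 := eq_of_exp_eq (f := fun u : ℝ => L (u, u) - M u) (c := 1) isPreconnected_Icc
    (ContinuousOn.sub (by fun_prop) hM) (fun u hu => by
      rw [Complex.exp_sub, he _ _ hu.1 le_rfl hu.2, hMe u hu]
      exact div_self (h0 _ ⟨hu.1, le_rfl, hu.2⟩)) hl0 hll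
  have e3 : L (0, l) = L (0, 0) := by
    linear_combination (1/2) * e1 - (1/2) * e2 - (1/2) * hMc
  have h1 := hτ 0 le_rfl hl
  rw [← he 0 l le_rfl hl le_rfl, e3, he 0 0 le_rfl le_rfl hl] at h1
  exact (mul_right_cancel₀ (h0 (0, 0) ⟨le_rfl, le_rfl, hl⟩) (by rw [one_mul]; exact h1)).symm

/-- A model function on the triangle with a single zero of given nondegenerate derivative. -/
theorem exists_model_zero {l : ℝ} {p : ℝ × ℝ} (h1 : 0 < p.1) (h2 : p.1 < p.2) (h3 : p.2 < l)
    {N : ℝ × ℝ →L[ℝ] ℂ} (hN : ∀ x, N x = 0 → x = 0) :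
    ∃ G : ℝ × ℝ → ℂ, Differentiable ℝ G ∧ HasFDerivAt G N p ∧ G p = 0 ∧
      (∀ x ∈ triangle l, G x = 0 → x = p) ∧ (∀ u, G (u, l) = -G (0, u)) ∧
      HasClosedLog (fun s => G (s, s)) l := by
  have hl : 0 < l := by linarith
  set k := Real.pi / l with hk
  have hk0 : 0 < k := div_pos Real.pi_pos hl
  have hkl : k * l = Real.pi := div_mul_cancel₀ _ hl.ne'
  set m0 := k * (p.1 + p.2) with hm0
  set δ0 := Real.cos (k * (p.2 - p.1)) with hδ0
  set S := Real.sin (k * (p.2 - p.1)) with hS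
  have hdpos : 0 < k * (p.2 - p.1) := mul_pos hk0 (by linarith)
  have hdpi : k * (p.2 - p.1) < Real.pi := by
      rw [← hkl]; exact mul_lt_mul_of_pos_left (by linarith) hk0
  have hS0 : 0 < S := Real.sin_pos_of_pos_of_lt_pi hdpos hdpi
  have hδ1 : |δ0| < 1 := by
    rw [← sq_lt_one_iff_abs_lt_one]
    have := Real.sin_sq_add_cos_sq (k * (p.2 - p.1))
    rw [← hS, ← hδ0] at this
    nlinarith
  set α := N (1, 1) / (2 * k) with hα
  set β := N (1, -1) / (2 * k * S) with hβ
  have hlin : ∀ x y : ℝ, (x : ℂ) * α + y * β = 0 → x = 0 ∧ y = 0 := fun x y h => by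
    have e1 : N ((x / (2 * k)) • (1, 1) + (y / (2 * k * S)) • (1, -1)) = 0 := by
      rw [map_add, map_smul, map_smul, ← h, hα, hβ, Complex.real_smul, Complex.real_smul]
      push_cast; ring
    have e2 := hN _ e1
    have e3 := congrArg Prod.fst e2
    have e4 := congrArg Prod.snd e2
    simp only [Prod.smul_mk, Prod.mk_add_mk, smul_eq_mul, Prod.fst_zero, Prod.snd_zero] at e3 e4
    have hx : x / (2 * k) = 0 := by linarith
    have hy : y / (2 * k * S) = 0 := by linarith
    rw [div_eq_zero_iff] at hx hy
    exact ⟨hx.resolve_right (by positivity), hy.resolve_right (by positivity)⟩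
  have hα0 : α ≠ 0 := fun h0 => by
    have := hlin 1 0 (by simp [h0]); simp at this
  have him : (β / α).im ≠ 0 := fun h0 => by
    have e1 : β = ((β / α).re : ℂ) * α := by
      conv_lhs => rw [← div_mul_cancel₀ β hα0, ← Complex.re_add_im (β / α), h0]
      simp
    have := hlin (-(β / α).re) 1 (by push_cast; rw [one_mul]; linear_combination e1)
    simp at this
  set G : ℝ × ℝ → ℂ := fun x => (Real.sin (k * (x.1 + x.2) - m0) : ℝ) * α +
    (Real.cos (k * (x.2 - x.1)) - δ0 * Real.cos (k * (x.1 + x.2) - m0) : ℝ) * β with hG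
  set A : ℝ × ℝ →L[ℝ] ℝ := k • (.fst ℝ ℝ ℝ + .snd ℝ ℝ ℝ) with hA
  set B : ℝ × ℝ →L[ℝ] ℝ := k • (.snd ℝ ℝ ℝ - .fst ℝ ℝ ℝ) with hB
  have hder : ∀ x : ℝ × ℝ, HasFDerivAt G
      (α • Complex.ofRealCLM.comp (Real.cos (k * (x.1 + x.2) - m0) • A) +
        β • Complex.ofRealCLM.comp (-Real.sin (k * (x.2 - x.1)) • B -
          δ0 • (-Real.sin (k * (x.1 + x.2) - m0) • A))) x := fun x => by
    have dA : HasFDerivAt (fun x : ℝ × ℝ => k * (x.1 + x.2) - m0) A x :=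
      ((hasFDerivAt_fst.add hasFDerivAt_snd).const_mul k).sub_const m0
    have dB : HasFDerivAt (fun x : ℝ × ℝ => k * (x.2 - x.1)) B x :=
      (hasFDerivAt_snd.sub hasFDerivAt_fst).const_mul k
    exact ((Complex.ofRealCLM.hasFDerivAt.comp x dA.sin).mul_const α).add
      ((Complex.ofRealCLM.hasFDerivAt.comp x (dB.cos.sub (dA.cos.const_mul δ0))).mul_const β)
  refine ⟨G, fun x => (hder x).differentiableAt, ?_, ?_, ?_, ?_, ?_⟩
  · refine (hder p).congr_fderiv (ContinuousLinearMap.ext fun x => ?_)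
    have e1 : x = ((x.1 + x.2) / 2) • ((1, 1) : ℝ × ℝ) + ((x.1 - x.2) / 2) • ((1, -1) : ℝ × ℝ) := by
      ext <;> simp <;> ring
    have hk0' : (k : ℂ) ≠ 0 := by exact_mod_cast hk0.ne'
    have hS0' : (S : ℂ) ≠ 0 := by exact_mod_cast hS0.ne'
    conv_rhs => rw [e1, map_add, map_smul, map_smul]
    simp only [hα, hβ, hA, hB, ← hS, ← hm0, sub_self, Real.cos_zero, Real.sin_zero,
      _root_.add_apply, _root_.smul_apply,
      ContinuousLinearMap.comp_apply, _root_.sub_apply, smul_eq_mul,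
      ContinuousLinearMap.coe_fst', ContinuousLinearMap.coe_snd', Complex.ofRealCLM_apply,
      Complex.real_smul]
    push_cast
    field_simp
    ring
  · simp [hG, hm0, hδ0]
  · rintro ⟨s, u⟩ ⟨hs, hsu, hu⟩ h0
    obtain ⟨e1, e2⟩ := hlin _ _ h0
    simp only at e1 e2 hs hsu hu
    have hab : -Real.pi * 2 < k * (s + u) - m0 ∧ k * (s + u) - m0 < Real.pi * 2 := by
      constructor <;> rw [hm0, ← hkl] <;> nlinarith
    have hd0 : 0 ≤ k * (u - s) := mul_nonneg hk0.le (by linarith)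
    have hdp : k * (u - s) ≤ Real.pi := by
        rw [← hkl]; exact mul_le_mul_of_nonneg_left (by linarith) hk0.le
    obtain ⟨n, hn⟩ := Real.sin_eq_zero_iff.1 e1
    have hn1 : -2 < n ∧ n < 2 := by
      rw [← hn] at hab
      constructor
      · have : (-2 : ℝ) < n := by nlinarith [Real.pi_pos]
        exact_mod_cast this
      · have : (n : ℝ) < 2 := by nlinarith [Real.pi_pos]
        exact_mod_cast this
    have hodd : (Real.cos (k * (s + u) - m0) = -1) →
        k * (u - s) = Real.pi - k * (p.2 - p.1) := fun hc => by
      rw [hc] at e2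
      refine Real.injOn_cos ⟨hd0, hdp⟩ ⟨by linarith, by linarith⟩ ?_
      rw [Real.cos_pi_sub]; linarith
    obtain rfl | rfl | rfl : n = -1 ∨ n = 0 ∨ n = 1 := by omega
    · exfalso
      have := hodd (by rw [← hn]; simp)
      have e3 : k * (s + u) - m0 = -Real.pi := by rw [← hn]; simp
      have : k * s = k * (p.2 - l) := by linarith
      have := mul_left_cancel₀ hk0.ne' this
      linarith
    · have e3 : k * (s + u) - m0 = 0 := by rw [← hn]; simp
      have e4 : k * (u - s) = k * (p.2 - p.1) := by
        refine Real.injOn_cos ⟨hd0, hdp⟩ ⟨by linarith, by linarith⟩ ?_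
        rw [e3, Real.cos_zero] at e2; linarith
      have e5 := mul_left_cancel₀ hk0.ne' e4
      have e6 : s + u = p.1 + p.2 := mul_left_cancel₀ hk0.ne' (by linarith)
      exact Prod.ext (by simp only; linarith) (by simp only; linarith)
    · exfalso
      have := hodd (by rw [← hn]; simp)
      have e3 : k * (s + u) - m0 = Real.pi := by rw [← hn]; simp
      have : k * u = k * (p.1 + l) := by linarith
      have := mul_left_cancel₀ hk0.ne' this
      linarith
  · intro u
    have e1 : k * (u + l) - m0 = k * (0 + u) - m0 + Real.pi := by rw [← hkl]; ring
    have e2 : k * (l - u) = Real.pi - k * (u - 0) := by rw [← hkl]; ring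
    simp only [hG, e1, e2, Real.sin_add_pi, Real.cos_add_pi, Real.cos_pi_sub]
    push_cast; ring
  · set e : ℂ := Complex.I * α * ((β / α).im : ℂ) with he
    have he0 : e ≠ 0 := mul_ne_zero (mul_ne_zero Complex.I_ne_zero hα0) (by exact_mod_cast him)
    have hre : ∀ s, 0 < (G (s, s) / e).re := fun s => by
      have : G (s, s) / e = -Complex.I * (Real.sin (k * (s + s) - m0) / (β / α).im : ℝ) +
          (1 - δ0 * Real.cos (k * (s + s) - m0) : ℝ) * (-Complex.I * (β / α) / (β / α).im) := by
        have hc : ((β / α).im : ℂ) ≠ 0 := by exact_mod_cast him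
        rw [div_eq_iff he0, he]
        simp only [hG, sub_self, mul_zero, Real.cos_zero]
        push_cast
        generalize ((β / α).im : ℂ) = c at *
        field_simp
        rw [Complex.I_sq]; ring
      have h2 : (-Complex.I * (β / α) / ((β / α).im : ℂ)).re = 1 := by
        rw [Complex.div_ofReal_re]; simp [div_self him]
      rw [this, Complex.add_re, Complex.re_ofReal_mul, h2, Complex.re_mul_ofReal]
      have := abs_lt.1 (lt_of_le_of_lt (abs_mul δ0 (Real.cos (k * (s + s) - m0))).le
        (lt_of_le_of_lt (mul_le_of_le_one_right (abs_nonneg _) (Real.abs_cos_le_one _)) hδ1))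
      simp
      linarith
    have hGc : Continuous G := (Differentiable.continuous fun x => (hder x).differentiableAt)
    refine ⟨fun s => Complex.log (G (s, s) / e) + Complex.log e, ?_, fun s _ => ?_, ?_⟩
    · refine Continuous.continuousOn
        (Continuous.add (Continuous.clog (by fun_prop) fun s => ?_) continuous_const)
      exact Complex.mem_slitPlane_iff.2 (Or.inl (hre s))
    · have hne : G (s, s) / e ≠ 0 := fun h0 => by
        have := hre s; rw [h0] at this; simp at this
      rw [Complex.exp_add, Complex.exp_log hne, Complex.exp_log he0, div_mul_cancel₀ _ he0]
    · have e1 : k * (l + l) - m0 = k * (0 + 0) - m0 + 2 * Real.pi := by rw [← hkl]; ring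
      simp only [hG, e1, Real.sin_add_two_pi, Real.cos_add_two_pi, sub_self]

/-- Two functions vanishing at a point with the same injective derivative are asymptotic there. -/
theorem tendsto_div_of_hasFDerivAt {E : Type*} [NormedAddCommGroup E] [NormedSpace ℝ E]
    [FiniteDimensional ℝ E] {W G : E → ℂ} {N : E →L[ℝ] ℂ} {p : E} (hW : HasFDerivAt W N p)
    (hG : HasFDerivAt G N p) (hW0 : W p = 0) (hG0 : G p = 0) (hN : ∀ x, N x = 0 → x = 0) :
    Filter.Tendsto (fun x => W x / G x) (nhdsWithin p {p}ᶜ) (nhds 1) := by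
  obtain ⟨K, -, hK⟩ := (N : E →ₗ[ℝ] ℂ).exists_antilipschitzWith
    (LinearMap.ker_eq_bot'.2 fun x hx => hN x hx)
  have hrev : (fun x => x - p) =O[nhds p] fun x => N (x - p) :=
    Asymptotics.IsBigO.of_bound K (Filter.Eventually.of_forall fun x => by
      have := hK.le_mul_dist (x - p) 0
      simpa [dist_eq_norm] using this)
  have hGo : (fun x => G x - N (x - p)) =o[nhds p] fun x => x - p := by
    simpa [hG0] using hG.isLittleO
  have hWo : (fun x => W x - N (x - p)) =o[nhds p] fun x => x - p := by
    simpa [hW0] using hW.isLittleO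
  have hNG : (fun x => N (x - p)) =O[nhds p] G := by
    simpa using (hGo.trans_isBigO hrev).right_isBigO_add
  have hpG := hrev.trans hNG
  have hlim : Filter.Tendsto (fun x => (W x - G x) / G x) (nhds p) (nhds 0) := by
    refine Asymptotics.IsLittleO.tendsto_div_nhds_zero ?_
    simpa using (hWo.sub hGo).trans_isBigO hpG
  have hlim2 := (hlim.mono_left (nhdsWithin_le_nhds (s := {p}ᶜ))).add_const 1
  rw [zero_add] at hlim2
  refine hlim2.congr' ?_
  obtain ⟨C, hC⟩ := hpG.bound
  filter_upwards [nhdsWithin_le_nhds hC, self_mem_nhdsWithin] with x hx hne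
  have hG0 : G x ≠ 0 := fun h0 => by
    rw [h0, norm_zero, mul_zero] at hx
    exact hne (sub_eq_zero.1 (norm_le_zero_iff.1 hx))
  field_simp
  ring

/-- Each nondegenerate zero in the interior of the triangle changes the sign of the gluing
factor. -/
theorem eq_neg_one_pow_card {l : ℝ} (hl : 0 ≤ l) (Z : Finset (ℝ × ℝ)) :
    ∀ {W : ℝ × ℝ → ℂ} {τ : ℂ}, ContinuousOn W (triangle l) →
    (∀ x ∈ triangle l, W x = 0 → x ∈ Z) →
    (∀ p ∈ Z, 0 < p.1 ∧ p.1 < p.2 ∧ p.2 < l) → (∀ p ∈ Z, W p = 0) →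
    (∀ p ∈ Z, ∃ N : ℝ × ℝ →L[ℝ] ℂ, HasFDerivAt W N p ∧ ∀ x, N x = 0 → x = 0) →
    (∀ u, 0 ≤ u → u ≤ l → W (u, l) = τ * W (0, u)) →
    HasClosedLog (fun s => W (s, s)) l → τ * (-1) ^ Z.card = 1 := by
  classical
  induction Z using Finset.induction_on with
  | empty =>
    intro W τ hW h0 _ _ _ hτ hd
    simpa using eq_one_of_ne_zero hl hW (fun x hx h => by simpa using h0 x hx h) hτ hd
  | insert p Z hp ih =>
    intro W τ hW h0 hint hz hder hτ hd
    have hpm := Finset.mem_insert_self p Z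
    obtain ⟨hp1, hp2, hp3⟩ := hint p hpm
    obtain ⟨N, hWN, hN⟩ := hder p hpm
    obtain ⟨G, hGd, hGN, hGp, hG0, hGτ, hGl⟩ := exists_model_zero hp1 hp2 hp3 hN
    have hsub : ∀ q ∈ Z, q ∈ triangle l := fun q hq => by
      have := hint q (Finset.mem_insert_of_mem hq)
      exact ⟨this.1.le, this.2.1.le, this.2.2.le⟩
    have hne : ∀ q ∈ Z, q ≠ p := fun q hq h => hp (h ▸ hq)
    set W' : ℝ × ℝ → ℂ := Function.update (fun x => W x / G x) p 1 with hW'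
    have hoff : ∀ x, x ≠ p → W' x = W x / G x := fun x hx => Function.update_of_ne hx _ _
    have hpe : W' p = 1 := Function.update_self _ _ _
    have := ih (W := W') (τ := -τ) ?_ ?_
      (fun q hq => hint q (Finset.mem_insert_of_mem hq)) ?_ ?_ ?_ ?_
    · rw [Finset.card_insert_of_notMem hp, pow_succ]; linear_combination this
    · intro x hx
      rcases eq_or_ne x p with rfl | hxp
      · exact (continuousAt_update_same.2
          (tendsto_div_of_hasFDerivAt hWN hGN (hz _ hpm) hGp hN)).continuousWithinAt
      · have hGx : G x ≠ 0 := fun h => hxp (hG0 x hx h)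
        refine ((hW x hx).div hGd.continuous.continuousWithinAt hGx).congr_of_eventuallyEq ?_
          (hoff x hxp)
        filter_upwards [nhdsWithin_le_nhds (isOpen_ne.mem_nhds hxp)] with y hy using hoff y hy
    · intro x hx hx0
      rcases eq_or_ne x p with rfl | hxp
      · rw [hpe] at hx0; exact absurd hx0 one_ne_zero
      · rw [hoff x hxp, div_eq_zero_iff] at hx0
        exact (Finset.mem_insert.1 (h0 x hx (hx0.resolve_right
          fun h => hxp (hG0 x hx h)))).resolve_left hxp
    · intro q hq
      rw [hoff q (hne q hq), hz q (Finset.mem_insert_of_mem hq), zero_div]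
    · intro q hq
      obtain ⟨M, hM, hM0⟩ := hder q (Finset.mem_insert_of_mem hq)
      have hGq : G q ≠ 0 := fun h => hne q hq (hG0 q (hsub q hq) h)
      have hd := hM.mul ((hGd q).inv hGq).hasFDerivAt
      refine ⟨(G q)⁻¹ • M, ?_, fun x hx => hM0 x ?_⟩
      · refine (hd.congr_of_eventuallyEq ?_).congr_fderiv ?_
        · filter_upwards [isOpen_ne.mem_nhds (hne q hq)] with y hy
          rw [hoff y hy, div_eq_mul_inv]; rfl
        · rw [hz q (Finset.mem_insert_of_mem hq)]; ext <;> simp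
      · simpa [hGq] using hx
    · intro u hu hul
      rw [hoff _ fun h => by rw [← h] at hp3; exact lt_irrefl _ hp3,
        hoff _ fun h => by rw [← h] at hp1; exact lt_irrefl _ hp1, hτ u hu hul, hGτ u, div_neg,
        mul_div_assoc, neg_mul]
    · refine (hd.div hGl).congr fun s _ => (hoff _ fun h => ?_).symm
      rw [← h] at hp2; exact lt_irrefl _ hp2

theorem eq_zero_of_det2_deriv {ζ : ℂ} {v w : ℝ} {x : ℝ × ℝ} (hζ : (ζ ^ 2).im ≠ 0) (hv : 0 < v)
    (hw : 0 < w) (h : (x.1 : ℂ) * (v * -ζ) + x.2 * (w * conj ζ) = 0) : x = 0 := by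
  have hre := congrArg Complex.re h
  have him := congrArg Complex.im h
  simp [sq] at hre him hζ
  have hre' : (x.2 * w - x.1 * v) * ζ.re = 0 := by linear_combination hre
  have him' : (x.2 * w + x.1 * v) * ζ.im = 0 := by linear_combination -him
  have q1 := (mul_eq_zero.1 hre').resolve_right fun h => hζ (by rw [h]; ring)
  have q2 := (mul_eq_zero.1 him').resolve_right fun h => hζ (by rw [h]; ring)
  refine Prod.ext ?_ ?_
  · exact (mul_eq_zero.1 (by linear_combination (q2 - q1) / 2 : x.1 * v = 0)).resolve_right hv.ne'
  · exact (mul_eq_zero.1 (by linear_combination (q2 + q1) / 2 : x.2 * w = 0)).resolve_right hw.ne'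

namespace SpinorCurve

variable {ξ : ℝ → ℂ × ℂ} {V κ : ℝ → ℝ}

theorem hasFDerivAt_det2_prod (hξ : SpinorCurve ξ V κ) (p : ℝ × ℝ) :
    HasFDerivAt (fun x : ℝ × ℝ => det2 (ξ x.1) (ξ x.2))
      ((ContinuousLinearMap.fst ℝ ℝ ℝ).smulRight
        (V p.1 * (Complex.I * κ p.1 * det2 (ξ p.1) (ξ p.2) - herm (ξ p.1) (ξ p.2))) +
      (ContinuousLinearMap.snd ℝ ℝ ℝ).smulRight
        (V p.2 * (Complex.I * κ p.2 * det2 (ξ p.1) (ξ p.2) + conj (herm (ξ p.1) (ξ p.2))))) p := by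
  have a1 := (hξ.d1 p.1).hasFDerivAt.comp p hasFDerivAt_fst
  have a2 := (hξ.d2 p.1).hasFDerivAt.comp p hasFDerivAt_fst
  have b1 := (hξ.d1 p.2).hasFDerivAt.comp p hasFDerivAt_snd
  have b2 := (hξ.d2 p.2).hasFDerivAt.comp p hasFDerivAt_snd
  refine ((a1.mul b2).sub (a2.mul b1)).congr_fderiv (ContinuousLinearMap.ext fun x => ?_)
  simp [det2, herm]
  ring

/-- The parity of the number of crossings of a closed curve determines the sign of its
holonomy. -/
theorem holonomy_sign (hξ : SpinorCurve ξ V κ) {l : ℝ} (hl : 0 < l) {σ : ℂ} (hσ : σ ^ 2 = 1)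
    (hper : ∀ s, ξ (s + l) = σ • ξ s) {Z : Finset (ℝ × ℝ)}
    (hZ : ∀ p, p ∈ Z ↔ 0 ≤ p.1 ∧ p.1 < p.2 ∧ p.2 ≤ l ∧ p.2 - p.1 < l ∧ det2 (ξ p.1) (ξ p.2) = 0)
    (hint : ∀ p ∈ Z, 0 < p.1 ∧ p.2 < l)
    (htr : ∀ p ∈ Z, (herm (ξ p.1) (ξ p.2) ^ 2).im ≠ 0) : -σ * (-1) ^ Z.card = 1 := by
  have hD := hξ.continuous_divided
  have hσ0 : σ ≠ 0 := fun h => by simp [h] at hσ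
  set W : ℝ × ℝ → ℂ := fun x => hξ.divided x - σ * hξ.divided (x.1, x.2 - l) with hW
  have hWc : Continuous W := by fun_prop
  have hdet : ∀ s u, det2 (ξ s) (ξ u) = σ * det2 (ξ s) (ξ (u - l)) := fun s u => by
    have := hper (u - l)
    rw [sub_add_cancel] at this
    rw [this]; simp [det2]; ring
  have hWd : ∀ s u : ℝ, ((u - s : ℝ) * (l - (u - s) : ℝ) : ℂ) * W (s, u) =
      l * det2 (ξ s) (ξ u) := fun s u => by
    have e1 := hξ.det2_eq_divided s u
    have e2 := hξ.det2_eq_divided s (u - l)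
    have e3 := hdet s u
    simp only [hW]
    push_cast at *
    linear_combination (-(l : ℂ) + (u - s)) * e1 - (u - s : ℂ) * σ * e2 - (u - s : ℂ) * e3
  have hl0 : (l : ℂ) ≠ 0 := by exact_mod_cast hl.ne'
  have hdiag : ∀ s, W (s, s) = V s := fun s => by
    have e1 := hξ.det2_eq_divided s (s - l)
    have e2 := hdet s s
    rw [det2_self, e1] at e2
    have e3 : hξ.divided (s, s - l) = 0 := by
      push_cast at e2
      simpa [hσ0, hl0] using e2
    simp only [hW, e3, mul_zero, sub_zero, hξ.divided_diag]
  have hglue : ∀ u, 0 ≤ u → u ≤ l → W (u, l) = -σ * W (0, u) := by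
    have hIoo : Set.EqOn (fun u : ℝ => W (u, l)) (fun u : ℝ => -σ * W (0, u)) (Set.Ioo 0 l) :=
      fun u hu => by
        have e1 := hWd u l
        have e2 := hWd 0 u
        have e3 := hdet u l
        rw [sub_self, det2_swap (ξ 0) (ξ u)] at e3
        have h1 : (u : ℂ) ≠ 0 := by exact_mod_cast hu.1.ne'
        have h2 : ((l : ℂ) - u) ≠ 0 := by exact_mod_cast (sub_pos.2 hu.2).ne'
        push_cast at e1 e2
        refine mul_left_cancel₀ (mul_ne_zero h1 h2) ?_
        linear_combination e1 + σ * e2 + l * e3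
    intro u h1 h2
    have := hIoo.closure (by fun_prop) (by fun_prop)
    rw [closure_Ioo hl.ne] at this
    exact this ⟨h1, h2⟩
  have hV : ∀ s, (V s : ℂ) ≠ 0 := fun s => by exact_mod_cast (hξ.V_pos s).ne'
  have hcoef : ∀ p ∈ Z, 0 < p.2 - p.1 ∧ 0 < l - (p.2 - p.1) := fun p hp => by
    have := (hZ p).1 hp
    exact ⟨by linarith, by linarith⟩
  have hz : ∀ p ∈ Z, det2 (ξ p.1) (ξ p.2) = 0 := fun p hp => ((hZ p).1 hp).2.2.2.2
  refine eq_neg_one_pow_card hl.le Z (W := W) hWc.continuousOn ?_ ?_ ?_ ?_ hglue ?_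
  · rintro ⟨s, u⟩ ⟨hs, hsu, hu⟩ h0
    simp only at hs hsu hu
    refine (hZ _).2 ⟨hs, lt_of_le_of_ne hsu ?_, hu, ?_, ?_⟩
    · intro (h : s = u)
      subst h
      rw [hdiag] at h0; exact hV _ h0
    · by_contra! hc
      simp only at hc
      obtain rfl : s = 0 := by linarith
      obtain rfl : u = l := by linarith
      have e1 := hglue 0 le_rfl hl.le
      rw [h0, hdiag] at e1
      exact mul_ne_zero (neg_ne_zero.2 hσ0) (hV 0) e1.symm
    · have := hWd s u
      rw [h0, mul_zero] at this
      exact (mul_eq_zero.1 this.symm).resolve_left hl0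
  · intro p hp
    exact ⟨(hint p hp).1, ((hZ p).1 hp).2.1, (hint p hp).2⟩
  · intro p hp
    have e1 := hWd p.1 p.2
    rw [hz p hp, mul_zero] at e1
    obtain ⟨h1, h2⟩ := hcoef p hp
    exact (mul_eq_zero.1 e1).resolve_left
      (mul_ne_zero (by exact_mod_cast h1.ne') (by exact_mod_cast h2.ne'))
  · intro p hp
    obtain ⟨h1, h2⟩ := hcoef p hp
    set c : ℝ × ℝ → ℝ := fun x => l / ((x.2 - x.1) * (l - (x.2 - x.1))) with hc
    have hq : (p.2 - p.1) * (l - (p.2 - p.1)) ≠ 0 := (mul_pos h1 h2).ne'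
    have hcd : DifferentiableAt ℝ c p := by fun_prop (disch := exact hq)
    have hcd' : DifferentiableAt ℝ (fun x => (c x : ℂ)) p :=
      Complex.ofRealCLM.differentiableAt.comp p hcd
    have hcp : 0 < c p := div_pos hl (mul_pos h1 h2)
    have hd := (hξ.hasFDerivAt_det2_prod p).mul hcd'.hasFDerivAt
    refine ⟨_, hd.congr_of_eventuallyEq ?_, fun x hx => ?_⟩
    · have o1 : ∀ᶠ x : ℝ × ℝ in nhds p, 0 < x.2 - x.1 :=
        ContinuousAt.eventually_lt (by fun_prop) (by fun_prop) h1
      have o2 : ∀ᶠ x : ℝ × ℝ in nhds p, 0 < l - (x.2 - x.1) :=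
        ContinuousAt.eventually_lt (by fun_prop) (by fun_prop) h2
      filter_upwards [o1, o2] with x hx1 hx2
      have e1 := hWd x.1 x.2
      have n1 : ((x.2 : ℂ) - x.1) ≠ 0 := by exact_mod_cast hx1.ne'
      have n2 : ((l : ℂ) - (x.2 - x.1)) ≠ 0 := by exact_mod_cast hx2.ne'
      simp only [hc, Pi.mul_apply]
      push_cast at e1 ⊢
      rw [mul_div_assoc', eq_div_iff (mul_ne_zero n1 n2)]
      linear_combination e1
    · have hc0 : (c p : ℂ) ≠ 0 := by exact_mod_cast hcp.ne'
      simp only [hz p hp, zero_mul, mul_zero, zero_sub, zero_add,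
        _root_.smul_apply, smul_eq_mul, _root_.add_apply,
        ContinuousLinearMap.smulRight_apply, ContinuousLinearMap.coe_fst',
        ContinuousLinearMap.coe_snd', Complex.real_smul] at hx
      have hx0 := (mul_eq_zero.1 hx).resolve_left hc0
      exact eq_zero_of_det2_deriv (htr p hp) (hξ.V_pos p.1) (hξ.V_pos p.2) hx0
  · have hVl : V 0 = V l := by
      have e1 := hglue 0 le_rfl hl.le
      have e2 := hglue l hl.le le_rfl
      rw [e1, hdiag, hdiag] at e2
      have : (V 0 : ℂ) = V l := by linear_combination -e2 - V 0 * hσ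
      exact_mod_cast this
    refine ⟨fun s => (Real.log (V s) : ℝ), ?_, fun s _ => ?_, by simp only [hVl]⟩
    · exact (Complex.continuous_ofReal.comp
        (hξ.V_cont.log fun s => (hξ.V_pos s).ne')).continuousOn
    · show Complex.exp ((Real.log (V s) : ℝ) : ℂ) = W (s, s)
      rw [hdiag, ← Complex.ofReal_exp, Real.exp_log (hξ.V_pos s)]

end SpinorCurve

/-- The image of `e₃` under the rotation with spinor `x`. -/
def spinorPoint (x : ℂ × ℂ) : R3 :=
  ![2 * (x.1.re * x.2.re + x.1.im * x.2.im), 2 * (x.1.im * x.2.re - x.1.re * x.2.im),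
    x.1.re ^ 2 + x.1.im ^ 2 - x.2.re ^ 2 - x.2.im ^ 2]

/-- The image of `e₁` under the rotation with spinor `x`. -/
def spinorTangent (x : ℂ × ℂ) : R3 :=
  ![x.1.re ^ 2 - x.1.im ^ 2 - x.2.re ^ 2 + x.2.im ^ 2,
    2 * (x.1.re * x.1.im + x.2.re * x.2.im), 2 * (x.1.im * x.2.im - x.1.re * x.2.re)]

/-- The image of `e₂` under the rotation with spinor `x`. -/
def spinorNormal (x : ℂ × ℂ) : R3 :=
  ![2 * (x.2.re * x.2.im - x.1.re * x.1.im),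
    x.1.re ^ 2 - x.1.im ^ 2 + x.2.re ^ 2 - x.2.im ^ 2, 2 * (x.1.re * x.2.im + x.1.im * x.2.re)]

/-- The first column of a curve of matrices. -/
def firstColumn (c : ℝ → Mat2) (s : ℝ) : ℂ × ℂ := (c s 0 0, c s 1 0)

/-- The matrix in `ℝ·SU(2)` with first column `x`. -/
def spinorMatrix (x : ℂ × ℂ) : Mat2 := !![x.1, -conj x.2; x.2, conj x.1]

theorem herm_self_re (x : ℂ × ℂ) :
    (herm x x).re = x.1.re ^ 2 + x.1.im ^ 2 + x.2.re ^ 2 + x.2.im ^ 2 := by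
  simp [herm]; ring

theorem sq_sum_eq_one {x : ℂ × ℂ} (hx : herm x x = 1) :
    x.1.re ^ 2 + x.1.im ^ 2 + x.2.re ^ 2 + x.2.im ^ 2 = 1 := by
  rw [← herm_self_re, hx, Complex.one_re]

theorem spinorMatrix_mul (x y : ℂ × ℂ) :
    spinorMatrix x * spinorMatrix y = spinorMatrix (act x y) := by
  ext i j
  fin_cases i <;> fin_cases j <;> simp [spinorMatrix, act, Matrix.mul_apply] <;> ring

theorem spinorMatrix_neg (x : ℂ × ℂ) : spinorMatrix (-x) = -spinorMatrix x := by
  ext i j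
  fin_cases i <;> fin_cases j <;> simp [spinorMatrix]

theorem inv_eq_conjTranspose {A : Mat2} (hA : A ∈ Matrix.specialUnitaryGroup (Fin 2) ℂ) :
    A⁻¹ = Aᴴ :=
  Matrix.inv_eq_left_inv
    (Matrix.mem_unitaryGroup_iff'.1 (Matrix.mem_specialUnitaryGroup_iff.1 hA).1)

theorem eq_spinorMatrix {A : Mat2} (hA : A ∈ Matrix.specialUnitaryGroup (Fin 2) ℂ) :
    A = spinorMatrix (A 0 0, A 1 0) := by
  have h1 := inv_eq_conjTranspose hA
  have h2 : A⁻¹ = A.adjugate := by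
    rw [Matrix.inv_def, (Matrix.mem_specialUnitaryGroup_iff.1 hA).2]; simp
  rw [h1, Matrix.adjugate_fin_two] at h2
  have e1 := congrFun (congrFun h2 0) 0
  have e2 := congrFun (congrFun h2 0) 1
  simp at e1 e2
  ext i j
  fin_cases i <;> fin_cases j <;> simp [spinorMatrix, e1, e2]

theorem herm_of_mem {A : Mat2} (hA : A ∈ Matrix.specialUnitaryGroup (Fin 2) ℂ) :
    herm (A 0 0, A 1 0) (A 0 0, A 1 0) = 1 := by
  have h := (Matrix.mem_specialUnitaryGroup_iff.1 hA).2
  rw [eq_spinorMatrix hA, Matrix.det_fin_two] at h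
  simp [spinorMatrix] at h
  simp only [herm]; linear_combination h

theorem toSu2_injective : Function.Injective toSu2 := fun v w h => by
  have h1 := congrFun (congrFun h 1) 0
  have h2 := congrFun (congrFun h 0) 0
  simp [toSu2, E1, E2, E3] at h1 h2
  have h3 := congrArg Complex.re h1
  have h4 := congrArg Complex.im h1
  simp at h3 h4
  ext i; fin_cases i
  · exact h4
  · exact h3
  · exact h2

theorem spinorMatrix_conj_E3 (x : ℂ × ℂ) :
    spinorMatrix x * E3 * (spinorMatrix x)ᴴ = toSu2 (spinorPoint x) := by
  ext i j
  fin_cases i <;> fin_cases j <;> apply Complex.ext <;>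
    simp [spinorMatrix, Matrix.mul_apply, E1, E2, E3, toSu2, spinorPoint, sq] <;> ring

theorem spinorMatrix_conj_E1 (x : ℂ × ℂ) :
    spinorMatrix x * E1 * (spinorMatrix x)ᴴ = toSu2 (spinorTangent x) := by
  ext i j
  fin_cases i <;> fin_cases j <;> apply Complex.ext <;>
    simp [spinorMatrix, Matrix.mul_apply, E1, E2, E3, toSu2, spinorTangent, sq] <;> ring

theorem dot3_spinorPoint (x y : ℂ × ℂ) : dot3 (spinorPoint x) (spinorPoint y) =
    (herm x x).re * (herm y y).re - 2 * Complex.normSq (det2 x y) := by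
  simp [dot3, spinorPoint, herm, det2, Complex.normSq_apply]; ring

theorem spinorPoint_eq_iff {x y : ℂ × ℂ} (hx : herm x x = 1) (hy : herm y y = 1) :
    spinorPoint x = spinorPoint y ↔ det2 x y = 0 := by
  have h := dot3_spinorPoint x y
  have hxx := dot3_spinorPoint x x
  have hyy := dot3_spinorPoint y y
  simp only [hx, hy, det2_self, map_zero, Complex.one_re] at h hxx hyy
  constructor
  · intro e
    rw [e, hyy] at h
    exact Complex.normSq_eq_zero.1 (by linarith)
  · intro e
    rw [e, map_zero] at h
    have h3 : dot3 (spinorPoint x) (spinorPoint x) - 2 * dot3 (spinorPoint x) (spinorPoint y) +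
      dot3 (spinorPoint y) (spinorPoint y) = 0 := by rw [h, hxx, hyy]; norm_num
    set v := spinorPoint x
    set w := spinorPoint y
    have h4 : (v 0 - w 0) ^ 2 + (v 1 - w 1) ^ 2 + (v 2 - w 2) ^ 2 = 0 := by
      rw [← h3]; simp only [dot3]; ring
    ext i; fin_cases i <;> simp <;>
        nlinarith [sq_nonneg (v 0 - w 0), sq_nonneg (v 1 - w 1), sq_nonneg (v 2 - w 2)]

theorem spinorTangent_smul (ζ : ℂ) (x : ℂ × ℂ) : spinorTangent (ζ • x) =
    (ζ ^ 2).re • spinorTangent x + (ζ ^ 2).im • spinorNormal x := by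
  ext i
  fin_cases i <;> simp [spinorTangent, spinorNormal, sq] <;> ring

theorem det3_spinor {x : ℂ × ℂ} (hx : herm x x = 1) (a b v : ℝ) :
    det3 (spinorPoint x) (v • spinorTangent x)
      (a • spinorTangent x + b • spinorNormal x) = v * b := by
  have h := sq_sum_eq_one hx
  have : v * b = v * b * (x.1.re ^ 2 + x.1.im ^ 2 + x.2.re ^ 2 + x.2.im ^ 2) ^ 3 := by rw [h]; ring
  rw [this]
  simp [det3, dot3, cross3, spinorPoint, spinorTangent, spinorNormal]; ring

theorem norm3_pos {v : R3} (hv : v ≠ 0) : 0 < norm3 v := by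
  refine Real.sqrt_pos.2 ?_
  by_contra! h
  refine hv (funext fun i => ?_)
  simp only [dot3] at h
  fin_cases i <;> simp <;> nlinarith [sq_nonneg (v 0), sq_nonneg (v 1), sq_nonneg (v 2)]

namespace IsLift

variable {γ : ℝ → R3} {c : ℝ → Mat2}

theorem eq_spinorMatrix (hc : IsLift γ c) (s : ℝ) : c s = spinorMatrix (firstColumn c s) :=
  _root_.eq_spinorMatrix (hc.mem s)

theorem unit (hc : IsLift γ c) (s : ℝ) : herm (firstColumn c s) (firstColumn c s) = 1 :=
  herm_of_mem (hc.mem s)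

theorem point (hc : IsLift γ c) (s : ℝ) : γ s = spinorPoint (firstColumn c s) := by
  refine toSu2_injective ?_
  rw [← hc.ad3, AdM, inv_eq_conjTranspose (hc.mem s), hc.eq_spinorMatrix,
    spinorMatrix_conj_E3]

theorem tangent (hc : IsLift γ c) (hγ : IsRegularCurve γ) (s : ℝ) :
    deriv γ s = norm3 (deriv γ s) • spinorTangent (firstColumn c s) := by
  have : (norm3 (deriv γ s))⁻¹ • deriv γ s = spinorTangent (firstColumn c s) := by
    refine toSu2_injective ?_
    rw [← hc.ad1, AdM, inv_eq_conjTranspose (hc.mem s), hc.eq_spinorMatrix,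
      spinorMatrix_conj_E1]
  rw [← this, smul_inv_smul₀ (norm3_pos (hγ.reg s)).ne']

end IsLift

theorem HasDerivAt.complex_re {f : ℝ → ℂ} {d : ℂ} {s : ℝ} (h : HasDerivAt f d s) :
    HasDerivAt (fun s => (f s).re) d.re s :=
  (Complex.reCLM.hasFDerivAt (x := f s)).comp_hasDerivAt s h

theorem HasDerivAt.complex_im {f : ℝ → ℂ} {d : ℂ} {s : ℝ} (h : HasDerivAt f d s) :
    HasDerivAt (fun s => (f s).im) d.im s :=
  (Complex.imCLM.hasFDerivAt (x := f s)).comp_hasDerivAt s h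

/-- The velocity of a unit spinor is determined by the velocity of the underlying point and the
geodesic curvature. -/
theorem spinor_velocity {ξ D : ℂ × ℂ} {v k : ℝ} (hξ : herm ξ ξ = 1) (hre : (herm ξ D).re = 0)
    (him : (herm ξ D).im = v / 2 * k) (hdet : det2 ξ D = (v / 2 : ℝ)) :
    D.1 = (v / 2 : ℝ) * (Complex.I * k * ξ.1 - conj ξ.2) ∧
      D.2 = (v / 2 : ℝ) * (Complex.I * k * ξ.2 + conj ξ.1) := by
  have h : herm ξ D = (v / 2 : ℝ) * k * Complex.I := by
    apply Complex.ext <;> simp [hre, him]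
  simp only [herm, det2] at h hdet hξ
  constructor
  · linear_combination ξ.1 * h - conj ξ.2 * hdet - D.1 * hξ
  · linear_combination ξ.2 * h + conj ξ.1 * hdet - D.2 * hξ

namespace IsRegularCurve

variable {γ : ℝ → R3}

theorem smooth_deriv (hγ : IsRegularCurve γ) : ContDiff ℝ (⊤ : ℕ∞) (deriv γ) :=
  (contDiff_infty_iff_deriv.1 hγ.smooth).2

theorem continuous_norm3_deriv (hγ : IsRegularCurve γ) : Continuous fun s => norm3 (deriv γ s) := by
  have := hγ.smooth_deriv.continuous
  unfold norm3 dot3; fun_prop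

theorem continuous_kappa (hγ : IsRegularCurve γ) : Continuous (kappa γ) := by
  have h0 := hγ.smooth.continuous
  have h1 := hγ.smooth_deriv.continuous
  have h2 := (contDiff_infty_iff_deriv.1 hγ.smooth_deriv).2.continuous
  refine Continuous.div ?_ (hγ.continuous_norm3_deriv.pow 3) fun s =>
    pow_ne_zero 3 (norm3_pos (hγ.reg s)).ne'
  simp only [det3, dot3, cross3, Matrix.cons_val]
  fun_prop

end IsRegularCurve

namespace IsLift

variable {γ : ℝ → R3} {c : ℝ → Mat2}

theorem spinorCurve (hc : IsLift γ c) (hγ : IsRegularCurve γ) :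
    SpinorCurve (firstColumn c) (fun s => norm3 (deriv γ s) / 2) (kappa γ) := by
  have key : ∀ s, ∃ D : ℂ × ℂ, HasDerivAt (fun s => c s 0 0) D.1 s ∧
      HasDerivAt (fun s => c s 1 0) D.2 s ∧
      D.1 = (norm3 (deriv γ s) / 2 : ℝ) * (Complex.I * kappa γ s * c s 0 0 - conj (c s 1 0)) ∧
      D.2 = (norm3 (deriv γ s) / 2 : ℝ) * (Complex.I * kappa γ s * c s 1 0 + conj (c s 0 0)) := by
    intro s
    have hp := ((hc.smooth 0 0).differentiable (by simp) s).hasDerivAt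
    have hr := ((hc.smooth 1 0).differentiable (by simp) s).hasDerivAt
    have hγd := hasDerivAt_pi.1 (hγ.smooth.differentiable (by simp) s).hasDerivAt
    have hγdd := hasDerivAt_pi.1 (hγ.smooth_deriv.differentiable (by simp) s).hasDerivAt
    have hv := norm3_pos (hγ.reg s)
    refine ⟨(deriv (fun s => c s 0 0) s, deriv (fun s => c s 1 0) s), hp, hr, ?_⟩
    set D : ℂ × ℂ := (deriv (fun s => c s 0 0) s, deriv (fun s => c s 1 0) s)
    have ha := hp.complex_re
    have hb := hp.complex_im
    have hx := hr.complex_re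
    have hy := hr.complex_im
    have hN := sq_sum_eq_one (hc.unit s)
    have hpt := hc.point
    have htan := hc.tangent hγ
    have hu : D.1.re * (c s 0 0).re + D.1.im * (c s 0 0).im + D.2.re * (c s 1 0).re +
        D.2.im * (c s 1 0).im = 0 := by
      have h1 := (((ha.pow 2).add (hb.pow 2)).add (hx.pow 2)).add (hy.pow 2)
      have h2 := h1.unique ((hasDerivAt_const s (1 : ℝ)).congr_of_eventuallyEq
        (Filter.Eventually.of_forall fun t => sq_sum_eq_one (hc.unit t)))
      simp at h2
      linear_combination h2 / 2
    have f0 := (((ha.mul hx).add (hb.mul hy)).const_mul 2).unique ((hγd 0).congr_of_eventuallyEq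
      (Filter.Eventually.of_forall fun t => by
        simpa [spinorPoint, firstColumn] using (congrFun (hpt t) 0).symm))
    have f1 := (((hb.mul hx).sub (ha.mul hy)).const_mul 2).unique ((hγd 1).congr_of_eventuallyEq
      (Filter.Eventually.of_forall fun t => by
        simpa [spinorPoint, firstColumn] using (congrFun (hpt t) 1).symm))
    have f2 := ((((ha.pow 2).add (hb.pow 2)).sub (hx.pow 2)).sub (hy.pow 2)).unique
      ((hγd 2).congr_of_eventuallyEq
      (Filter.Eventually.of_forall fun t => by
        simpa [spinorPoint, firstColumn] using (congrFun (hpt t) 2).symm))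
    have g := ((((hγdd 0).mul (((hx.mul hy).sub (ha.mul hb)).const_mul 2)).add
      ((hγdd 1).mul ((((ha.pow 2).sub (hb.pow 2)).add (hx.pow 2)).sub (hy.pow 2)))).add
      ((hγdd 2).mul (((ha.mul hy).add (hb.mul hx)).const_mul 2))).unique
      ((hasDerivAt_const s (0 : ℝ)).congr_of_eventuallyEq
        (Filter.Eventually.of_forall fun t => by
          have t0 := congrFun (htan t) 0
          have t1 := congrFun (htan t) 1
          have t2 := congrFun (htan t) 2
          simp [spinorTangent, firstColumn] at t0 t1 t2 ⊢
          rw [t0, t1, t2]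
          ring))
    have hk : kappa γ s * norm3 (deriv γ s) ^ 3 =
        det3 (γ s) (deriv γ s) (deriv (deriv γ) s) := by
      rw [kappa, div_mul_cancel₀ _ (pow_ne_zero 3 hv.ne')]
    have t0 := congrFun (htan s) 0
    have t1 := congrFun (htan s) 1
    have t2 := congrFun (htan s) 2
    have p0 := congrFun (hpt s) 0
    have p1 := congrFun (hpt s) 1
    have p2 := congrFun (hpt s) 2
    simp [spinorTangent, spinorPoint, firstColumn] at t0 t1 t2 p0 p1 p2 hN
    simp only [det3, dot3, cross3, Matrix.cons_val] at hk
    simp at f0 f1 f2 g hk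
    simp only [t0, t1, t2, p0, p1, p2] at hk f0 f1 f2 g
    refine spinor_velocity (ξ := (c s 0 0, c s 1 0)) (D := D) (hc.unit s) ?_ ?_ ?_
    · simp [herm]; linear_combination hu
    · simp only [herm, Complex.add_im, Complex.mul_im, Complex.conj_re, Complex.conj_im]
      generalize norm3 (deriv γ s) = v at *
      generalize kappa γ s = k at *
      generalize deriv (deriv γ) s 0 = g0 at *
      generalize deriv (deriv γ) s 1 = g1 at *
      generalize deriv (deriv γ) s 2 = g2 at *
      generalize (c s 0 0).re = a at *
      generalize (c s 0 0).im = b at *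
      generalize (c s 1 0).re = x at *
      generalize (c s 1 0).im = y at *
      refine mul_left_cancel₀ (pow_ne_zero 2 hv.ne') ?_
      simp only [D]
      generalize (deriv (fun s => c s 0 0) s).re = a' at *
      generalize (deriv (fun s => c s 0 0) s).im = b' at *
      generalize (deriv (fun s => c s 1 0) s).re = x' at *
      generalize (deriv (fun s => c s 1 0) s).im = y' at *
      have hN' : a ^ 2 + b ^ 2 + x ^ 2 + y ^ 2 - 1 = 0 := sub_eq_zero.2 hN
      linear_combination -hk / 2 - v * (a ^ 2 + b ^ 2 + x ^ 2 + y ^ 2) / 2 * g -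
        v ^ 2 * (a * b' - b * a' + x * y' - y * x') *
        (a ^ 2 + b ^ 2 + x ^ 2 + y ^ 2 + 1) * hN'
    · have hN' := sub_eq_zero.2 hN
      apply Complex.ext
      · simp only [det2, Complex.sub_re, Complex.mul_re, Complex.ofReal_re, D]
        generalize norm3 (deriv γ s) = v at *
        generalize (c s 0 0).re = a at *
        generalize (c s 0 0).im = b at *
        generalize (c s 1 0).re = x at *
        generalize (c s 1 0).im = y at *
        linear_combination (a ^ 2 - b ^ 2 - x ^ 2 + y ^ 2) / 2 * f0 + (a * b + x * y) * f1 +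
          (b * y - a * x) * f2 + (v / 2 * (1 + (a ^ 2 + b ^ 2 + x ^ 2 + y ^ 2)) -
            (a * D.2.re - b * D.2.im - x * D.1.re + y * D.1.im)) * hN'
      · simp only [det2, Complex.sub_im, Complex.mul_im, Complex.ofReal_im, D]
        generalize norm3 (deriv γ s) = v at *
        generalize (c s 0 0).re = a at *
        generalize (c s 0 0).im = b at *
        generalize (c s 1 0).re = x at *
        generalize (c s 1 0).im = y at *
        linear_combination (a * b - x * y) * f0 -
          (a ^ 2 - b ^ 2 + x ^ 2 - y ^ 2) / 2 * f1 - (a * y + b * x) * f2 -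
          (a * D.2.im + b * D.2.re - x * D.1.im - y * D.1.re) * hN'
  refine ⟨fun s => ?_, fun s => ?_, hc.unit, fun s => half_pos (norm3_pos (hγ.reg s)),
    hγ.continuous_norm3_deriv.div_const 2, hγ.continuous_kappa⟩
  · obtain ⟨D, h1, -, h3, -⟩ := key s
    exact h1.congr_deriv h3
  · obtain ⟨D, -, h2, -, h4⟩ := key s
    exact h2.congr_deriv h4

end IsLift

theorem dot3_spinorTangent_self {x : ℂ × ℂ} (hx : herm x x = 1) :
    dot3 (spinorTangent x) (spinorTangent x) = 1 := by
  have h := sq_sum_eq_one hx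
  have : dot3 (spinorTangent x) (spinorTangent x) =
    (x.1.re ^ 2 + x.1.im ^ 2 + x.2.re ^ 2 + x.2.im ^ 2) ^ 2 := by
    simp [dot3, spinorTangent]; ring
  rw [this, h, one_pow]

theorem dot3_spinorTangent_smul {ζ : ℂ} {x : ℂ × ℂ} (hx : herm x x = 1) :
    dot3 (spinorTangent x) (spinorTangent (ζ • x)) = (ζ ^ 2).re := by
  have h := sq_sum_eq_one hx
  have : dot3 (spinorTangent x) (spinorTangent (ζ • x)) =
    (ζ ^ 2).re * (x.1.re ^ 2 + x.1.im ^ 2 + x.2.re ^ 2 + x.2.im ^ 2) ^ 2 := by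
    rw [spinorTangent_smul]
    simp [dot3, spinorTangent, spinorNormal]; ring
  rw [this, h, one_pow, mul_one]

theorem normSq_herm_eq_one {x y : ℂ × ℂ} (hx : herm x x = 1) (hy : herm y y = 1)
    (h : det2 x y = 0) : Complex.normSq (herm x y) = 1 := by
  have h1 := normSq_herm_add_det2 (y := y) hx
  have h2 := sq_sum_eq_one hy
  rw [h, map_zero, Complex.normSq_apply y.1, Complex.normSq_apply y.2] at h1
  linarith

namespace IsLift

variable {γ : ℝ → R3} {c : ℝ → Mat2}

theorem point_eq_iff (hc : IsLift γ c) (s u : ℝ) :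
    γ s = γ u ↔ det2 (firstColumn c s) (firstColumn c u) = 0 := by
  rw [hc.point, hc.point, spinorPoint_eq_iff (hc.unit s) (hc.unit u)]

theorem firstColumn_eq (hc : IsLift γ c) {s u : ℝ} (h : γ s = γ u) :
    firstColumn c u = herm (firstColumn c s) (firstColumn c u) • firstColumn c s :=
  eq_smul_of_det2_eq_zero (hc.unit s) ((hc.point_eq_iff s u).1 h)

theorem det3_eq (hc : IsLift γ c) (hγ : IsRegularCurve γ) {s u : ℝ} (h : γ s = γ u) :
    det3 (γ s) (deriv γ s) (deriv γ u) = norm3 (deriv γ s) * norm3 (deriv γ u) *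
      (herm (firstColumn c s) (firstColumn c u) ^ 2).im := by
  have e := hc.firstColumn_eq h
  generalize herm (firstColumn c s) (firstColumn c u) = ζ at *
  have hs := hc.tangent hγ s
  have hu := hc.tangent hγ u
  rw [e, spinorTangent_smul] at hu
  generalize norm3 (deriv γ s) = v at *
  generalize norm3 (deriv γ u) = w at *
  rw [hc.point s, hs, hu, smul_add, smul_smul, smul_smul, det3_spinor (hc.unit s)]
  ring

theorem im_ne_zero (hc : IsLift γ c) (hγ : IsRegularCurve γ) {s u : ℝ} (h : γ s = γ u)
    (hli : LinearIndependent ℝ ![deriv γ s, deriv γ u]) :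
    (herm (firstColumn c s) (firstColumn c u) ^ 2).im ≠ 0 := by
  intro h0
  have hs := hc.tangent hγ s
  have hu := hc.tangent hγ u
  have hz := spinorTangent_smul (herm (firstColumn c s) (firstColumn c u)) (firstColumn c s)
  rw [← hc.firstColumn_eq h, h0, zero_smul, add_zero] at hz
  rw [hz] at hu
  have := (LinearIndependent.pair_iff.1 hli
    (norm3 (deriv γ u) * (herm (firstColumn c s) (firstColumn c u) ^ 2).re)
    (-norm3 (deriv γ s)) (by
      generalize norm3 (deriv γ u) = v at *
      generalize norm3 (deriv γ s) = w at *
      rw [hs, hu]; module)).2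
  exact (norm3_pos (hγ.reg s)).ne' (neg_eq_zero.1 this)

theorem ne_of_isShell (hc : IsLift γ c) {a b : ℝ} (h : IsShell γ a b) (s u : ℝ) (has : a ≤ s)
    (hsu : s < u) (hub : u ≤ b) (hlt : u - s < b - a) :
    det2 (firstColumn c s) (firstColumn c u) ≠ 0 := by
  rw [Ne, ← hc.point_eq_iff]
  intro he
  obtain ⟨hab, hinj, hclose, -⟩ := h
  rcases hub.lt_or_eq with hub | rfl
  · exact hsu.ne (hinj ⟨has, hsu.trans hub⟩ ⟨has.trans hsu.le, hub⟩ he)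
  · have := hinj ⟨has, hsu⟩ ⟨le_rfl, hab⟩ (he.trans hclose.symm)
    linarith

theorem spinorShell (hc : IsLift γ c) (hγ : IsRegularCurve γ) {a b : ℝ}
    (h : IsPositiveShell γ a b) :
    SpinorShell (firstColumn c) (fun s => norm3 (deriv γ s) / 2) (kappa γ) a b
      (herm (firstColumn c a) (firstColumn c b)) where
  curve := hc.spinorCurve hγ
  lt := h.1.1
  ne := hc.ne_of_isShell h.1
  close := hc.firstColumn_eq h.1.2.2.1
  pos := by
    have h2 := h.2
    rw [hc.det3_eq hγ h.1.2.2.1] at h2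
    have := mul_pos (norm3_pos (hγ.reg a)) (norm3_pos (hγ.reg b))
    exact (pos_iff_neg_of_mul_neg h2).1 this

theorem spinorShell_reverse (hc : IsLift γ c) (hγ : IsRegularCurve γ) {a b : ℝ}
    (h : IsNegativeShell γ a b) :
    SpinorShell (fun s => (Complex.I * (firstColumn c (-s)).1, Complex.I * (firstColumn c (-s)).2))
      (fun s => norm3 (deriv γ (-s)) / 2) (fun s => -kappa γ (-s)) (-b) (-a)
      (conj (herm (firstColumn c a) (firstColumn c b))) where
  curve := (hc.spinorCurve hγ).reverse
  lt := neg_lt_neg h.1.1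
  ne := fun s u hs hsu hu hlt h0 => by
    refine hc.ne_of_isShell h.1 (-u) (-s) (by linarith) (by linarith) (by linarith) (by linarith) ?_
    rw [det2_swap]
    simp only [det2] at h0 ⊢
    linear_combination h0 - ((firstColumn c (-s)).1 * (firstColumn c (-u)).2 -
      (firstColumn c (-s)).2 * (firstColumn c (-u)).1) * Complex.I_sq
  close := by
    rw [neg_neg, neg_neg, ← herm_swap]
    have := hc.firstColumn_eq h.1.2.2.1.symm
    refine Prod.ext ?_ ?_
    · have := congrArg Prod.fst this
      simp at this ⊢
      linear_combination Complex.I * this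
    · have := congrArg Prod.snd this
      simp at this ⊢
      linear_combination Complex.I * this
  pos := by
    have h2 := h.2
    rw [hc.det3_eq hγ h.1.2.2.1] at h2
    have := mul_pos (norm3_pos (hγ.reg a)) (norm3_pos (hγ.reg b))
    rw [← map_pow, Complex.conj_im]
    exact neg_neg_of_pos ((pos_iff_pos_of_mul_pos h2).1 this)

theorem inv_eq (hc : IsLift γ c) (s : ℝ) : (c s)⁻¹ = spinorMatrix (qconj (firstColumn c s)) := by
  rw [inv_eq_conjTranspose (hc.mem s), hc.eq_spinorMatrix]
  ext i j
  fin_cases i <;> fin_cases j <;> simp [spinorMatrix, qconj, firstColumn]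

theorem exists_antipodal_of_shells {γ' : ℝ → R3} {c' : ℝ → Mat2} (hc : IsLift γ c)
    (hc' : IsLift γ' c') (hγ : IsRegularCurve γ) (hγ' : IsRegularCurve γ') {μ : ℝ}
    (hκ : ∀ s, μ < kappa γ s) (hκ' : ∀ s, kappa γ' s < μ) {a b a' b' : ℝ}
    (h : IsNegativeShell γ a b) (h' : IsPositiveShell γ' a' b') :
    ∃ s s' t t', c t * (c' t')⁻¹ = -(c s * (c' s')⁻¹) := by
  obtain ⟨s, t, s', t', he⟩ := (hc.spinorShell_reverse hγ h).exists_antipodal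
    (hc'.spinorShell hγ' h') (fun s _ => neg_lt_neg (hκ (-s))) fun s _ => hκ' s
  have key : ∀ s, Complex.I • (Complex.I * (firstColumn c (-s)).1,
      Complex.I * (firstColumn c (-s)).2) = -firstColumn c (-s) := fun s => by
    ext <;> simp [← mul_assoc]
  rw [key, key, neg_act, neg_act] at he
  refine ⟨-t, t', -s, s', ?_⟩
  rw [hc'.inv_eq, hc'.inv_eq, hc.eq_spinorMatrix, hc.eq_spinorMatrix, spinorMatrix_mul,
    spinorMatrix_mul, ← spinorMatrix_neg, ← neg_inj.1 he]

/-- A lift of a closed curve is closed up to sign. -/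
theorem exists_sign (hc : IsLift γ c) (hγ : IsRegularCurve γ) {l : ℝ} (hl : ∀ s, γ (s + l) = γ s) :
    ∃ σ : ℂ, σ ^ 2 = 1 ∧ ∀ s, firstColumn c (s + l) = σ • firstColumn c s := by
  have hξ := hc.spinorCurve hγ
  have hsm := fun s => hc.firstColumn_eq (hl s).symm
  set ζ : ℝ → ℂ := fun s => herm (firstColumn c s) (firstColumn c (s + l)) with hζ
  have hd : ∀ s, deriv γ (s + l) = deriv γ s := fun s => by
    rw [← deriv_comp_add_const]; simp only [hl]
  have hsq : ∀ s, ζ s ^ 2 = 1 := fun s => by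
    have h1 := hc.tangent hγ (s + l)
    have h0 := hc.tangent hγ s
    have hv := (norm3_pos (hγ.reg s)).ne'
    rw [hd] at h1
    generalize norm3 (deriv γ s) = v at *
    have h2 : spinorTangent (firstColumn c s) = spinorTangent (firstColumn c (s + l)) :=
      smul_right_injective _ hv (h0.symm.trans h1)
    rw [hsm s] at h2
    have h3 := dot3_spinorTangent_smul (ζ := ζ s) (hc.unit s)
    rw [← h2, dot3_spinorTangent_self (hc.unit s)] at h3
    have h4 := normSq_herm_eq_one (hc.unit s) (hc.unit (s + l))
      ((hc.point_eq_iff _ _).1 (hl s).symm)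
    have h5 : Complex.normSq (ζ s ^ 2) = 1 := by rw [map_pow, h4, one_pow]
    rw [Complex.normSq_apply, ← h3] at h5
    have h6 : (ζ s ^ 2).im = 0 := mul_self_eq_zero.1 (by linarith)
    exact Complex.ext h3.symm h6
  have hcont : Continuous ζ := by
    have := hξ.cont
    fun_prop
  rcases isPreconnected_univ.eq_or_eq_neg_of_sq_eq hcont.continuousOn
    (continuousOn_const (c := (1 : ℂ))) (fun s _ => by simp [hsq]) (by simp) with h | h
  · exact ⟨1, by norm_num, fun s => (hsm s).trans (by rw [show herm _ _ = ζ s from rfl, h trivial])⟩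
  · exact ⟨-1, by norm_num, fun s => (hsm s).trans
      (by rw [show herm _ _ = ζ s from rfl, h trivial]; rfl)⟩

end IsLift

namespace SpinorCurve

variable {ξ : ℝ → ℂ × ℂ} {V κ : ℝ → ℝ}

theorem shift (hξ : SpinorCurve ξ V κ) (r : ℝ) :
    SpinorCurve (fun s => ξ (r + s)) (fun s => V (r + s)) (fun s => κ (r + s)) where
  d1 s := (hξ.d1 (r + s)).comp_const_add r s
  d2 s := (hξ.d2 (r + s)).comp_const_add r s
  unit s := hξ.unit (r + s)
  V_pos s := hξ.V_pos (r + s)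
  V_cont := hξ.V_cont.comp (by fun_prop)
  κ_cont := hξ.κ_cont.comp (by fun_prop)

/-- The pairs of crossing parameters in a fundamental interval. -/
def crossingPairs (ξ : ℝ → ℂ × ℂ) (l : ℝ) : Set (ℝ × ℝ) :=
  {p | 0 ≤ p.1 ∧ p.1 < p.2 ∧ p.2 ≤ l ∧ p.2 - p.1 < l ∧ det2 (ξ p.1) (ξ p.2) = 0}

/-- A curve is locally injective. -/
theorem eventually_det2_ne_zero (hξ : SpinorCurve ξ V κ) (s : ℝ) :
    ∀ᶠ p : ℝ × ℝ in nhds (s, s), p.1 ≠ p.2 → det2 (ξ p.1) (ξ p.2) ≠ 0 := by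
  have h0 : hξ.divided (s, s) ≠ 0 := by
    rw [hξ.divided_diag]; exact_mod_cast (hξ.V_pos s).ne'
  filter_upwards [hξ.continuous_divided.continuousAt.eventually_ne h0] with p hp hne
  rw [hξ.det2_eq_divided]
  refine mul_ne_zero ?_ hp
  exact_mod_cast sub_ne_zero.2 hne.symm

theorem finite_crossingPairs (hξ : SpinorCurve ξ V κ) {l : ℝ} {σ : ℂ} (hσ : σ ^ 2 = 1)
    (hper : ∀ s, ξ (s + l) = σ • ξ s)
    (htr : ∀ p ∈ crossingPairs ξ l, (herm (ξ p.1) (ξ p.2) ^ 2).im ≠ 0) :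
    (crossingPairs ξ l).Finite := by
  have hσ0 : σ ≠ 0 := fun h => by simp [h] at hσ
  by_contra hinf
  obtain ⟨p, hp, hacc⟩ := Set.Infinite.exists_accPt_of_subset_isCompact hinf
    ((isCompact_Icc (a := (0 : ℝ)) (b := l)).prod (isCompact_Icc (a := (0 : ℝ)) (b := l)))
    fun q ⟨h1, h2, h3, _⟩ => ⟨⟨h1, h2.le.trans h3⟩, h1.trans h2.le, h3⟩
  rw [accPt_iff_frequently_nhdsNE] at hacc
  have hcl : p ∈ closure (crossingPairs ξ l) :=
    mem_closure_iff_frequently.2 (hacc.filter_mono nhdsWithin_le_nhds)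
  have hξc := hξ.cont
  have hle : p.1 ≤ p.2 :=
    closure_minimal (fun q hq => hq.2.1.le) (isClosed_le continuous_fst continuous_snd) hcl
  have hdet : det2 (ξ p.1) (ξ p.2) = 0 :=
    closure_minimal (t := {q : ℝ × ℝ | det2 (ξ q.1) (ξ q.2) = 0}) (fun q hq => hq.2.2.2.2)
      (isClosed_eq (by fun_prop) continuous_const) hcl
  refine hacc ?_
  rcases hle.eq_or_lt with heq | hlt
  · have := hξ.eventually_det2_ne_zero p.1
    rw [show (p.1, p.1) = p from Prod.ext rfl heq] at this
    filter_upwards [nhdsWithin_le_nhds this] with q hq hmem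
    exact hq hmem.2.1.ne hmem.2.2.2.2
  by_cases hl : p.2 - p.1 < l
  · have hZ : p ∈ crossingPairs ξ l := ⟨hp.1.1, hlt, hp.2.2, hl, hdet⟩
    have hd := hξ.hasFDerivAt_det2_prod p
    simp only [hdet, mul_zero, zero_sub, zero_add] at hd
    have hN := hd.eventually_ne (c := 0) <| by
      obtain ⟨K, -, hK⟩ := LinearMap.exists_antilipschitzWith (ContinuousLinearMap.toLinearMap
        ((ContinuousLinearMap.fst ℝ ℝ ℝ).smulRight (V p.1 * -herm (ξ p.1) (ξ p.2)) +
          (ContinuousLinearMap.snd ℝ ℝ ℝ).smulRight (V p.2 * conj (herm (ξ p.1) (ξ p.2)))))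
        (LinearMap.ker_eq_bot'.2 fun x hx =>
          eq_zero_of_det2_deriv (htr p hZ) (hξ.V_pos _) (hξ.V_pos _) (by simpa using hx))
      exact ⟨K, hK⟩
    filter_upwards [hN] with q hq hmem using hq hmem.2.2.2.2
  · have e1 : p.1 = 0 := by linarith [hp.1.1, hp.2.2]
    have e2 : p.2 = l := by linarith [hp.1.1, hp.2.2]
    have hev := hξ.eventually_det2_ne_zero 0
    have hcont : Filter.Tendsto (fun q : ℝ × ℝ => (q.1, q.2 - l)) (nhds p) (nhds (0, 0)) := by
      have : Continuous fun q : ℝ × ℝ => (q.1, q.2 - l) := by fun_prop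
      simpa [e1, e2] using this.tendsto p
    filter_upwards [nhdsWithin_le_nhds (hcont.eventually hev)] with q hq hmem
    obtain ⟨h1, h2, h3, h4, h5⟩ := hmem
    refine hq (show q.1 ≠ q.2 - l from fun h => by linarith) ?_
    have := hper (q.2 - l)
    rw [sub_add_cancel] at this
    rw [this] at h5
    have h6 : σ * det2 (ξ q.1) (ξ (q.2 - l)) = 0 := by
      rw [← h5]; simp [det2]; ring
    exact (mul_eq_zero.1 h6).resolve_left hσ0

end SpinorCurve

theorem exists_mem_Ico_sub {l : ℝ} (hl : 0 < l) (s : ℝ) :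
    ∃ t ∈ Set.Ico 0 l, ∃ k : ℤ, s - t = k * l := by
  obtain ⟨m, hm, -⟩ := existsUnique_sub_zsmul_mem_Ico hl s 0
  rw [zero_add] at hm
  exact ⟨_, hm, m, by rw [zsmul_eq_mul]; ring⟩

theorem eq_of_sub_eq_int_mul {l : ℝ} (hl : 0 < l) {s t : ℝ} (hs : s ∈ Set.Ico 0 l)
    (ht : t ∈ Set.Ico 0 l) {k : ℤ} (h : s - t = k * l) : s = t := by
  have h1 : (k : ℝ) < 1 := by
    by_contra! h1; nlinarith [hs.2, ht.1]
  have h2 : (-1 : ℝ) < k := by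
    by_contra! h1; nlinarith [hs.1, ht.2]
  have h3 : k = 0 := by
    have : k < 1 := by exact_mod_cast h1
    have : -1 < k := by exact_mod_cast h2
    omega
  rw [h3] at h; push_cast at h; linarith

theorem not_exists_int_mul {l d : ℝ} (h0 : 0 < d) (hd : d < l) : ¬∃ k : ℤ, d = k * l := by
  rintro ⟨k, hk⟩
  exact h0.ne' (eq_of_sub_eq_int_mul (h0.trans hd) ⟨h0.le, hd⟩ ⟨le_rfl, h0.trans hd⟩
    (k := k) (by rw [sub_zero, hk]))

theorem HasPeriod.eq_of_sub_eq {γ : ℝ → R3} {l : ℝ} (hl : HasPeriod γ l) {s t : ℝ} {k : ℤ}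
    (h : s - t = k * l) : γ s = γ t := by
  rw [← Function.Periodic.int_mul hl.2 k t, ← h, add_sub_cancel]

/-- A generic closed curve passes through a point that is not a crossing. -/
theorem IsGeneric.exists_simple_point {γ : ℝ → R3} {l : ℝ} (hl : HasPeriod γ l) {C : Set (ℝ × ℝ)}
    (hfin : C.Finite)
    (hC : ∀ s t, 0 ≤ s → s < t → t < l → γ s = γ t → (s, t) ∈ C) :
    ∃ r, ∀ u, γ u = γ r → ∃ k : ℤ, u - r = k * l := by
  obtain ⟨r, hr, hrC⟩ := (Set.Ioo_infinite hl.1).exists_notMem_finite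
    ((hfin.image Prod.fst).union (hfin.image Prod.snd))
  refine ⟨r, fun u hu => ?_⟩
  obtain ⟨t, ht, k, hk⟩ := exists_mem_Ico_sub hl.1 u
  have htr : γ t = γ r := (hl.eq_of_sub_eq hk).symm.trans hu
  rcases lt_trichotomy t r with h | rfl | h
  · exact absurd (Or.inr ⟨_, hC t r ht.1 h hr.2 htr, rfl⟩) hrC
  · exact ⟨k, hk⟩
  · exact absurd (Or.inl ⟨_, hC r t hr.1.le h ht.2 htr.symm, rfl⟩) hrC

namespace IsLift

variable {γ : ℝ → R3} {c : ℝ → Mat2} {l : ℝ}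

theorem im_ne_zero_of_mem_crossingPairs (hc : IsLift γ c) (hγ : IsRegularCurve γ)
    (hgen : IsGeneric γ l) (r : ℝ) (p : ℝ × ℝ)
    (hp : p ∈ SpinorCurve.crossingPairs (fun s => firstColumn c (r + s)) l) :
    (herm (firstColumn c (r + p.1)) (firstColumn c (r + p.2)) ^ 2).im ≠ 0 := by
  have he := (hc.point_eq_iff _ _).2 hp.2.2.2.2
  refine hc.im_ne_zero hγ he (hgen _ _ he fun ⟨k, hk⟩ => ?_).1
  exact not_exists_int_mul (sub_pos.2 hp.2.1) hp.2.2.2.1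
    ⟨-k, by push_cast; linear_combination -hk⟩

theorem finite_crossingPairs (hc : IsLift γ c) (hγ : IsRegularCurve γ) (hl : HasPeriod γ l)
    (hgen : IsGeneric γ l) (r : ℝ) :
    (SpinorCurve.crossingPairs (fun s => firstColumn c (r + s)) l).Finite := by
  obtain ⟨σ, hσ, hper⟩ := hc.exists_sign hγ hl.2
  exact ((hc.spinorCurve hγ).shift r).finite_crossingPairs hσ
    (fun s => by rw [← add_assoc, hper]) (hc.im_ne_zero_of_mem_crossingPairs hγ hgen r)

theorem mem_crossingPairs_iff (hc : IsLift γ c) (r : ℝ) (p : ℝ × ℝ) :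
    p ∈ SpinorCurve.crossingPairs (fun s => firstColumn c (r + s)) l ↔
      0 ≤ p.1 ∧ p.1 < p.2 ∧ p.2 ≤ l ∧ p.2 - p.1 < l ∧ γ (r + p.1) = γ (r + p.2) := by
  rw [hc.point_eq_iff]; rfl

/-- The crossings of a generic closed curve correspond to its pairs of crossing parameters, as
long as the base point is not a crossing. -/
theorem ncard_crossingPairs (hc : IsLift γ c) (hl : HasPeriod γ l) (hgen : IsGeneric γ l) {r : ℝ}
    (hint : ∀ p ∈ SpinorCurve.crossingPairs (fun s => firstColumn c (r + s)) l,
      0 < p.1 ∧ p.2 < l) :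
    (SpinorCurve.crossingPairs (fun s => firstColumn c (r + s)) l).ncard = crossings γ l := by
  have hinj : Set.InjOn (fun p : ℝ × ℝ => γ (r + p.1))
      (SpinorCurve.crossingPairs (fun s => firstColumn c (r + s)) l) := by
    intro p hp q hq hpq
    have hp' := hint p hp
    have hq' := hint q hq
    obtain ⟨p0, p1, p2, p3, p4⟩ := (hc.mem_crossingPairs_iff r p).1 hp
    obtain ⟨q0, q1, q2, q3, q4⟩ := (hc.mem_crossingPairs_iff r q).1 hq
    have key := (hgen _ _ p4 fun ⟨k, hk⟩ => not_exists_int_mul (sub_pos.2 p1) p3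
      ⟨-k, by push_cast; linear_combination -hk⟩).2
    have red : ∀ u ∈ Set.Ico 0 l, γ (r + u) = γ (r + p.1) → u = p.1 ∨ u = p.2 := by
      intro u hu h
      refine (key _ h).imp ?_ ?_
      · rintro ⟨k, hk⟩
        exact eq_of_sub_eq_int_mul hl.1 hu ⟨p0, by linarith⟩ (k := k) (by linear_combination hk)
      · rintro ⟨k, hk⟩
        exact eq_of_sub_eq_int_mul hl.1 hu ⟨by linarith, hp'.2⟩ (k := k) (by linear_combination hk)
    have h1 := red q.1 ⟨q0, by linarith⟩ hpq.symm
    have h2 := red q.2 ⟨by linarith, hq'.2⟩ (q4.symm.trans hpq.symm)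
    refine Prod.ext ?_ ?_ <;> rcases h1 with h1 | h1 <;> rcases h2 with h2 | h2 <;> linarith
  rw [← hinj.ncard_image, crossings]
  congr 1
  ext P
  constructor
  · rintro ⟨p, hp, rfl⟩
    obtain ⟨p0, p1, p2, p3, p4⟩ := (hc.mem_crossingPairs_iff r p).1 hp
    refine ⟨r + p.1, r + p.2, rfl, p4.symm, fun ⟨k, hk⟩ => ?_⟩
    exact not_exists_int_mul (sub_pos.2 p1) p3 ⟨-k, by push_cast; linear_combination -hk⟩
  · rintro ⟨s, t, rfl, hts, hne⟩
    obtain ⟨s', hs', k, hk⟩ := exists_mem_Ico_sub hl.1 (s - r)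
    obtain ⟨t', ht', m, hm⟩ := exists_mem_Ico_sub hl.1 (t - r)
    have es : γ s = γ (r + s') := hl.eq_of_sub_eq (k := k) (by linear_combination hk)
    have et : γ t = γ (r + t') := hl.eq_of_sub_eq (k := m) (by linear_combination hm)
    rcases lt_trichotomy s' t' with h | rfl | h
    · exact ⟨(s', t'), (hc.mem_crossingPairs_iff r _).2 ⟨hs'.1, h, ht'.2.le, by
        linarith [hs'.1, ht'.2], by rw [← es, ← et, hts]⟩, es.symm⟩
    · exact absurd ⟨k - m, by push_cast; linear_combination hk - hm⟩ hne
    · exact ⟨(t', s'), (hc.mem_crossingPairs_iff r _).2 ⟨ht'.1, h, hs'.2.le, by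
        linarith [hs'.2, ht'.1], by rw [← es, ← et, hts]⟩, et.symm.trans hts⟩

/-- A lift of a generic closed curve with an even number of crossings changes sign along one
period. -/
theorem add_period_of_even (hc : IsLift γ c) (hγ : IsRegularCurve γ) (hl : HasPeriod γ l)
    (hgen : IsGeneric γ l) (heven : Even (crossings γ l)) (s : ℝ) : c (s + l) = -c s := by
  obtain ⟨σ, hσ, hper⟩ := hc.exists_sign hγ hl.2
  obtain ⟨r, hr⟩ := IsGeneric.exists_simple_point hl (hc.finite_crossingPairs hγ hl hgen 0)
    fun s t hs hst ht he => (hc.mem_crossingPairs_iff 0 (s, t)).2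
      ⟨hs, hst, ht.le, by simp only; linarith, by simpa using he⟩
  have hfin := hc.finite_crossingPairs hγ hl hgen r
  have hint : ∀ p ∈ SpinorCurve.crossingPairs (fun s => firstColumn c (r + s)) l,
      0 < p.1 ∧ p.2 < l := by
    intro p hp
    obtain ⟨p0, p1, p2, p3, p4⟩ := (hc.mem_crossingPairs_iff r p).1 hp
    constructor
    · refine p0.lt_of_ne fun h => ?_
      rw [← h, add_zero] at p4
      obtain ⟨k, hk⟩ := hr _ p4.symm
      exact not_exists_int_mul (by linarith) (by linarith)
        ⟨k, (add_sub_cancel_left r p.2).symm.trans hk⟩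
    · refine p2.lt_of_ne fun h => ?_
      rw [h, hl.2] at p4
      obtain ⟨k, hk⟩ := hr _ p4
      exact not_exists_int_mul (by linarith) (by linarith)
        ⟨k, (add_sub_cancel_left r p.1).symm.trans hk⟩
  have hsign := ((hc.spinorCurve hγ).shift r).holonomy_sign hl.1 hσ
    (fun s => by rw [← add_assoc, hper]) (Z := hfin.toFinset) (fun p => by
      rw [Set.Finite.mem_toFinset]; rfl) (fun p hp => hint p (hfin.mem_toFinset.1 hp))
    fun p hp => hc.im_ne_zero_of_mem_crossingPairs hγ hgen r p (hfin.mem_toFinset.1 hp)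
  rw [← Set.ncard_eq_toFinset_card _ hfin, hc.ncard_crossingPairs hl hgen hint, heven.neg_one_pow,
    mul_one] at hsign
  rw [hc.eq_spinorMatrix, hc.eq_spinorMatrix s, hper, ← spinorMatrix_neg, neg_eq_iff_eq_neg.1 hsign]
  congr 1
  exact neg_one_smul ℂ _

end IsLift

theorem inv_neg_of_mem {A : Mat2} (hA : A ∈ Matrix.specialUnitaryGroup (Fin 2) ℂ) :
    (-A)⁻¹ = -A⁻¹ := by
  have h := Matrix.mem_unitaryGroup_iff'.1 (Matrix.mem_specialUnitaryGroup_iff.1 hA).1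
  rw [inv_eq_conjTranspose hA]
  exact Matrix.inv_eq_left_inv (by rw [neg_mul_neg]; exact h)

theorem inv_mem_specialUnitaryGroup {A : Mat2} (hA : A ∈ Matrix.specialUnitaryGroup (Fin 2) ℂ) :
    A⁻¹ ∈ Matrix.specialUnitaryGroup (Fin 2) ℂ := by
  rw [inv_eq_conjTranspose hA]
  exact (star (⟨A, hA⟩ : Matrix.specialUnitaryGroup (Fin 2) ℂ)).2

theorem fmap_mem {γ1 γ2 : ℝ → R3} {c1 c2 : ℝ → Mat2} (hc1 : IsLift γ1 c1) (hc2 : IsLift γ2 c2)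
    (s1 s2 : ℝ) : fmap c1 c2 s1 s2 ∈ Matrix.specialUnitaryGroup (Fin 2) ℂ :=
  mul_mem (mul_mem (mul_mem (inv_mem_specialUnitaryGroup (hc1.mem 0)) (hc1.mem s1))
    (inv_mem_specialUnitaryGroup (hc2.mem s2))) (hc2.mem 0)

theorem distS3_neg_self {A : Mat2} (hA : A ∈ Matrix.specialUnitaryGroup (Fin 2) ℂ) :
    distS3 A (-A) = Real.pi := by
  have h := Matrix.mem_unitaryGroup_iff.1 (Matrix.mem_specialUnitaryGroup_iff.1 hA).1
  rw [Matrix.star_eq_conjTranspose] at h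
  simp [distS3, h]

theorem extDiam_eq_pi {γ1 γ2 : ℝ → R3} {c1 c2 : ℝ → Mat2} (hc1 : IsLift γ1 c1)
    (hc2 : IsLift γ2 c2) {s1 s2 u1 u2 : ℝ} (h : fmap c1 c2 u1 u2 = -fmap c1 c2 s1 s2) :
    extDiam c1 c2 = Real.pi := by
  refine IsGreatest.csSup_eq ⟨⟨s1, s2, u1, u2, ?_⟩, ?_⟩
  · rw [h, distS3_neg_self (fmap_mem hc1 hc2 s1 s2)]
  · rintro _ ⟨s1, s2, u1, u2, rfl⟩
    exact Real.arccos_le_pi _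

/-- Theorem B -/
theorem stmt12 (μ : ℝ) (γ1 γ2 : ℝ → R3) (l1 l2 : ℝ) (c1 c2 : ℝ → Mat2)
    (hμ : 0 < μ)
    (hreg1 : IsRegularCurve γ1) (hreg2 : IsRegularCurve γ2)
    (hper1 : HasPeriod γ1 l1) (hper2 : HasPeriod γ2 l2)
    (hadm1 : ∀ s, μ < kappa γ1 s) (hadm2 : ∀ s, kappa γ2 s < μ)
    (hpar1 : ∀ s, norm3 (deriv γ1 s) ^ 2 * (1 + kappa γ1 s ^ 2) = 4)
    (hpar2 : ∀ s, norm3 (deriv γ2 s) ^ 2 * (1 + kappa γ2 s ^ 2) = 4)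
    (hgen1 : IsGeneric γ1 l1) (hgen2 : IsGeneric γ2 l2)
    (hc1 : IsLift γ1 c1) (hc2 : IsLift γ2 c2)
    (hab : (Even (crossings γ1 l1) ∨ Even (crossings γ2 l2)) ∨
      (Odd (crossings γ1 l1) ∧ Odd (crossings γ2 l2) ∧
        (∃ a b, b - a < l1 ∧ IsNegativeShell γ1 a b) ∧
        ∃ a b, b - a < l2 ∧ IsPositiveShell γ2 a b)) :
    (∃ s1 s2 u1 u2 : ℝ, fmap c1 c2 u1 u2 = -fmap c1 c2 s1 s2) ∧
    extDiam c1 c2 = Real.pi := by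
  suffices h : ∃ s1 s2 u1 u2 : ℝ, fmap c1 c2 u1 u2 = -fmap c1 c2 s1 s2 by
    obtain ⟨s1, s2, u1, u2, h⟩ := h
    exact ⟨⟨s1, s2, u1, u2, h⟩, extDiam_eq_pi hc1 hc2 h⟩
  rcases hab with (h | h) | ⟨-, -, ⟨a, b, -, h⟩, a', b', -, h'⟩
  · refine ⟨0, 0, 0 + l1, 0, ?_⟩
    simp only [fmap]
    rw [hc1.add_period_of_even hreg1 hper1 hgen1 h, mul_neg, neg_mul, neg_mul]
  · refine ⟨0, 0, 0, 0 + l2, ?_⟩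
    simp only [fmap]
    rw [hc2.add_period_of_even hreg2 hper2 hgen2 h, inv_neg_of_mem (hc2.mem 0), mul_neg, neg_mul]
  · obtain ⟨s, s', t, t', he⟩ :=
      hc1.exists_antipodal_of_shells hc2 hreg1 hreg2 hadm1 hadm2 h h'
    have e : ∀ x y, fmap c1 c2 x y = (c1 0)⁻¹ * (c1 x * (c2 y)⁻¹) * c2 0 := fun x y => by
      simp only [fmap, mul_assoc]
    exact ⟨s, s', t, t', by rw [e, e, he, mul_neg, neg_mul]⟩
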